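/- arXiv:1107.1386 — 7 statements merged into one kernel-verified Lean document; each statement's English description precedes it below -/
import Mathlib

section
/- Let K be a Z-set in the Hilbert cube Q = ℕ → [0,1] (with the product topology and the metric d(x,y) = Σₙ 2⁻ⁿ |xₙ − yₙ|). Let Auth(Q,K) = {h : h is a homeomorphism of Q onto Q with h(K) = K} and Auth₀(Q,K) = {h ∈ Auth(Q,K) : h(x) = x for all x ∈ K}, both equipped with the topology of uniform convergence. Then there exists a closed subgroup G of Auth(Q,K) such that the map Φ : Auth₀(Q,K) × G → Auth(Q,K), Φ(u,v) = u ∘ v, is a homeomorphism. -/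
open Topology Set

/-- The Hilbert cube `Q = ℕ → [0,1]`, with the product topology. -/
abbrev HCube : Type := ℕ → unitInterval

/-- The metric `d(x,y) = Σₙ 2⁻ⁿ |xₙ - yₙ|` on the Hilbert cube. -/
noncomputable def hDist (x y : HCube) : ℝ :=
  ∑' n : ℕ, (2 : ℝ)⁻¹ ^ n * |(x n : ℝ) - (y n : ℝ)|

/-- `A` is of type `Z` in `Q`. -/
def IsZType (A : Set HCube) : Prop :=
  ∀ ε > (0 : ℝ), ∀ f : HCube → HCube, Continuous f →
    ∃ g : HCube → HCube, Continuous g ∧ Set.range g ∩ A = ∅ ∧ ∀ q, hDist (f q) (g q) < ε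

/-- A `Z`-set in `Q` is a closed set of type `Z`. -/
def IsZSet (A : Set HCube) : Prop := IsClosed A ∧ IsZType A

/-- The sup-metric `sup_{x ∈ Q} d(f(x), g(x))` on self-maps of `Q`. -/
noncomputable def supDist (f g : HCube → HCube) : ℝ := ⨆ x : HCube, hDist (f x) (g x)

/-- The topology of uniform convergence on `S`, where elements of `S` are regarded as
self-maps of `Q` via `F`: the topology generated by the balls of the sup-metric. -/
def unifTop {S : Type*} (F : S → HCube → HCube) : TopologicalSpace S :=
  TopologicalSpace.generateFrom
    {U : Set S | ∃ (c : S) (ε : ℝ), 0 < ε ∧ U = {g : S | supDist (F c) (F g) < ε}}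

/-- `Auth(Q,K)`: the group of self-homeomorphisms `h` of `Q` with `h(K) = K`. -/
def Auth (K : Set HCube) : Type := {h : HCube ≃ₜ HCube // (h : HCube → HCube) '' K = K}

/-- `Auth(Q,K)` carries the topology of uniform convergence. -/
noncomputable instance (K : Set HCube) : TopologicalSpace (Auth K) :=
  unifTop (fun h => (h.1 : HCube → HCube))

/-- `Auth₀(Q,K)`: those elements of `Auth(Q,K)` fixing `K` pointwise. -/
def Auth₀ (K : Set HCube) : Set (Auth K) := {h | ∀ x ∈ K, h.1 x = x}

/-- Composition `u ∘ v` in `Auth(Q,K)`. -/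
def authComp {K : Set HCube} (u v : Auth K) : Auth K :=
  ⟨v.1.trans u.1, by
    have h : ⇑(v.1.trans u.1) = (u.1 : HCube → HCube) ∘ (v.1 : HCube → HCube) := rfl
    rw [h, Set.image_comp, v.2, u.2]⟩

/-- The identity element of `Auth(Q,K)`. -/
def authId (K : Set HCube) : Auth K := ⟨Homeomorph.refl _, by simp⟩

/-- Inversion in `Auth(Q,K)`. -/
def authInv {K : Set HCube} (u : Auth K) : Auth K :=
  ⟨u.1.symm, by
    calc (u.1.symm : HCube → HCube) '' K
        = (u.1.symm : HCube → HCube) '' ((u.1 : HCube → HCube) '' K) := by rw [u.2]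
      _ = K := by rw [← Set.image_comp]; simp⟩

/-- The piecewise linear self-map of `[0,1]` fixing the end points and sending `a` to `b`. -/
noncomputable def plMap (a b t : ℝ) : ℝ := b * min t a / a + (1 - b) * max (t - a) 0 / (1 - a)

lemma plMap_of_le {a b t : ℝ} (h : t ≤ a) : plMap a b t = b * t / a := by
  simp [plMap, min_eq_left h, max_eq_right (sub_nonpos.2 h)]

lemma plMap_of_ge {a b t : ℝ} (ha : 0 < a) (h : a ≤ t) :
    plMap a b t = b + (1 - b) * (t - a) / (1 - a) := by
  simp [plMap, min_eq_right h, max_eq_left (sub_nonneg.2 h), ha.ne']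

lemma plMap_self {a b : ℝ} (ha : 0 < a) : plMap a b a = b := by
  rw [plMap_of_le le_rfl, mul_div_assoc, div_self ha.ne', mul_one]

lemma plMap_plMap {a b t : ℝ} (ha : a ∈ Ioo (0 : ℝ) 1) (hb : b ∈ Ioo (0 : ℝ) 1) :
    plMap b a (plMap a b t) = t := by
  have ha' : 0 < 1 - a := sub_pos.2 ha.2
  have hb' : 0 < 1 - b := sub_pos.2 hb.2
  have ha0 := ha.1
  have hb0 := hb.1
  rcases le_total t a with h | h
  · rw [plMap_of_le h, plMap_of_le]
    · field_simp
    · rw [div_le_iff₀ ha0]; nlinarith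
  · rw [plMap_of_ge ha0 h, plMap_of_ge hb0]
    · field_simp
      ring
    · have : 0 ≤ (1 - b) * (t - a) / (1 - a) :=
        div_nonneg (mul_nonneg hb'.le (sub_nonneg.2 h)) ha'.le
      linarith

lemma plMap_mem_Icc {a b t : ℝ} (ha : a ∈ Ioo (0 : ℝ) 1) (hb : b ∈ Ioo (0 : ℝ) 1)
    (ht : t ∈ Icc (0 : ℝ) 1) : plMap a b t ∈ Icc (0 : ℝ) 1 := by
  obtain ⟨ha0, ha1⟩ := ha
  obtain ⟨hb0, hb1⟩ := hb
  obtain ⟨ht0, ht1⟩ := ht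
  have ha' : 0 < 1 - a := sub_pos.2 ha1
  rcases le_total t a with h | h
  · rw [plMap_of_le h]
    refine ⟨by positivity, ?_⟩
    rw [div_le_iff₀ ha0]; nlinarith
  · rw [plMap_of_ge ha0 h]
    have h1 : 0 ≤ (1 - b) * (t - a) / (1 - a) :=
      div_nonneg (mul_nonneg (by linarith) (sub_nonneg.2 h)) ha'.le
    have h2 : (1 - b) * (t - a) / (1 - a) ≤ 1 - b := by
      rw [div_le_iff₀ ha']; nlinarith
    constructor <;> linarith

lemma plMap_mem_Ioo {a b t : ℝ} (ha : a ∈ Ioo (0 : ℝ) 1) (hb : b ∈ Ioo (0 : ℝ) 1)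
    (ht : t ∈ Ioo (0 : ℝ) 1) : plMap a b t ∈ Ioo (0 : ℝ) 1 := by
  obtain ⟨ha0, ha1⟩ := ha
  obtain ⟨hb0, hb1⟩ := hb
  obtain ⟨ht0, ht1⟩ := ht
  have ha' : 0 < 1 - a := sub_pos.2 ha1
  rcases le_total t a with h | h
  · rw [plMap_of_le h]
    refine ⟨by positivity, ?_⟩
    rw [div_lt_iff₀ ha0]; nlinarith
  · rw [plMap_of_ge ha0 h]
    have h1 : 0 ≤ (1 - b) * (t - a) / (1 - a) :=
      div_nonneg (mul_nonneg (by linarith) (sub_nonneg.2 h)) ha'.le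
    have h2 : (1 - b) * (t - a) / (1 - a) < 1 - b := by
      rw [div_lt_iff₀ ha']; nlinarith
    constructor <;> linarith

lemma abs_plMap_sub_self_le {a b t : ℝ} (ha : a ∈ Ioo (0 : ℝ) 1) (ht : t ∈ Icc (0 : ℝ) 1) :
    |plMap a b t - t| ≤ |a - b| := by
  obtain ⟨ha0, ha1⟩ := ha
  obtain ⟨ht0, ht1⟩ := ht
  have ha' : 0 < 1 - a := sub_pos.2 ha1
  rcases le_total t a with h | h
  · have : plMap a b t - t = (b - a) * (t / a) := by
      rw [plMap_of_le h]; field_simp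
    rw [this, abs_mul, abs_sub_comm a b]
    refine mul_le_of_le_one_right (abs_nonneg _) ?_
    rw [abs_of_nonneg (by positivity), div_le_one ha0]
    exact h
  · have : plMap a b t - t = (b - a) * ((1 - t) / (1 - a)) := by
      rw [plMap_of_ge ha0 h]; field_simp; ring
    rw [this, abs_mul, abs_sub_comm a b]
    refine mul_le_of_le_one_right (abs_nonneg _) ?_
    rw [abs_of_nonneg (div_nonneg (by linarith) ha'.le), div_le_one ha']
    linarith

lemma abs_plMap_sub_le {a b t δ : ℝ} (hδ : 0 < δ) (ha : a ∈ Icc δ (1 - δ))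
    (hb : b ∈ Icc (0 : ℝ) 1) : |plMap a b t - b| ≤ |t - a| / δ := by
  obtain ⟨ha0, ha1⟩ := ha
  obtain ⟨hb0, hb1⟩ := hb
  have hapos : 0 < a := by linarith
  have ha' : 0 < 1 - a := by linarith
  rcases le_total t a with h | h
  · have : plMap a b t - b = (t - a) * (b / a) := by
      rw [plMap_of_le h]; field_simp
    rw [this, abs_mul, div_eq_mul_one_div |t - a| δ]
    refine mul_le_mul_of_nonneg_left ?_ (abs_nonneg _)
    rw [abs_of_nonneg (by positivity)]
    exact div_le_div₀ zero_le_one hb1 hδ ha0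
  · have : plMap a b t - b = (t - a) * ((1 - b) / (1 - a)) := by
      rw [plMap_of_ge hapos h]; field_simp; ring
    rw [this, abs_mul, div_eq_mul_one_div |t - a| δ]
    refine mul_le_mul_of_nonneg_left ?_ (abs_nonneg _)
    rw [abs_of_nonneg (div_nonneg (by linarith) ha'.le)]
    exact div_le_div₀ zero_le_one (by linarith) hδ (by linarith)

lemma plMap_mono {a b t s : ℝ} (ha : a ∈ Ioo (0 : ℝ) 1) (hb : b ∈ Ioo (0 : ℝ) 1) (h : t ≤ s) :
    plMap a b t ≤ plMap a b s := by
  have ha' : 0 < 1 - a := sub_pos.2 ha.2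
  have hb' : 0 < 1 - b := sub_pos.2 hb.2
  have ha0 := ha.1
  have hb0 := hb.1
  unfold plMap
  gcongr

/-- `plMap` as a self-map of the unit interval. -/
noncomputable def plI (a b : Ioo (0 : ℝ) 1) (t : unitInterval) : unitInterval :=
  ⟨plMap a b t, plMap_mem_Icc a.2 b.2 t.2⟩

lemma plI_plI (a b : Ioo (0 : ℝ) 1) (t : unitInterval) : plI b a (plI a b t) = t :=
  Subtype.ext (plMap_plMap a.2 b.2)

lemma plI_mem_Ioo (a b : Ioo (0 : ℝ) 1) {t : unitInterval} (ht : (t : ℝ) ∈ Ioo (0 : ℝ) 1) :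
    (plI a b t : ℝ) ∈ Ioo (0 : ℝ) 1 := plMap_mem_Ioo a.2 b.2 ht

lemma continuous_plI : Continuous
    (fun p : Ioo (0 : ℝ) 1 × Ioo (0 : ℝ) 1 × unitInterval => plI p.1 p.2.1 p.2.2) := by
  refine Continuous.subtype_mk ?_ _
  unfold plMap
  refine Continuous.add (Continuous.div (by fun_prop) (by fun_prop) fun p => p.1.2.1.ne')
    (Continuous.div (by fun_prop) (by fun_prop) fun p => (sub_pos.2 p.1.2.2).ne')

lemma Continuous.plI {X : Type*} [TopologicalSpace X] {a b : X → Ioo (0 : ℝ) 1}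
    {t : X → unitInterval} (ha : Continuous a) (hb : Continuous b) (ht : Continuous t) :
    Continuous fun x => plI (a x) (b x) (t x) :=
  continuous_plI.comp (ha.prodMk (hb.prodMk ht))

/-- `plI a b` as a homeomorphism of the unit interval. -/
noncomputable def plHomeo (a b : Ioo (0 : ℝ) 1) : unitInterval ≃ₜ unitInterval where
  toFun := plI a b
  invFun := plI b a
  left_inv := plI_plI a b
  right_inv := plI_plI b a
  continuous_toFun := continuous_const.plI continuous_const continuous_id
  continuous_invFun := continuous_const.plI continuous_const continuous_id

/-- The midpoint of the unit interval. -/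
noncomputable def midI : Ioo (0 : ℝ) 1 := ⟨1 / 2, by norm_num, by norm_num⟩

/-- A compact part of the open interval can be squeezed towards the midpoint. -/
lemma exists_squeeze {p q κ : ℝ} (hp : 0 < p) (hq : q < 1) (hκ : 0 < κ) :
    ∃ σ : unitInterval ≃ₜ unitInterval,
      (∀ t : unitInterval, (t : ℝ) ∈ Icc p q → |(σ t : ℝ) - 1 / 2| ≤ κ) ∧
      ∀ t : unitInterval, (t : ℝ) ∈ Ioo (0 : ℝ) 1 → (σ t : ℝ) ∈ Ioo (0 : ℝ) 1 := by
  by_cases hpq : p ≤ q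
  · have hp1 : p ∈ Ioo (0 : ℝ) 1 := ⟨hp, by linarith⟩
    have hq1 : q ∈ Ioo (0 : ℝ) 1 := ⟨by linarith, hq⟩
    set c : ℝ := min κ (1 / 2) with hc
    have hc0 : 0 < c := lt_min hκ (by norm_num)
    have hc2 : c ≤ 1 / 2 := min_le_right _ _
    have hc1 : c ∈ Ioo (0 : ℝ) 1 := ⟨hc0, by linarith⟩
    have hd : plMap q c p ∈ Ioo (0 : ℝ) 1 := plMap_mem_Ioo hq1 hc1 hp1
    have hdc : plMap q c p ≤ c := by
      conv_rhs => rw [← plMap_self (b := c) hq1.1]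
      exact plMap_mono hq1 hc1 hpq
    refine ⟨(plHomeo ⟨q, hq1⟩ ⟨c, hc1⟩).trans (plHomeo ⟨_, hd⟩ midI), ?_, ?_⟩
    · intro t ht
      have e1 : (((plHomeo ⟨q, hq1⟩ ⟨c, hc1⟩).trans (plHomeo ⟨_, hd⟩ midI)) t : ℝ) =
        plMap (plMap q c p) (1 / 2) (plMap q c t) := rfl
      rw [e1]
      have h1 : plMap q c p ≤ plMap q c t := plMap_mono hq1 hc1 ht.1
      have h2 : plMap q c t ≤ c := by
        conv_rhs => rw [← plMap_self (b := c) hq1.1]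
        exact plMap_mono hq1 hc1 ht.2
      rw [plMap_of_ge hd.1 h1]
      have hd' : 0 < 1 - plMap q c p := sub_pos.2 hd.2
      have h3 : 0 ≤ (1 - 1 / 2) * (plMap q c t - plMap q c p) / (1 - plMap q c p) :=
        div_nonneg (mul_nonneg (by norm_num) (by linarith)) hd'.le
      have h4 : (1 - 1 / 2) * (plMap q c t - plMap q c p) / (1 - plMap q c p) ≤ c := by
        rw [div_le_iff₀ hd']
        nlinarith [hd.1]
      rw [abs_le]
      have := min_le_left κ (1 / 2)
      constructor <;> linarith
    · intro t ht
      exact plI_mem_Ioo _ _ (plI_mem_Ioo _ _ ht)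
  · exact ⟨Homeomorph.refl _, fun t ht => absurd (ht.1.trans ht.2) hpq, fun t ht => ht⟩

/-- A coordinatewise change of the coordinates in `A`, controlled by those outside `A`. -/
def shearHomeo {ι : Type*} (A : Set ι) (f g : (ι → unitInterval) → ι → unitInterval → unitInterval)
    (hf : ∀ i, Continuous fun p : (ι → unitInterval) × unitInterval => f p.1 i p.2)
    (hg : ∀ i, Continuous fun p : (ι → unitInterval) × unitInterval => g p.1 i p.2)
    (hf' : ∀ x y, (∀ i, i ∉ A → x i = y i) → f x = f y)
    (hg' : ∀ x y, (∀ i, i ∉ A → x i = y i) → g x = g y)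
    (hfA : ∀ x i t, i ∉ A → f x i t = t) (hgA : ∀ x i t, i ∉ A → g x i t = t)
    (hgf : ∀ x i t, g x i (f x i t) = t) (hfg : ∀ x i t, f x i (g x i t) = t) :
    (ι → unitInterval) ≃ₜ (ι → unitInterval) where
  toFun x i := f x i (x i)
  invFun x i := g x i (x i)
  left_inv x := by
    funext i
    have : g (fun i => f x i (x i)) = g x := hg' _ _ fun i hi => hfA x i _ hi
    simp only [this, hgf]
  right_inv x := by
    funext i
    have : f (fun i => g x i (x i)) = f x := hf' _ _ fun i hi => hgA x i _ hi
    simp only [this, hfg]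
  continuous_toFun := continuous_pi fun i => (hf i).comp (continuous_id.prodMk (continuous_apply i))
  continuous_invFun :=
    continuous_pi fun i => (hg i).comp (continuous_id.prodMk (continuous_apply i))

/-- A change of the second factor of a product, controlled by the first factor. -/
def fiberHomeo {X ι : Type*} [TopologicalSpace X] (f g : X → ι → unitInterval → unitInterval)
    (hf : ∀ i, Continuous fun p : X × unitInterval => f p.1 i p.2)
    (hg : ∀ i, Continuous fun p : X × unitInterval => g p.1 i p.2)
    (hgf : ∀ x i t, g x i (f x i t) = t) (hfg : ∀ x i t, f x i (g x i t) = t) :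
    X × (ι → unitInterval) ≃ₜ X × (ι → unitInterval) where
  toFun p := (p.1, fun i => f p.1 i (p.2 i))
  invFun p := (p.1, fun i => g p.1 i (p.2 i))
  left_inv p := by simp [hgf]
  right_inv p := by simp [hfg]
  continuous_toFun := continuous_fst.prodMk <| continuous_pi fun i =>
    (hf i).comp (continuous_fst.prodMk ((continuous_apply i).comp continuous_snd))
  continuous_invFun := continuous_fst.prodMk <| continuous_pi fun i =>
    (hg i).comp (continuous_fst.prodMk ((continuous_apply i).comp continuous_snd))

/-- The shear `(ρ, τ) ↦ (ρ, τ + k ρ)`. -/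
def shearMap (k : ℝ) (p : ℝ × ℝ) : ℝ × ℝ := (p.1, p.2 + k * p.1)

/-- The shear `(ρ, τ) ↦ (ρ, τ + k ρ)`, rescaled so as to preserve the sup norm. -/
noncomputable def bend (k : ℝ) (p : ℝ × ℝ) : ℝ × ℝ := (‖p‖ / ‖shearMap k p‖) • shearMap k p

lemma shearMap_smul (k c : ℝ) (p : ℝ × ℝ) : shearMap k (c • p) = c • shearMap k p := by
  ext <;> simp [shearMap]; ring

lemma shearMap_neg_shearMap (k : ℝ) (p : ℝ × ℝ) : shearMap (-k) (shearMap k p) = p := by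
  ext <;> simp [shearMap]

lemma shearMap_eq_zero {k : ℝ} {p : ℝ × ℝ} : shearMap k p = 0 ↔ p = 0 := by
  constructor
  · intro h
    rw [← shearMap_neg_shearMap k p, h]
    ext <;> simp [shearMap]
  · rintro rfl
    ext <;> simp [shearMap]

lemma norm_bend (k : ℝ) (p : ℝ × ℝ) : ‖bend k p‖ = ‖p‖ := by
  by_cases h : p = 0
  · simp [bend, h]
  · have : ‖shearMap k p‖ ≠ 0 := by simpa [shearMap_eq_zero] using h
    rw [bend, norm_smul, norm_div, norm_norm, norm_norm, div_mul_cancel₀ _ this]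

lemma bend_neg_bend (k : ℝ) (p : ℝ × ℝ) : bend (-k) (bend k p) = p := by
  by_cases h : p = 0
  · simp [bend, h]
  · have h1 : ‖shearMap k p‖ ≠ 0 := by simpa [shearMap_eq_zero] using h
    have h2 : ‖p‖ ≠ 0 := by simpa using h
    have h3 : shearMap (-k) (bend k p) = (‖p‖ / ‖shearMap k p‖) • p := by
      rw [bend, shearMap_smul, shearMap_neg_shearMap]
    rw [bend, norm_bend, h3, norm_smul, norm_div, norm_norm, norm_norm, smul_smul]
    convert one_smul ℝ p
    field_simp

lemma continuous_shearMap (k : ℝ) : Continuous (shearMap k) := by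
  unfold shearMap; fun_prop

lemma continuous_bend (k : ℝ) : Continuous (bend k) := by
  rw [continuous_iff_continuousAt]
  intro p
  by_cases h : p = 0
  · subst h
    rw [ContinuousAt, show bend k 0 = 0 by simp [bend]]
    rw [tendsto_zero_iff_norm_tendsto_zero]
    simp only [norm_bend]
    simpa using (continuous_norm (E := ℝ × ℝ)).tendsto 0
  · have h1 : ‖shearMap k p‖ ≠ 0 := by simpa [shearMap_eq_zero] using h
    exact ContinuousAt.smul (continuous_norm.continuousAt.div
      (continuous_shearMap k).norm.continuousAt h1) (continuous_shearMap k).continuousAt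

lemma bend_of_fst_eq_zero {k : ℝ} {p : ℝ × ℝ} (h : p.1 = 0) : bend k p = p := by
  have : shearMap k p = p := by ext <;> simp [shearMap, h]
  rw [bend, this]
  by_cases hp : p = 0
  · simp [hp]
  · rw [div_self (by simpa using hp), one_smul]

lemma bend_fst (k : ℝ) (p : ℝ × ℝ) : (bend k p).1 = ‖p‖ / ‖shearMap k p‖ * p.1 := rfl

lemma bend_fst_nonneg {k : ℝ} {p : ℝ × ℝ} (h : 0 ≤ p.1) : 0 ≤ (bend k p).1 := by
  rw [bend_fst]; positivity

lemma bend_three_side {τ : ℝ} (h : |τ| ≤ 1) : bend 3 (1, τ) = (1 / (τ + 3), 1) := by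
  obtain ⟨h1, h2⟩ := abs_le.1 h
  have e1 : ‖((1 : ℝ), τ)‖ = 1 := by simp [Prod.norm_def, h]
  have e2 : ‖shearMap 3 ((1 : ℝ), τ)‖ = τ + 3 := by
    have : (0 : ℝ) ≤ τ + 3 := by linarith
    simp only [shearMap, Prod.norm_def, Real.norm_eq_abs, mul_one, abs_one, abs_of_nonneg this]
    exact max_eq_right (by linarith)
  have h3 : τ + 3 ≠ 0 := by linarith
  rw [bend, e1, e2]
  ext <;> simp [shearMap, h3]

lemma bend_three_top {ρ : ℝ} (h0 : 0 ≤ ρ) (h1 : ρ ≤ 1) :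
    bend 3 (ρ, 1) = (ρ / (1 + 3 * ρ), 1) := by
  have e1 : ‖(ρ, (1 : ℝ))‖ = 1 := by simp [Prod.norm_def, abs_of_nonneg h0, h1]
  have e2 : ‖shearMap 3 (ρ, (1 : ℝ))‖ = 1 + 3 * ρ := by
    have : (0 : ℝ) ≤ 1 + 3 * ρ := by linarith
    simp only [shearMap, Prod.norm_def, Real.norm_eq_abs, abs_of_nonneg this, abs_of_nonneg h0]
    exact max_eq_right (by linarith)
  have h3 : 1 + 3 * ρ ≠ 0 := by linarith
  rw [bend, e1, e2]
  ext
  · simp [shearMap]; field_simp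
  · simp [shearMap, h3]

/-- The relative position of `a` in the strip `[1 - ε, 1]`. -/
noncomputable def stripPos (ε a : ℝ) : ℝ := max 0 ((a - (1 - ε)) / ε)

lemma stripPos_nonneg (ε a : ℝ) : 0 ≤ stripPos ε a := le_max_left _ _

lemma stripPos_le_one {ε a : ℝ} (hε : 0 < ε) (ha : a ≤ 1) : stripPos ε a ≤ 1 :=
  max_le zero_le_one (by rw [div_le_one hε]; linarith)

/-- Bending of the square, supported in the strip `1 - ε ≤ a`, as a map of the plane. -/
noncomputable def bendStrip (ε k : ℝ) (p : ℝ × ℝ) : ℝ × ℝ :=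
  (p.1 + ε * ((bend k (stripPos ε p.1, 2 * p.2 - 1)).1 - stripPos ε p.1),
    ((bend k (stripPos ε p.1, 2 * p.2 - 1)).2 + 1) / 2)

lemma continuous_bendStrip (ε k : ℝ) : Continuous (bendStrip ε k) := by
  have h1 : Continuous (stripPos ε) := by unfold stripPos; fun_prop
  have h2 : Continuous fun p : ℝ × ℝ => bend k (stripPos ε p.1, 2 * p.2 - 1) :=
    (continuous_bend k).comp (by fun_prop)
  have h3 : Continuous fun p : ℝ × ℝ => stripPos ε p.1 := h1.comp continuous_fst
  exact (continuous_fst.add (continuous_const.mul (h2.fst.sub h3))).prodMk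
    ((h2.snd.add continuous_const).div_const 2)

lemma stripPos_bendStrip {ε k : ℝ} (hε : 0 < ε) (p : ℝ × ℝ) :
    stripPos ε (bendStrip ε k p).1 = (bend k (stripPos ε p.1, 2 * p.2 - 1)).1 := by
  rcases le_or_gt p.1 (1 - ε) with h | h
  · have h0 : stripPos ε p.1 = 0 :=
      max_eq_left (div_nonpos_of_nonpos_of_nonneg (by linarith) hε.le)
    have h1 : (bendStrip ε k p).1 = p.1 := by simp [bendStrip, h0, bend_of_fst_eq_zero]
    rw [h1, h0, bend_of_fst_eq_zero rfl]
  · have h0 : stripPos ε p.1 = (p.1 - (1 - ε)) / ε :=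
      max_eq_right (div_nonneg (by linarith) hε.le)
    have h1 : (bendStrip ε k p).1 =
        1 - ε + ε * (bend k (stripPos ε p.1, 2 * p.2 - 1)).1 := by
      simp only [bendStrip]
      rw [mul_sub, h0, mul_div_cancel₀ _ hε.ne']
      ring
    rw [h1, stripPos, max_eq_right]
    · field_simp; ring
    · have h2 : 0 ≤ (bend k (stripPos ε p.1, 2 * p.2 - 1)).1 :=
        bend_fst_nonneg (stripPos_nonneg ε p.1)
      refine div_nonneg ?_ hε.le
      nlinarith

lemma bendStrip_neg_bendStrip {ε k : ℝ} (hε : 0 < ε) (p : ℝ × ℝ) :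
    bendStrip ε (-k) (bendStrip ε k p) = p := by
  have h1 := stripPos_bendStrip (k := k) hε p
  have h2 : 2 * (bendStrip ε k p).2 - 1 = (bend k (stripPos ε p.1, 2 * p.2 - 1)).2 := by
    simp only [bendStrip]; ring
  have h3 : bend (-k) (stripPos ε (bendStrip ε k p).1, 2 * (bendStrip ε k p).2 - 1) =
      (stripPos ε p.1, 2 * p.2 - 1) := by
    rw [h1, h2, Prod.mk.eta, bend_neg_bend]
  rw [bendStrip, h3, h1]
  ext
  · simp only [bendStrip]; ring
  · simp

lemma abs_two_mul_sub_one_le {t : ℝ} (ht : t ∈ Icc (0 : ℝ) 1) : |2 * t - 1| ≤ 1 := by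
  rw [abs_le]; constructor <;> linarith [ht.1, ht.2]

lemma norm_strip_le {ε : ℝ} (hε : 0 < ε) {p : ℝ × ℝ} (h1 : p.1 ≤ 1)
    (h2 : p.2 ∈ Icc (0 : ℝ) 1) : ‖(stripPos ε p.1, 2 * p.2 - 1)‖ ≤ 1 := by
  rw [Prod.norm_def]
  refine max_le ?_ (abs_two_mul_sub_one_le h2)
  rw [Real.norm_eq_abs, abs_of_nonneg (stripPos_nonneg _ _)]
  exact stripPos_le_one hε h1

lemma bend_fst_le_one {ε k : ℝ} (hε : 0 < ε) {p : ℝ × ℝ} (h1 : p.1 ≤ 1)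
    (h2 : p.2 ∈ Icc (0 : ℝ) 1) : (bend k (stripPos ε p.1, 2 * p.2 - 1)).1 ≤ 1 :=
  (le_abs_self _).trans ((norm_fst_le _).trans ((norm_bend _ _).le.trans (norm_strip_le hε h1 h2)))

lemma bendStrip_fst_of_le {ε k : ℝ} (hε : 0 < ε) {p : ℝ × ℝ} (h : p.1 ≤ 1 - ε) :
    bendStrip ε k p = p := by
  have h0 : stripPos ε p.1 = 0 :=
    max_eq_left (div_nonpos_of_nonpos_of_nonneg (by linarith) hε.le)
  ext <;> simp [bendStrip, h0, bend_of_fst_eq_zero]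

lemma bendStrip_fst_of_ge {ε k : ℝ} (hε : 0 < ε) {p : ℝ × ℝ} (h : 1 - ε ≤ p.1) :
    (bendStrip ε k p).1 = 1 - ε + ε * (bend k (stripPos ε p.1, 2 * p.2 - 1)).1 := by
  have h0 : stripPos ε p.1 = (p.1 - (1 - ε)) / ε :=
    max_eq_right (div_nonneg (by linarith) hε.le)
  simp only [bendStrip]
  rw [mul_sub, h0, mul_div_cancel₀ _ hε.ne']
  ring

lemma bendStrip_mem {ε k : ℝ} (hε : 0 < ε) (hε1 : ε ≤ 1) {p : ℝ × ℝ}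
    (h1 : p.1 ∈ Icc (0 : ℝ) 1) (h2 : p.2 ∈ Icc (0 : ℝ) 1) :
    (bendStrip ε k p).1 ∈ Icc (0 : ℝ) 1 ∧ (bendStrip ε k p).2 ∈ Icc (0 : ℝ) 1 := by
  constructor
  · rcases le_total p.1 (1 - ε) with h | h
    · rw [bendStrip_fst_of_le hε h]; exact h1
    · rw [bendStrip_fst_of_ge hε h]
      have e1 := bend_fst_le_one (k := k) hε h1.2 h2
      have e2 : 0 ≤ (bend k (stripPos ε p.1, 2 * p.2 - 1)).1 :=
        bend_fst_nonneg (stripPos_nonneg ε p.1)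
      constructor <;> nlinarith
  · have e1 : |(bend k (stripPos ε p.1, 2 * p.2 - 1)).2| ≤ 1 :=
      (norm_snd_le _).trans ((norm_bend _ _).le.trans (norm_strip_le hε h1.2 h2))
    obtain ⟨e2, e3⟩ := abs_le.1 e1
    simp only [bendStrip]
    constructor <;> linarith

/-- Bending of the unit square near its right-hand edge. -/
noncomputable def bendHomeo (ε : ℝ) (hε : 0 < ε) (hε1 : ε ≤ 1) :
    unitInterval × unitInterval ≃ₜ unitInterval × unitInterval where
  toFun p := (⟨_, (bendStrip_mem (k := 3) (p := (p.1.1, p.2.1)) hε hε1 p.1.2 p.2.2).1⟩,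
    ⟨_, (bendStrip_mem (k := 3) (p := (p.1.1, p.2.1)) hε hε1 p.1.2 p.2.2).2⟩)
  invFun p := (⟨_, (bendStrip_mem (k := -3) (p := (p.1.1, p.2.1)) hε hε1 p.1.2 p.2.2).1⟩,
    ⟨_, (bendStrip_mem (k := -3) (p := (p.1.1, p.2.1)) hε hε1 p.1.2 p.2.2).2⟩)
  left_inv p := by
    ext
    · exact congrArg Prod.fst (bendStrip_neg_bendStrip (k := 3) hε (p.1.1, p.2.1))
    · exact congrArg Prod.snd (bendStrip_neg_bendStrip (k := 3) hε (p.1.1, p.2.1))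
  right_inv p := by
    have := bendStrip_neg_bendStrip (k := -3) hε (p.1.1, p.2.1)
    rw [neg_neg] at this
    ext
    · exact congrArg Prod.fst this
    · exact congrArg Prod.snd this
  continuous_toFun := by
    have h : Continuous fun p : unitInterval × unitInterval =>
      bendStrip ε 3 ((p.1 : ℝ), (p.2 : ℝ)) := (continuous_bendStrip ε 3).comp (by fun_prop)
    exact (h.fst.subtype_mk _).prodMk (h.snd.subtype_mk _)
  continuous_invFun := by
    have h : Continuous fun p : unitInterval × unitInterval =>
      bendStrip ε (-3) ((p.1 : ℝ), (p.2 : ℝ)) := (continuous_bendStrip ε (-3)).comp (by fun_prop)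
    exact (h.fst.subtype_mk _).prodMk (h.snd.subtype_mk _)

section bendHomeo

variable {ε : ℝ} (hε : 0 < ε) (hε1 : ε ≤ 1) (p : unitInterval × unitInterval)

lemma bendHomeo_fst : ((bendHomeo ε hε hε1 p).1 : ℝ) = (bendStrip ε 3 ((p.1 : ℝ), (p.2 : ℝ))).1 :=
  rfl

lemma bendHomeo_snd : ((bendHomeo ε hε hε1 p).2 : ℝ) = (bendStrip ε 3 ((p.1 : ℝ), (p.2 : ℝ))).2 :=
  rfl

lemma bendHomeo_of_le (h : (p.1 : ℝ) ≤ 1 - ε) : bendHomeo ε hε hε1 p = p := by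
  have := bendStrip_fst_of_le (k := 3) (p := ((p.1 : ℝ), (p.2 : ℝ))) hε h
  ext
  · rw [bendHomeo_fst, this]
  · rw [bendHomeo_snd, this]

lemma le_bendHomeo_fst (h : 1 - ε ≤ (p.1 : ℝ)) : 1 - ε ≤ ((bendHomeo ε hε hε1 p).1 : ℝ) := by
  rw [bendHomeo_fst, bendStrip_fst_of_ge hε h]
  have e2 : 0 ≤ (bend 3 (stripPos ε (p.1 : ℝ), 2 * (p.2 : ℝ) - 1)).1 :=
    bend_fst_nonneg (stripPos_nonneg ε _)
  nlinarith

lemma abs_bendHomeo_fst_sub_le : |((bendHomeo ε hε hε1 p).1 : ℝ) - p.1| ≤ ε := by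
  rcases le_total (p.1 : ℝ) (1 - ε) with h | h
  · rw [bendHomeo_of_le _ _ _ h]; simpa using hε.le
  · have h1 := le_bendHomeo_fst hε hε1 p h
    have h2 := (bendHomeo ε hε hε1 p).1.2.2
    have h3 := p.1.2.2
    rw [abs_le]; constructor <;> linarith

lemma bendHomeo_snd_of_one (h : p.1 = 1) : (bendHomeo ε hε hε1 p).2 = 1 := by
  ext
  rw [bendHomeo_snd]
  have : stripPos ε 1 = 1 := by
    rw [stripPos, sub_sub_cancel, div_self hε.ne', max_eq_right zero_le_one]
  simp [bendStrip, h, this, bend_three_side (abs_two_mul_sub_one_le p.2.2)]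

lemma bendHomeo_of_snd_one (h : p.2 = 1) :
    (bendHomeo ε hε hε1 p).2 = 1 ∧ ((bendHomeo ε hε hε1 p).1 : ℝ) ≤ 1 - ε / 2 := by
  have h0 := stripPos_nonneg ε p.1
  have h1 := stripPos_le_one hε p.1.2.2
  have e : bend 3 (stripPos ε p.1, 2 * 1 - 1) =
      (stripPos ε p.1 / (1 + 3 * stripPos ε p.1), 1) := by
    rw [show (2 : ℝ) * 1 - 1 = 1 by norm_num, bend_three_top h0 h1]
  constructor
  · ext
    rw [bendHomeo_snd, bendStrip]
    simp only [h, Icc.coe_one, e]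
    norm_num
  · rcases le_total (p.1 : ℝ) (1 - ε) with h' | h'
    · rw [bendHomeo_of_le _ _ _ h']; linarith
    · rw [bendHomeo_fst, bendStrip_fst_of_ge hε h']
      simp only [h, Icc.coe_one, e]
      have : stripPos ε p.1 / (1 + 3 * stripPos ε p.1) ≤ 1 / 2 := by
        rw [div_le_iff₀ (by linarith)]; linarith
      nlinarith

end bendHomeo

/-- A homeomorphism of the square moving the first coordinate at most `2 * ε`, sending both
vertical edges into the top edge, and the top edge into its own interior. -/
lemma exists_square_homeo {ε : ℝ} (hε : 0 < ε) (hε1 : ε ≤ 1 / 4) :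
    ∃ H : unitInterval × unitInterval ≃ₜ unitInterval × unitInterval,
      (∀ p, |((H p).1 : ℝ) - p.1| ≤ 2 * ε) ∧
      (∀ p, p.1 = 0 ∨ p.1 = 1 → (H p).2 = 1) ∧
      ∀ p, p.2 = 1 → (H p).2 = 1 ∧ ((H p).1 : ℝ) ∈ Icc (ε / 2) (1 - ε / 2) := by
  have hε2 : ε ≤ 1 := by linarith
  let F : unitInterval × unitInterval ≃ₜ unitInterval × unitInterval :=
    Homeomorph.prodCongr unitInterval.symmHomeomorph (Homeomorph.refl _)
  let B := bendHomeo ε hε hε2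
  have hF : ∀ p, F p = (unitInterval.symm p.1, p.2) := fun p => rfl
  have hF1 : ∀ p, ((F p).1 : ℝ) = 1 - p.1 := fun p => rfl
  refine ⟨((B.trans F).trans B).trans F, fun p => ?_, fun p hp => ?_, fun p hp => ?_⟩
  · change |((F (B (F (B p)))).1 : ℝ) - p.1| ≤ 2 * ε
    rw [hF1]
    have h1 := abs_le.1 (abs_bendHomeo_fst_sub_le hε hε2 (F (B p)))
    have h2 := abs_le.1 (abs_bendHomeo_fst_sub_le hε hε2 p)
    rw [hF1] at h1
    rw [abs_le]
    constructor <;> linarith [h1.1, h1.2, h2.1, h2.2]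
  · change (B (F (B p))).2 = 1
    rcases hp with hp | hp
    · have : B p = p := bendHomeo_of_le hε hε2 p (by rw [hp, Icc.coe_zero]; linarith)
      rw [this]
      exact bendHomeo_snd_of_one hε hε2 _ (by simp [hF, hp])
    · exact (bendHomeo_of_snd_one hε hε2 (F (B p)) (bendHomeo_snd_of_one hε hε2 p hp)).1
  · have h1 := bendHomeo_of_snd_one hε hε2 p hp
    have h2 := bendHomeo_of_snd_one hε hε2 (F (B p)) h1.1
    refine ⟨h2.1, ?_⟩
    change ((F (B (F (B p)))).1 : ℝ) ∈ _
    rw [hF1]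
    refine ⟨by linarith [h2.2], ?_⟩
    rcases le_total (((F (B p)).1 : unitInterval) : ℝ) (1 - ε) with h | h
    · have h3 : B (F (B p)) = F (B p) := bendHomeo_of_le hε hε2 _ h
      rw [h3, hF1]
      have := h1.2
      change ((B p).1 : ℝ) ≤ _ at this
      linarith
    · have h3 := le_bendHomeo_fst hε hε2 _ h
      change 1 - ε ≤ ((B (F (B p))).1 : ℝ) at h3
      linarith

/-- A homeomorphism of the square acting on the coordinates `i` and `m` of a cube. -/
def liftSquare {ι : Type*} [DecidableEq ι]
    (H : unitInterval × unitInterval ≃ₜ unitInterval × unitInterval) {i m : ι} (h : i ≠ m) :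
    (ι → unitInterval) ≃ₜ (ι → unitInterval) where
  toFun x := Function.update (Function.update x i (H (x i, x m)).1) m (H (x i, x m)).2
  invFun x := Function.update (Function.update x i (H.symm (x i, x m)).1) m (H.symm (x i, x m)).2
  left_inv x := by
    funext j
    by_cases hm : j = m
    · subst hm; simp [h]
    · by_cases hi : j = i
      · subst hi; simp [h]
      · simp [hi, hm]
  right_inv x := by
    funext j
    by_cases hm : j = m
    · subst hm; simp [h]
    · by_cases hi : j = i
      · subst hi; simp [h]
      · simp [hi, hm]
  continuous_toFun := by
    have h1 : Continuous fun x : ι → unitInterval => H (x i, x m) := by fun_prop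
    exact (continuous_id.update i h1.fst).update m h1.snd
  continuous_invFun := by
    have h1 : Continuous fun x : ι → unitInterval => H.symm (x i, x m) := by fun_prop
    exact (continuous_id.update i h1.fst).update m h1.snd

section liftSquare

variable {ι : Type*} [DecidableEq ι]
  (H : unitInterval × unitInterval ≃ₜ unitInterval × unitInterval) {i m : ι} (h : i ≠ m)
  (x : ι → unitInterval)

lemma liftSquare_fst : liftSquare H h x i = (H (x i, x m)).1 := by
  simp [liftSquare, h]

lemma liftSquare_snd : liftSquare H h x m = (H (x i, x m)).2 := by
  simp [liftSquare]

lemma liftSquare_of_ne {j : ι} (hi : j ≠ i) (hm : j ≠ m) : liftSquare H h x j = x j := by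
  simp [liftSquare, hi, hm]

end liftSquare

/-- The face `x m = 1` can be pushed into the region where finitely many other coordinates stay
away from the end points. -/
lemma exists_push_top {ι : Type*} [DecidableEq ι] {ε : ℝ} (hε : 0 < ε) (hε1 : ε ≤ 1 / 4)
    (m : ι) (A : Finset ι) : m ∉ A → ∃ T : (ι → unitInterval) ≃ₜ (ι → unitInterval),
      (∀ x j, j ∉ A → j ≠ m → T x j = x j) ∧
      (∀ x j, j ∈ A → |(T x j : ℝ) - x j| ≤ 2 * ε) ∧
      ∀ x, x m = 1 → T x m = 1 ∧ ∀ j ∈ A, (T x j : ℝ) ∈ Icc (ε / 2) (1 - ε / 2) := by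
  induction A using Finset.induction_on with
  | empty => exact fun _ => ⟨Homeomorph.refl _, by simp⟩
  | insert i A hi ih =>
    intro hm
    rw [Finset.mem_insert, not_or] at hm
    obtain ⟨T, h1, h2, h3⟩ := ih hm.2
    obtain ⟨H, H1, -, H3⟩ := exists_square_homeo hε hε1
    have him : i ≠ m := fun e => hm.1 e.symm
    refine ⟨T.trans (liftSquare H him), fun x j hj hjm => ?_, fun x j hj => ?_, fun x hx => ?_⟩
    · rw [Finset.mem_insert, not_or] at hj
      rw [Homeomorph.trans_apply, liftSquare_of_ne _ _ _ hj.1 hjm, h1 _ _ hj.2 hjm]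
    · rw [Homeomorph.trans_apply]
      by_cases hji : j = i
      · subst hji
        rw [liftSquare_fst]
        have := H1 (T x j, T x m)
        rwa [h1 x j hi him] at this ⊢
      · have hjA : j ∈ A := (Finset.mem_insert.1 hj).resolve_left hji
        rw [liftSquare_of_ne _ _ _ hji (fun e : j = m => hm.2 (e ▸ hjA))]
        exact h2 x j hjA
    · rw [Homeomorph.trans_apply]
      obtain ⟨h4, h5⟩ := h3 x hx
      obtain ⟨h6, h7⟩ := H3 (T x i, T x m) h4
      refine ⟨by rw [liftSquare_snd, h6], fun j hj => ?_⟩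
      by_cases hji : j = i
      · subst hji
        rwa [liftSquare_fst]
      · have hjA : j ∈ A := (Finset.mem_insert.1 hj).resolve_left hji
        rw [liftSquare_of_ne _ _ _ hji (fun e : j = m => hm.2 (e ▸ hjA))]
        exact h5 j hjA

/-- The faces `x n = 0` and `x n = 1` can be pushed, by a small homeomorphism, into the region
where finitely many coordinates stay away from the end points. -/
lemma exists_push_faces {ι : Type*} [DecidableEq ι] {ε : ℝ} (hε : 0 < ε) (hε1 : ε ≤ 1 / 4)
    {n m : ι} {A : Finset ι} (hm : m ∉ A) (hn : n ∈ A) :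
    ∃ T : (ι → unitInterval) ≃ₜ (ι → unitInterval),
      (∀ x j, j ≠ m → |(T x j : ℝ) - x j| ≤ 4 * ε) ∧
      ∀ x, x n = 0 ∨ x n = 1 → ∀ j ∈ A, (T x j : ℝ) ∈ Icc (ε / 2) (1 - ε / 2) := by
  obtain ⟨T, h1, h2, h3⟩ := exists_push_top hε hε1 m A hm
  obtain ⟨H, H1, H2, -⟩ := exists_square_homeo hε hε1
  have hnm : n ≠ m := fun e => hm (e ▸ hn)
  refine ⟨(liftSquare H hnm).trans T, fun x j hj => ?_, fun x hx => ?_⟩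
  · rw [Homeomorph.trans_apply]
    have e1 : |(T (liftSquare H hnm x) j : ℝ) - liftSquare H hnm x j| ≤ 2 * ε := by
      by_cases hjA : j ∈ A
      · exact h2 _ j hjA
      · rw [h1 _ j hjA hj, sub_self, abs_zero]; positivity
    have e2 : |(liftSquare H hnm x j : ℝ) - x j| ≤ 2 * ε := by
      by_cases hjn : j = n
      · subst hjn
        rw [liftSquare_fst]
        exact H1 (x j, x m)
      · rw [liftSquare_of_ne _ _ _ hjn hj, sub_self, abs_zero]; positivity
    have := abs_sub_le (T (liftSquare H hnm x) j : ℝ) (liftSquare H hnm x j) (x j)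
    linarith
  · rw [Homeomorph.trans_apply]
    refine (h3 _ ?_).2
    rw [liftSquare_snd]
    exact H2 _ hx

lemma exists_of_mem_uniformity_cube {V : Set ((ℕ → unitInterval) × (ℕ → unitInterval))}
    (hV : V ∈ uniformity (ℕ → unitInterval)) : ∃ N : ℕ, ∃ κ > (0 : ℝ),
      ∀ x y : ℕ → unitInterval, (∀ i < N, |(x i : ℝ) - y i| < κ) → (x, y) ∈ V := by
  rw [Pi.uniformity] at hV
  obtain ⟨⟨I, f⟩, ⟨hI, hf⟩, hsub⟩ := (Filter.HasBasis.iInf fun i : ℕ =>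
    (Metric.uniformity_basis_dist (α := unitInterval)).comap
      fun a : (ℕ → unitInterval) × (ℕ → unitInterval) => (a.1 i, a.2 i)).mem_iff.1 hV
  obtain ⟨N, hN⟩ := hI.bddAbove
  obtain ⟨κ, hκ, hκ'⟩ : ∃ κ > (0 : ℝ), ∀ i : I, κ ≤ f i := by
    have := hI.to_subtype
    rcases isEmpty_or_nonempty I with h | h
    · exact ⟨1, one_pos, fun i => h.elim i⟩
    · obtain ⟨i, hi⟩ := Finite.exists_min f
      exact ⟨f i, hf i, hi⟩
  refine ⟨N + 1, κ, hκ, fun x y hxy => hsub ?_⟩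
  rw [Set.mem_iInter]
  intro i
  exact (hxy i (Nat.lt_succ_of_le (hN i.2))).trans_le (hκ' i)

lemma mem_uniformity_cube (N : ℕ) {κ : ℝ} (hκ : 0 < κ) :
    {p : (ℕ → unitInterval) × (ℕ → unitInterval) | ∀ i < N, |(p.1 i : ℝ) - p.2 i| < κ} ∈
      uniformity (ℕ → unitInterval) := by
  have : {p : (ℕ → unitInterval) × (ℕ → unitInterval) | ∀ i < N, |(p.1 i : ℝ) - p.2 i| < κ} =
      ⋂ i ∈ Finset.range N, {p | |(p.1 i : ℝ) - p.2 i| < κ} := by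
    ext; simp
  rw [this, Filter.biInter_finset_mem]
  intro i _
  have h := (Pi.uniformContinuous_proj (fun _ : ℕ => unitInterval) i) (Metric.dist_mem_uniformity hκ)
  exact h

/-- Clamping to the interval `[δ, 1 - δ]`. -/
noncomputable def clampI {δ : ℝ} (hδ : 0 < δ) (hδ1 : δ < 1) (x : ℝ) : Ioo (0 : ℝ) 1 :=
  ⟨max δ (min (1 - δ) x), hδ.trans_le (le_max_left _ _),
    max_lt hδ1 ((min_le_left _ _).trans_lt (by linarith))⟩

section clampI

variable {δ : ℝ} (hδ : 0 < δ) (hδ1 : δ < 1)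

lemma coe_clampI (x : ℝ) : (clampI hδ hδ1 x : ℝ) = max δ (min (1 - δ) x) := rfl

lemma continuous_clampI : Continuous (clampI hδ hδ1) := by
  refine Continuous.subtype_mk ?_ _
  fun_prop

lemma clampI_mem (h : δ ≤ 1 / 2) (x : ℝ) : (clampI hδ hδ1 x : ℝ) ∈ Icc δ (1 - δ) :=
  ⟨le_max_left _ _, max_le (by linarith) (min_le_left _ _)⟩

lemma clampI_of_mem {x : ℝ} (h : x ∈ Icc δ (1 - δ)) : (clampI hδ hδ1 x : ℝ) = x := by
  rw [coe_clampI, min_eq_right h.2, max_eq_right h.1]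

lemma abs_clampI_sub_le (x y : ℝ) : |(clampI hδ hδ1 x : ℝ) - clampI hδ hδ1 y| ≤ |x - y| := by
  rw [coe_clampI, coe_clampI]
  refine (abs_max_sub_max_le_max _ _ _ _).trans ?_
  rw [sub_self, abs_zero, max_eq_right (abs_nonneg _)]
  refine (abs_min_sub_min_le_max _ _ _ _).trans ?_
  rw [sub_self, abs_zero, max_eq_right (abs_nonneg _)]

lemma abs_clampI_sub_self_le {x : ℝ} (hx : x ∈ Icc (0 : ℝ) 1) :
    |(clampI hδ hδ1 x : ℝ) - x| ≤ δ := by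
  rw [coe_clampI, abs_le]
  obtain ⟨h0, h1⟩ := hx
  rcases le_total (1 - δ) x with h | h
  · rw [min_eq_left h]
    rcases le_total δ (1 - δ) with h' | h'
    · rw [max_eq_right h']; constructor <;> linarith
    · rw [max_eq_left h']; constructor <;> linarith
  · rw [min_eq_right h]
    rcases le_total δ x with h' | h'
    · rw [max_eq_right h']; constructor <;> linarith
    · rw [max_eq_left h']; constructor <;> linarith

end clampI

/-- The coordinates `N, …, 2 * N - 1` can be made to approximate the coordinates
`0, …, N - 1`, on the set where all of these are bounded away from the end points. -/
lemma exists_coding (N : ℕ) {δ κ : ℝ} (hδ : 0 < δ) (hδ1 : δ ≤ 1 / 2) (hκ : 0 < κ) :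
    ∃ S : (ℕ → unitInterval) ≃ₜ (ℕ → unitInterval),
      (∀ x, ∀ i < N, S x i = x i) ∧
      ∀ x, (∀ i < 2 * N, (x i : ℝ) ∈ Icc δ (1 - δ)) →
        ∀ i < N, |(S x (N + i) : ℝ) - x i| ≤ κ := by
  have hδ2 : δ < 1 := by linarith
  obtain ⟨σ, hσ, -⟩ := exists_squeeze (q := 1 - δ) hδ (by linarith) (half_pos hκ)
  let b : (ℕ → unitInterval) → ℕ → Ioo (0 : ℝ) 1 := fun x i => clampI hδ hδ2 (x (i - N))
  have hb : ∀ i, Continuous fun p : (ℕ → unitInterval) × unitInterval => b p.1 i := fun i =>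
    (continuous_clampI hδ hδ2).comp (by fun_prop)
  have hdep : ∀ x y : ℕ → unitInterval, (∀ i, i ∉ {i | N ≤ i ∧ i < 2 * N} → x i = y i) →
      ∀ i, N ≤ i ∧ i < 2 * N → b x i = b y i := by
    intro x y h i hi
    have : x (i - N) = y (i - N) := h _ (by simp only [Set.mem_ofPred_eq]; omega)
    simp only [b, this]
  refine ⟨shearHomeo {i | N ≤ i ∧ i < 2 * N}
    (fun x i t => if N ≤ i ∧ i < 2 * N then plI midI (b x i) (σ t) else t)
    (fun x i t => if N ≤ i ∧ i < 2 * N then σ.symm (plI (b x i) midI t) else t)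
    ?_ ?_ ?_ ?_ ?_ ?_ ?_ ?_, ?_, ?_⟩
  · intro i
    by_cases hi : N ≤ i ∧ i < 2 * N
    · simp only [hi, and_self, if_true]
      exact continuous_const.plI (hb i) (σ.continuous.comp continuous_snd)
    · simp only [hi, if_false]; exact continuous_snd
  · intro i
    by_cases hi : N ≤ i ∧ i < 2 * N
    · simp only [hi, and_self, if_true]
      exact σ.symm.continuous.comp ((hb i).plI continuous_const continuous_snd)
    · simp only [hi, if_false]; exact continuous_snd
  · intro x y h
    funext i t
    by_cases hi : N ≤ i ∧ i < 2 * N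
    · simp only [hi, and_self, if_true, hdep x y h i hi]
    · simp only [hi, if_false]
  · intro x y h
    funext i t
    by_cases hi : N ≤ i ∧ i < 2 * N
    · simp only [hi, and_self, if_true, hdep x y h i hi]
    · simp only [hi, if_false]
  · intro x i t hi
    exact if_neg hi
  · intro x i t hi
    exact if_neg hi
  · intro x i t
    by_cases hi : N ≤ i ∧ i < 2 * N
    · simp only [hi, and_self, if_true, plI_plI, Homeomorph.symm_apply_apply]
    · simp only [hi, if_false]
  · intro x i t
    by_cases hi : N ≤ i ∧ i < 2 * N
    · simp only [hi, and_self, if_true, plI_plI, Homeomorph.apply_symm_apply]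
    · simp only [hi, if_false]
  · intro x i hi
    exact if_neg (by omega)
  · intro x hx i hi
    have h1 : N ≤ N + i ∧ N + i < 2 * N := by omega
    have h2 : b x (N + i) = clampI hδ hδ2 (x i) := by simp [b]
    have h3 := hσ _ (hx (N + i) h1.2)
    have h4 : (clampI hδ hδ2 (x i) : ℝ) = x i := clampI_of_mem _ _ (hx i (by omega))
    change |((if N ≤ N + i ∧ N + i < 2 * N then plI midI (b x (N + i)) (σ (x (N + i))) else
      x (N + i) : unitInterval) : ℝ) - x i| ≤ κ
    rw [if_pos h1, h2]
    change |plMap (1 / 2) (clampI hδ hδ2 (x i)) (σ (x (N + i))) - x i| ≤ κ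
    rw [h4]
    refine (abs_plMap_sub_le (δ := 1 / 2) (by norm_num) (by norm_num) (x i).2).trans ?_
    rw [div_le_iff₀ (by norm_num)]
    linarith

/-- A map `g` of the cube can be realised, on its first `N` coordinates, by a homeomorphism
controlled by the coordinates `N, …, 2 * N - 1`. -/
lemma exists_realize {g : (ℕ → unitInterval) → ℕ → unitInterval} (hg : Continuous g) (N M : ℕ)
    (hMN : M ≤ N) {δ κ ε : ℝ} (hδ : 0 < δ) (hδ1 : δ ≤ 1 / 2) (hκ : 0 < κ)
    (hgε : ∀ x, ∀ i < M, |(g x i : ℝ) - x i| ≤ ε) :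
    ∃ S : (ℕ → unitInterval) ≃ₜ (ℕ → unitInterval),
      (∀ x, ∀ i < M, |(S x i : ℝ) - x i| ≤ ε) ∧
      ∀ x : ℕ → unitInterval, (∀ i < N, (x i : ℝ) ∈ Icc δ (1 - δ)) →
        (∀ i < N, |(x (N + i) : ℝ) - x i| ≤ δ * κ) →
        ∃ y, ∀ i < N, |(S x i : ℝ) - g y i| < 3 * κ := by
  have hδ2 : δ < 1 := by linarith
  set η := min δ κ with hη
  have hη0 : 0 < η := lt_min hδ hκ
  have hηδ : η ≤ δ := min_le_left _ _
  have hηκ : η ≤ κ := min_le_right _ _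
  have hη1 : η < 1 := by linarith
  let a : (ℕ → unitInterval) → ℕ → Ioo (0 : ℝ) 1 := fun x i => clampI hδ hδ2 (x (N + i))
  let y : (ℕ → unitInterval) → ℕ → unitInterval := fun x i => ⟨a x i, Ioo_subset_Icc_self (a x i).2⟩
  let c : (ℕ → unitInterval) → ℕ → Ioo (0 : ℝ) 1 := fun x i => clampI hη0 hη1 (g (y x) i)
  have ha : ∀ i, Continuous fun x : ℕ → unitInterval => a x i := fun i =>
    (continuous_clampI hδ hδ2).comp (by fun_prop)
  have hy : Continuous y := continuous_pi fun i =>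
    Continuous.subtype_mk (continuous_subtype_val.comp (ha i)) _
  have hc : ∀ i, Continuous fun x : ℕ → unitInterval => c x i := fun i =>
    (continuous_clampI hη0 hη1).comp
      (continuous_subtype_val.comp ((continuous_apply i).comp (hg.comp hy)))
  have hdep : ∀ x z : ℕ → unitInterval, (∀ i, i ∉ {i | i < N} → x i = z i) →
      a x = a z ∧ c x = c z := by
    intro x z h
    have h1 : a x = a z := by
      funext i
      simp only [a]
      rw [h (N + i) (by simp)]
    refine ⟨h1, ?_⟩
    simp only [c, y, h1]
  refine ⟨shearHomeo {i | i < N}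
    (fun x i t => if i < N then plI (a x i) (c x i) t else t)
    (fun x i t => if i < N then plI (c x i) (a x i) t else t)
    ?_ ?_ ?_ ?_ ?_ ?_ ?_ ?_, ?_, ?_⟩
  · intro i
    by_cases hi : i < N
    · simp only [hi, if_true]
      exact ((ha i).comp continuous_fst).plI ((hc i).comp continuous_fst) continuous_snd
    · simp only [hi, if_false]; exact continuous_snd
  · intro i
    by_cases hi : i < N
    · simp only [hi, if_true]
      exact ((hc i).comp continuous_fst).plI ((ha i).comp continuous_fst) continuous_snd
    · simp only [hi, if_false]; exact continuous_snd
  · intro x z h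
    simp only [hdep x z h]
  · intro x z h
    simp only [hdep x z h]
  · intro x i t hi
    exact if_neg hi
  · intro x i t hi
    exact if_neg hi
  · intro x i t
    by_cases hi : i < N
    · simp only [hi, if_true, plI_plI]
    · simp only [hi, if_false]
  · intro x i t
    by_cases hi : i < N
    · simp only [hi, if_true, plI_plI]
    · simp only [hi, if_false]
  · intro x i hi
    change |((if i < N then plI (a x i) (c x i) (x i) else x i : unitInterval) : ℝ) - x i| ≤ ε
    rw [if_pos (by omega)]
    refine (abs_plMap_sub_self_le (a x i).2 (x i).2).trans ?_
    have h1 : (a x i : ℝ) ∈ Icc δ (1 - δ) := clampI_mem hδ hδ2 hδ1 _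
    have h2 : (clampI hη0 hη1 (a x i) : ℝ) = a x i :=
      clampI_of_mem _ _ ⟨by linarith [h1.1], by linarith [h1.2]⟩
    rw [← h2]
    refine (abs_clampI_sub_le hη0 hη1 _ _).trans ?_
    rw [abs_sub_comm]
    exact hgε (y x) i hi
  · intro x hx hx'
    refine ⟨y x, fun i hi => ?_⟩
    change |((if i < N then plI (a x i) (c x i) (x i) else x i : unitInterval) : ℝ) - _| < _
    rw [if_pos hi]
    have h1 : (a x i : ℝ) ∈ Icc δ (1 - δ) := clampI_mem hδ hδ2 hδ1 _
    have h2 : |(x i : ℝ) - a x i| ≤ δ * κ := by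
      have h4 : (clampI hδ hδ2 (x i) : ℝ) = x i := clampI_of_mem _ _ (hx i hi)
      have h5 := abs_clampI_sub_le hδ hδ2 (x (N + i)) (x i)
      rw [h4, abs_sub_comm] at h5
      exact h5.trans (hx' i hi)
    have h3 : |((plI (a x i) (c x i) (x i) : unitInterval) : ℝ) - c x i| ≤ κ := by
      refine (abs_plMap_sub_le hδ h1 (Ioo_subset_Icc_self (c x i).2)).trans ?_
      rw [div_le_iff₀ hδ]; linarith
    have h4 : |(c x i : ℝ) - g (y x) i| ≤ κ :=
      (abs_clampI_sub_self_le hη0 hη1 (g (y x) i).2).trans hηκ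
    have := abs_sub_le ((plI (a x i) (c x i) (x i) : unitInterval) : ℝ) (c x i) (g (y x) i)
    linarith

/-- A closed set which can be approximately avoided can be moved off the faces of the cube by
a small homeomorphism. -/
lemma exists_avoid_faces {K : Set (ℕ → unitInterval)} (hK : IsClosed K)
    (hZ : ∀ M : ℕ, ∀ ε > (0 : ℝ), ∃ g : (ℕ → unitInterval) → ℕ → unitInterval, Continuous g ∧
      (∀ x, g x ∉ K) ∧ ∀ x, ∀ i < M, |(g x i : ℝ) - x i| < ε) (n M : ℕ) {ε : ℝ} (hε : 0 < ε) :
    ∃ η : (ℕ → unitInterval) ≃ₜ (ℕ → unitInterval),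
      (∀ x, ∀ i < M, |(η x i : ℝ) - x i| ≤ ε) ∧ ∀ x ∈ K, (η x n : ℝ) ∈ Ioo (0 : ℝ) 1 := by
  obtain ⟨g, hg, hgK, hgε⟩ := hZ M (ε / 2) (half_pos hε)
  obtain ⟨V, hV, -, hVK⟩ := lebesgue_number_of_compact_open (isCompact_range hg) hK.isOpen_compl
    (by rintro _ ⟨x, rfl⟩; exact hgK x)
  obtain ⟨N₀, κ, hκ, hN₀⟩ := exists_of_mem_uniformity_cube hV
  set N := max N₀ (max M (n + 1)) with hN
  have hN0 : N₀ ≤ N := le_max_left _ _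
  have hNM : M ≤ N := (le_max_left _ _).trans (le_max_right _ _)
  have hNn : n + 1 ≤ N := (le_max_right _ _).trans (le_max_right _ _)
  set ε₀ := min (ε / 8) (1 / 4) with hε₀
  have h0 : 0 < ε₀ := by positivity
  have h1 : ε₀ ≤ ε / 8 := min_le_left _ _
  have h2 : ε₀ ≤ 1 / 4 := min_le_right _ _
  obtain ⟨T, hT1, hT2⟩ := exists_push_faces h0 h2 (n := n) (m := 2 * N) (A := Finset.range (2 * N))
    (by simp) (by simp; omega)
  have hδ : 0 < ε₀ / 2 := half_pos h0
  have hδ1 : ε₀ / 2 ≤ 1 / 2 := by linarith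
  obtain ⟨S, hS1, hS2⟩ := exists_coding N hδ hδ1 (κ := ε₀ / 2 * (κ / 3)) (by positivity)
  obtain ⟨R, hR1, hR2⟩ := exists_realize hg N M hNM hδ hδ1 (κ := κ / 3) (by positivity)
    (ε := ε / 2) (fun x i hi => (hgε x i hi).le)
  have hmove : ∀ x, ∀ i < M, |(R (S (T x)) i : ℝ) - x i| ≤ ε := by
    intro x i hi
    have e1 := hR1 (S (T x)) i hi
    rw [hS1 _ i (by omega)] at e1
    have e2 := hT1 x i (by omega)
    have := abs_sub_le (R (S (T x)) i : ℝ) (T x i) (x i)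
    linarith
  have havoid : ∀ x, x n = 0 ∨ x n = 1 → R (S (T x)) ∉ K := by
    intro x hx
    have e1 := hT2 x hx
    simp only [Finset.mem_range] at e1
    have e2 := hS2 (T x) e1
    obtain ⟨y, hy⟩ := hR2 (S (T x))
      (fun i hi => by rw [hS1 _ i hi]; exact e1 i (by omega))
      (fun i hi => by rw [hS1 _ i hi]; exact e2 i hi)
    refine hVK (g y) (mem_range_self y) (hN₀ _ _ fun i hi => ?_)
    rw [abs_sub_comm]
    have := hy i (by omega)
    linarith
  refine ⟨((T.trans S).trans R).symm, fun x i hi => ?_, fun x hx => ?_⟩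
  · obtain ⟨z, rfl⟩ := ((T.trans S).trans R).surjective x
    rw [Homeomorph.symm_apply_apply, abs_sub_comm]
    exact hmove z i hi
  · obtain ⟨z, rfl⟩ := ((T.trans S).trans R).surjective x
    rw [Homeomorph.symm_apply_apply]
    have h3 : z n ≠ 0 := fun h => havoid z (Or.inl h) hx
    have h4 : z n ≠ 1 := fun h => havoid z (Or.inr h) hx
    refine ⟨lt_of_le_of_ne (z n).2.1 fun h => h3 (Subtype.ext h.symm),
      lt_of_le_of_ne (z n).2.2 fun h => h4 (Subtype.ext h)⟩

lemma summable_hDist (x y : HCube) :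
    Summable fun n : ℕ => (2 : ℝ)⁻¹ ^ n * |(x n : ℝ) - (y n : ℝ)| := by
  refine Summable.of_nonneg_of_le (fun n => by positivity) (fun n => ?_)
    (summable_geometric_of_lt_one (r := (2 : ℝ)⁻¹) (by norm_num) (by norm_num))
  refine mul_le_of_le_one_right (by positivity) ?_
  rw [abs_le]
  constructor <;> linarith [(x n).2.1, (x n).2.2, (y n).2.1, (y n).2.2]

lemma le_hDist (x y : HCube) (n : ℕ) : (2 : ℝ)⁻¹ ^ n * |(x n : ℝ) - y n| ≤ hDist x y :=
  (summable_hDist x y).le_tsum n fun _ _ => by positivity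

lemma continuous_hDist : Continuous fun p : HCube × HCube => hDist p.1 p.2 := by
  refine continuous_tsum (u := fun n : ℕ => (2 : ℝ)⁻¹ ^ n) (fun n => by fun_prop)
    (summable_geometric_of_lt_one (by norm_num) (by norm_num)) fun n p => ?_
  rw [Real.norm_of_nonneg (by positivity)]
  refine mul_le_of_le_one_right (by positivity) ?_
  rw [abs_le]
  constructor <;> linarith [(p.1 n).2.1, (p.1 n).2.2, (p.2 n).2.1, (p.2 n).2.2]

lemma hDist_self (x : HCube) : hDist x x = 0 := by simp [hDist]

lemma hDist_comm (x y : HCube) : hDist x y = hDist y x := by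
  simp only [hDist, abs_sub_comm]

lemma hDist_triangle (x y z : HCube) : hDist x z ≤ hDist x y + hDist y z := by
  unfold hDist
  rw [← (summable_hDist x y).tsum_add (summable_hDist y z)]
  refine (summable_hDist x z).tsum_le_tsum (fun n => ?_)
    ((summable_hDist x y).add (summable_hDist y z))
  rw [← mul_add]
  exact mul_le_mul_of_nonneg_left (abs_sub_le _ _ _) (by positivity)

lemma abs_sub_lt_of_hDist_lt {x y : HCube} {N : ℕ} {κ : ℝ} (h : hDist x y < (2 : ℝ)⁻¹ ^ N * κ)
    {i : ℕ} (hi : i ≤ N) : |(x i : ℝ) - y i| < κ := by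
  have h1 := (le_hDist x y i).trans_lt h
  have h2 : (2 : ℝ)⁻¹ ^ N ≤ (2 : ℝ)⁻¹ ^ i := pow_le_pow_of_le_one (by norm_num) (by norm_num) hi
  by_contra! h3
  have h4 : (2 : ℝ)⁻¹ ^ N * κ ≤ (2 : ℝ)⁻¹ ^ N * |(x i : ℝ) - y i| := by gcongr
  have h5 : (2 : ℝ)⁻¹ ^ N * |(x i : ℝ) - y i| ≤ (2 : ℝ)⁻¹ ^ i * |(x i : ℝ) - y i| := by gcongr
  linarith

/-- The metric `hDist` on the Hilbert cube, compatible with the product topology. -/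
noncomputable abbrev hMetric : MetricSpace HCube :=
  MetricSpace.ofDistTopology hDist hDist_self hDist_comm hDist_triangle
    (fun s => by
      constructor
      · intro hs x hx
        obtain ⟨V, hV, hVs⟩ := UniformSpace.mem_nhds_iff.1 (hs.mem_nhds hx)
        obtain ⟨N, κ, hκ, hN⟩ := exists_of_mem_uniformity_cube hV
        exact ⟨(2 : ℝ)⁻¹ ^ N * κ, by positivity, fun y hy =>
          hVs (hN x y fun i hi => abs_sub_lt_of_hDist_lt hy hi.le)⟩
      · intro h
        rw [isOpen_iff_mem_nhds]
        intro x hx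
        obtain ⟨ε, hε, hs⟩ := h x hx
        have hc : Continuous fun y => hDist x y :=
          continuous_hDist.comp (continuous_const.prodMk continuous_id)
        filter_upwards [hc.continuousAt.eventually_lt_const (u := ε) (by simpa only [hDist_self] using hε)]
          with y hy using hs y hy)
    fun x y h => by
      funext n
      have := le_hDist x y n
      rw [h] at this
      have h2 : |(x n : ℝ) - y n| = 0 :=
        le_antisymm (nonpos_of_mul_nonpos_right this (by positivity)) (abs_nonneg _)
      exact Subtype.ext (sub_eq_zero.1 (abs_eq_zero.1 h2))

/-- The topology of uniform convergence is the compact-open topology. -/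
lemma unifTop_eq_induced {S : Type*} (F : S → C(HCube, HCube)) :
    unifTop (fun s => (F s : HCube → HCube)) = TopologicalSpace.induced F inferInstance := by
  let _ := hMetric
  have hd : ∀ f g : C(HCube, HCube), supDist f g = dist f g := fun f g => by
    rw [ContinuousMap.dist_eq_iSup]; rfl
  refine le_antisymm ?_ ?_
  · rw [← continuous_iff_le_induced]
    let _ := unifTop (fun s => (F s : HCube → HCube))
    rw [continuous_iff_continuousAt]
    intro s
    rw [ContinuousAt, Metric.tendsto_nhds]
    intro ε hε
    have ho : IsOpen {g : S | supDist (F s) (F g) < ε} :=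
      TopologicalSpace.isOpen_generateFrom_of_mem ⟨s, ε, hε, rfl⟩
    filter_upwards [ho.mem_nhds (show supDist (F s) (F s) < ε by rwa [hd, dist_self])] with g hg
    rw [dist_comm, ← hd]
    exact hg
  · refine le_generateFrom ?_
    rintro _ ⟨c, ε, -, rfl⟩
    refine ⟨{f | dist (F c) f < ε}, isOpen_lt (by fun_prop) (by fun_prop), ?_⟩
    ext g
    simp [hd]

lemma IsZSet.exists_near {K : Set HCube} (hK : IsZSet K) (φ : HCube ≃ₜ HCube) (M : ℕ) {ε : ℝ}
    (hε : 0 < ε) : ∃ g : HCube → HCube, Continuous g ∧ (∀ x, g x ∉ φ '' K) ∧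
      ∀ x, ∀ i < M, |(g x i : ℝ) - x i| < ε := by
  have hu : UniformContinuous φ := CompactSpace.uniformContinuous_of_continuous φ.continuous
  obtain ⟨N, κ, hκ, hN⟩ := exists_of_mem_uniformity_cube (hu (mem_uniformity_cube M hε))
  obtain ⟨g, hg, hgK, hgd⟩ := hK.2 ((2 : ℝ)⁻¹ ^ N * κ) (by positivity) φ.symm φ.symm.continuous
  refine ⟨φ ∘ g, φ.continuous.comp hg, ?_, fun x i hi => ?_⟩
  · rintro x ⟨k, hk, hkx⟩
    have : g x ∈ range g ∩ K := ⟨mem_range_self x, by rwa [← φ.injective hkx]⟩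
    rwa [hgK] at this
  · have := hN (φ.symm x) (g x) (fun i hi => abs_sub_lt_of_hDist_lt (hgd x) hi.le) i hi
    simp only [Homeomorph.apply_symm_apply] at this
    rwa [abs_sub_comm]

/-- Pairs of mutually inverse continuous self-maps of the Hilbert cube. -/
def invPairs : Set (C(HCube, HCube) × C(HCube, HCube)) :=
  {p | p.1.comp p.2 = ContinuousMap.id _ ∧ p.2.comp p.1 = ContinuousMap.id _}

/-- The homeomorphism given by a pair of mutually inverse maps. -/
def invPairs.homeo (p : invPairs) : HCube ≃ₜ HCube where
  toFun := p.1.1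
  invFun := p.1.2
  left_inv x := DFunLike.congr_fun p.2.2 x
  right_inv x := DFunLike.congr_fun p.2.1 x

/-- The pair of mutually inverse maps given by a homeomorphism. -/
def invPairs.ofHomeo (φ : HCube ≃ₜ HCube) : invPairs :=
  ⟨(⟨φ, φ.continuous⟩, ⟨φ.symm, φ.symm.continuous⟩),
    ContinuousMap.ext φ.apply_symm_apply, ContinuousMap.ext φ.symm_apply_apply⟩

lemma isClosed_invPairs : IsClosed invPairs :=
  (isClosed_eq (continuous_fst.compCM continuous_snd) continuous_const).inter
    (isClosed_eq (continuous_snd.compCM continuous_fst) continuous_const)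

instance : BaireSpace invPairs := by
  let _ := hMetric
  have := isClosed_invPairs.completeSpace_coe
  infer_instance

lemma tendsto_id_of_abs_sub_le {F : ℕ → C(HCube, HCube)}
    (h : ∀ m x, ∀ i < m, |(F m x i : ℝ) - x i| ≤ 1 / ((m : ℝ) + 1)) :
    Filter.Tendsto F Filter.atTop (𝓝 (ContinuousMap.id _)) := by
  rw [ContinuousMap.tendsto_iff_tendstoUniformly]
  intro u hu
  obtain ⟨N, κ, hκ, hN⟩ := exists_of_mem_uniformity_cube hu
  filter_upwards [Filter.eventually_ge_atTop N,
    tendsto_one_div_add_atTop_nhds_zero_nat.eventually_lt_const hκ] with m hm hm' x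
  refine hN _ _ fun i hi => ?_
  rw [abs_sub_comm]
  exact (h m x i (by omega)).trans_lt hm'

lemma IsZSet.dense_avoid {K : Set HCube} (hK : IsZSet K) (n : ℕ) :
    Dense {p : invPairs | MapsTo p.1.1 K {y | (y n : ℝ) ∈ Ioo (0 : ℝ) 1}} := by
  intro p
  have hφK : IsClosed (invPairs.homeo p '' K) :=
    (invPairs.homeo p).isClosedMap _ hK.1
  have key := fun m : ℕ => exists_avoid_faces hφK
    (fun M ε hε => hK.exists_near (invPairs.homeo p) M hε) n m (ε := 1 / ((m : ℝ) + 1))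
    (by positivity)
  choose η hη hηK using key
  refine mem_closure_of_tendsto (f := fun m => invPairs.ofHomeo ((invPairs.homeo p).trans (η m)))
    (b := Filter.atTop) ?_ (Filter.Eventually.of_forall fun m x hx => hηK m _ ⟨x, hx, rfl⟩)
  rw [tendsto_subtype_rng]
  refine Filter.Tendsto.prodMk_nhds ?_ ?_
  · have h1 : Filter.Tendsto (fun m => (⟨η m, (η m).continuous⟩ : C(HCube, HCube)))
        Filter.atTop (𝓝 (ContinuousMap.id _)) := tendsto_id_of_abs_sub_le hη
    have := h1.compCM (tendsto_const_nhds (x := p.1.1))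
    rwa [ContinuousMap.id_comp] at this
  · have h1 : Filter.Tendsto (fun m => (⟨(η m).symm, (η m).symm.continuous⟩ : C(HCube, HCube)))
        Filter.atTop (𝓝 (ContinuousMap.id _)) := by
      refine tendsto_id_of_abs_sub_le fun m x i hi => ?_
      obtain ⟨z, rfl⟩ := (η m).surjective x
      have := hη m z i hi
      rw [abs_sub_comm] at this
      simpa using this
    have := (tendsto_const_nhds (x := p.1.2)).compCM h1
    rwa [ContinuousMap.comp_id] at this

/-- A `Z`-set can be moved into the pseudo-interior of the Hilbert cube. -/
lemma IsZSet.exists_homeo_mem_Ioo {K : Set HCube} (hK : IsZSet K) :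
    ∃ φ : HCube ≃ₜ HCube, ∀ x ∈ K, ∀ n, (φ x n : ℝ) ∈ Ioo (0 : ℝ) 1 := by
  have hd := dense_iInter_of_isOpen_nat (fun n => ?_) (fun n => hK.dense_avoid n)
  · have : Nonempty invPairs := ⟨invPairs.ofHomeo (Homeomorph.refl _)⟩
    obtain ⟨p, hp⟩ := hd.nonempty
    exact ⟨invPairs.homeo p, fun x hx n => mem_iInter.1 hp n hx⟩
  · refine (ContinuousMap.isOpen_setOfPred_mapsTo hK.1.isCompact ?_).preimage
      (continuous_fst.comp continuous_subtype_val)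
    exact isOpen_Ioo.preimage (continuous_subtype_val.comp (continuous_apply n))

/-- Tietze extension for families of functions with values in the open unit interval. -/
lemma exists_extension_Ioo {K Z ι : Type*} [TopologicalSpace K] [TopologicalSpace Z] [NormalSpace Z]
    {e : K → Z} (he : IsClosedEmbedding e) {b : K → ι → unitInterval}
    (hb : Continuous b) (hb1 : ∀ k i, (b k i : ℝ) ∈ Ioo (0 : ℝ) 1) :
    ∃ F : Z → ι → Ioo (0 : ℝ) 1, (∀ i, Continuous fun z => F z i) ∧
      ∀ k i, (F (e k) i : ℝ) = b k i := by
  have key : ∀ i, ∃ g : C(Z, ℝ), (∀ y, g y ∈ Ioo (0 : ℝ) 1) ∧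
      g ∘ e = fun k => (b k i : ℝ) := fun i =>
    ContinuousMap.exists_extension_forall_mem_of_isClosedEmbedding
      (⟨fun k => (b k i : ℝ), by fun_prop⟩ : C(K, ℝ)) (fun k => hb1 k i)
      ⟨1 / 2, by norm_num, by norm_num⟩ he
  choose g hg hge using key
  exact ⟨fun z i => ⟨g i z, hg i z⟩, fun i => Continuous.subtype_mk (g i).continuous _,
    fun k i => congrFun (hge i) k⟩

lemma plI_eq {a b : Ioo (0 : ℝ) 1} {t s : unitInterval} (ht : (a : ℝ) = t) (hs : (b : ℝ) = s) :
    plI a b t = s := by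
  refine Subtype.ext ?_
  change plMap a b t = s
  rw [← ht, plMap_self a.2.1, hs]

/-- The coordinates of the first factor can be coded into the second factor. -/
lemma exists_coded {K : Type*} [TopologicalSpace K] [CompactSpace K]
    {x : K → ℕ → unitInterval} {y : K → ℕ × ℕ → unitInterval} (hy : Continuous y)
    (hxy : Function.Injective fun k => (x k, y k))
    (hy1 : ∀ k i, (y k i : ℝ) ∈ Ioo (0 : ℝ) 1) :
    ∃ S : (ℕ → unitInterval) × (ℕ × ℕ → unitInterval) ≃ₜ
        (ℕ → unitInterval) × (ℕ × ℕ → unitInterval),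
      (∀ p, (S p).1 = p.1) ∧ (Function.Injective fun k => (S (x k, y k)).2) ∧
      ∀ k i, ((S (x k, y k)).2 i : ℝ) ∈ Ioo (0 : ℝ) 1 := by
  have hσ : ∀ i : ℕ × ℕ, ∃ σ : unitInterval ≃ₜ unitInterval,
      (∀ k, |(σ (y k i) : ℝ) - 1 / 2| ≤ 1 / ((i.2 : ℝ) + 1)) ∧
      ∀ t : unitInterval, (t : ℝ) ∈ Ioo (0 : ℝ) 1 → (σ t : ℝ) ∈ Ioo (0 : ℝ) 1 := by
    intro i
    have hc : Continuous fun k => (y k i : ℝ) := by fun_prop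
    rcases isEmpty_or_nonempty K with h | h
    · exact ⟨Homeomorph.refl _, fun k => (IsEmpty.false k).elim, fun t ht => ht⟩
    obtain ⟨a, ha⟩ := (isCompact_univ.exists_isMinOn univ_nonempty hc.continuousOn)
    obtain ⟨b, hb⟩ := (isCompact_univ.exists_isMaxOn univ_nonempty hc.continuousOn)
    obtain ⟨σ, h1, h2⟩ := exists_squeeze (hy1 a i).1 (hy1 b i).2
      (κ := 1 / ((i.2 : ℝ) + 1)) (by positivity)
    exact ⟨σ, fun k => h1 _ ⟨ha.2 (mem_univ k), hb.2 (mem_univ k)⟩, h2⟩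
  choose σ hσ1 hσ2 using hσ
  let G : unitInterval → Ioo (0 : ℝ) 1 := fun t =>
    ⟨1 / 4 + t / 2, by linarith [t.2.1], by linarith [t.2.2]⟩
  have hG : Continuous G := Continuous.subtype_mk (by fun_prop) _
  let S := fiberHomeo (X := ℕ → unitInterval) (ι := ℕ × ℕ)
    (fun x i t => plI midI (G (x i.1)) (σ i t))
    (fun x i t => (σ i).symm (plI (G (x i.1)) midI t))
    (fun i => continuous_const.plI (by fun_prop) (by fun_prop))
    (fun i => (σ i).symm.continuous.comp (Continuous.plI (by fun_prop) continuous_const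
      (by fun_prop)))
    (fun x i t => by rw [plI_plI, Homeomorph.symm_apply_apply])
    (fun x i t => by rw [Homeomorph.apply_symm_apply, plI_plI])
  refine ⟨S, fun p => rfl, fun k k' h => ?_, fun k i => plI_mem_Ioo _ _ (hσ2 i _ (hy1 k i))⟩
  have hclose : ∀ k (m j : ℕ), |((S (x k, y k)).2 (m, j) : ℝ) - G (x k m)| ≤
      2 * (1 / ((j : ℝ) + 1)) := by
    intro k m j
    change |plMap (1 / 2) (G (x k m)) (σ (m, j) (y k (m, j))) - G (x k m)| ≤ _
    refine (abs_plMap_sub_le (δ := 1 / 2) (by norm_num) (by norm_num)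
      (Ioo_subset_Icc_self (G (x k m)).2)).trans ?_
    have := hσ1 (m, j) k
    rw [div_le_iff₀ (by norm_num)]
    linarith
  have hx : x k = x k' := by
    funext m
    have h0 : |((G (x k m) : ℝ)) - G (x k' m)| ≤ 0 := by
      refine ge_of_tendsto' (x := Filter.atTop) (f := fun j : ℕ => 4 * (1 / ((j : ℝ) + 1))) ?_
        fun j => ?_
      · simpa using tendsto_one_div_add_atTop_nhds_zero_nat.const_mul (4 : ℝ)
      · have h1 := hclose k m j
        have h2 := hclose k' m j
        rw [← show (S (x k, y k)).2 = (S (x k', y k')).2 from h] at h2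
        rw [abs_sub_comm] at h1
        have := abs_sub_le (G (x k m) : ℝ) ((S (x k, y k)).2 (m, j)) (G (x k' m))
        linarith
    have h1 : (1 / 4 + (x k m : ℝ) / 2) - (1 / 4 + (x k' m : ℝ) / 2) = 0 :=
      abs_nonpos_iff.1 h0
    exact Subtype.ext (by linarith)
  have hS : S (x k, y k) = S (x k', y k') := Prod.ext hx h
  exact hxy (S.injective hS)

/-- Any embedding of a `Z`-set into the pseudo-interior extends, after stabilising by a cube, to a
homeomorphism. -/
lemma IsZSet.exists_homeo_extend {K : Set HCube} (hK : IsZSet K) {b : K → ℕ → unitInterval}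
    (hb : Continuous b) (hbi : Function.Injective b) (hb1 : ∀ k i, (b k i : ℝ) ∈ Ioo (0 : ℝ) 1) :
    ∃ Ψ : HCube ≃ₜ (ℕ → unitInterval) × (ℕ × ℕ → unitInterval),
      ∀ k : K, (Ψ k).1 = b k ∧ ∀ i, ((Ψ k).2 i : ℝ) = 1 / 2 := by
  have : CompactSpace K := isCompact_iff_compactSpace.1 hK.1.isCompact
  obtain ⟨φ, hφ⟩ := hK.exists_homeo_mem_Ioo
  let e : ℕ ⊕ ℕ × ℕ ≃ ℕ := Classical.choice (nonempty_equiv_of_countable)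
  let R : HCube ≃ₜ (ℕ → unitInterval) × (ℕ × ℕ → unitInterval) :=
    (Homeomorph.piCongrLeft (Y := fun _ => unitInterval) e).symm.trans
      Homeomorph.sumArrowHomeomorphProdArrow
  have hR1 : ∀ x i, (R x).1 i = x (e (Sum.inl i)) := fun x i => rfl
  have hR2 : ∀ x i, (R x).2 i = x (e (Sum.inr i)) := fun x i => rfl
  let x : K → ℕ → unitInterval := fun k => (R (φ k)).1
  let y : K → ℕ × ℕ → unitInterval := fun k => (R (φ k)).2
  have hx : Continuous x := by fun_prop
  have hy : Continuous y := by fun_prop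
  have hx1 : ∀ k i, (x k i : ℝ) ∈ Ioo (0 : ℝ) 1 := fun k i => hφ k k.2 _
  have hy1 : ∀ k i, (y k i : ℝ) ∈ Ioo (0 : ℝ) 1 := fun k i => hφ k k.2 _
  obtain ⟨S, hS1, hSi, hS2⟩ := exists_coded (x := x) hy
    (fun k k' h => Subtype.ext (φ.injective (R.injective h))) hy1
  let a : K → ℕ × ℕ → unitInterval := fun k => (S (x k, y k)).2
  have ha : Continuous a := by fun_prop
  obtain ⟨F, hF, hFx⟩ := exists_extension_Ioo (ha.isClosedEmbedding hSi) hx hx1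
  obtain ⟨G, hG, hGb⟩ := exists_extension_Ioo (ha.isClosedEmbedding hSi) hb hb1
  obtain ⟨H, hH, hHa⟩ := exists_extension_Ioo (hb.isClosedEmbedding hbi) ha hS2
  let T := fiberHomeo (X := ℕ × ℕ → unitInterval) (ι := ℕ)
    (fun y i t => plI (F y i) (G y i) t) (fun y i t => plI (G y i) (F y i) t)
    (fun i => Continuous.plI ((hF i).comp continuous_fst) ((hG i).comp continuous_fst)
      continuous_snd)
    (fun i => Continuous.plI ((hG i).comp continuous_fst) ((hF i).comp continuous_fst)
      continuous_snd)
    (fun y i t => plI_plI _ _ _) (fun y i t => plI_plI _ _ _)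
  let U := fiberHomeo (X := ℕ → unitInterval) (ι := ℕ × ℕ)
    (fun x i t => plI (H x i) midI t) (fun x i t => plI midI (H x i) t)
    (fun i => Continuous.plI ((hH i).comp continuous_fst) continuous_const continuous_snd)
    (fun i => Continuous.plI continuous_const ((hH i).comp continuous_fst) continuous_snd)
    (fun y i t => plI_plI _ _ _) (fun y i t => plI_plI _ _ _)
  let C := Homeomorph.prodComm (ℕ → unitInterval) (ℕ × ℕ → unitInterval)
  refine ⟨(((φ.trans R).trans S).trans ((C.trans T).trans C.symm)).trans U, fun k => ?_⟩
  have h1 : S (R (φ k)) = (x k, a k) := Prod.ext (hS1 _) rfl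
  have h2 : T (a k, x k) = (a k, b k) := by
    refine Prod.ext rfl (funext fun i => ?_)
    exact plI_eq (hFx k i) (hGb k i)
  have h3 : (U (b k, a k)).1 = b k := rfl
  have h4 : ∀ i, ((U (b k, a k)).2 i : ℝ) = 1 / 2 := by
    intro i
    have : (U (b k, a k)).2 i = ⟨1 / 2, by norm_num, by norm_num⟩ :=
      plI_eq (b := midI) (hHa k i) rfl
    rw [this]
  simp only [Homeomorph.trans_apply, h1]
  have h5 : C.symm (T (C (x k, a k))) = (b k, a k) := by
    change (T (a k, x k)).swap = _
    rw [h2]; rfl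
  rw [h5]
  exact ⟨h3, h4⟩

section Recursion

variable (ρ : ℕ → ℕ → ℝ)

/-- The least value in `[0, 1]` at `n` compatible with the values of `v` before `n`. -/
noncomputable def lowerVal (v : ℕ → ℝ) (n : ℕ) : ℝ :=
  (Finset.range n).fold max 0 fun i => v i - ρ i n

/-- The greatest value in `[0, 1]` at `n` compatible with the values of `v` before `n`. -/
noncomputable def upperVal (v : ℕ → ℝ) (n : ℕ) : ℝ :=
  (Finset.range n).fold min 1 fun i => v i + ρ i n

variable {ρ}

lemma lowerVal_congr {v w : ℕ → ℝ} {n : ℕ} (h : ∀ i < n, v i = w i) :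
    lowerVal ρ v n = lowerVal ρ w n :=
  Finset.fold_congr fun i hi => by rw [h i (Finset.mem_range.1 hi)]

lemma upperVal_congr {v w : ℕ → ℝ} {n : ℕ} (h : ∀ i < n, v i = w i) :
    upperVal ρ v n = upperVal ρ w n :=
  Finset.fold_congr fun i hi => by rw [h i (Finset.mem_range.1 hi)]

lemma lowerVal_le_iff {v : ℕ → ℝ} {n : ℕ} {c : ℝ} :
    lowerVal ρ v n ≤ c ↔ 0 ≤ c ∧ ∀ i < n, v i - ρ i n ≤ c := by
  simp [lowerVal, Finset.fold_max_le]

lemma le_upperVal_iff {v : ℕ → ℝ} {n : ℕ} {c : ℝ} :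
    c ≤ upperVal ρ v n ↔ c ≤ 1 ∧ ∀ i < n, c ≤ v i + ρ i n := by
  simp [upperVal, Finset.le_fold_min]

lemma lowerVal_lt_iff {v : ℕ → ℝ} {n : ℕ} {c : ℝ} :
    lowerVal ρ v n < c ↔ 0 < c ∧ ∀ i < n, v i - ρ i n < c := by
  simp [lowerVal, Finset.fold_max_lt]

lemma lt_upperVal_iff {v : ℕ → ℝ} {n : ℕ} {c : ℝ} :
    c < upperVal ρ v n ↔ c < 1 ∧ ∀ i < n, c < v i + ρ i n := by
  simp [upperVal, Finset.lt_fold_min]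

lemma continuous_lowerVal (n : ℕ) : Continuous fun v => lowerVal ρ v n := by
  unfold lowerVal
  induction Finset.range n using Finset.induction_on with
  | empty => simpa using continuous_const
  | insert a s ha ih =>
    simp only [Finset.fold_insert ha]
    exact ((continuous_apply a).sub continuous_const).max ih

lemma continuous_upperVal (n : ℕ) : Continuous fun v => upperVal ρ v n := by
  unfold upperVal
  induction Finset.range n using Finset.induction_on with
  | empty => simpa using continuous_const
  | insert a s ha ih =>
    simp only [Finset.fold_insert ha]
    exact ((continuous_apply a).add continuous_const).min ih

/-- The strict triangle inequality, together with symmetry and positivity. -/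
structure IsStrictDist (ρ : ℕ → ℕ → ℝ) : Prop where
  symm : ∀ i j, ρ i j = ρ j i
  self : ∀ i, ρ i i = 0
  pos : ∀ i j, i ≠ j → 0 < ρ i j
  lt : ∀ i j n, n ≠ i → n ≠ j → ρ i j < ρ i n + ρ j n

lemma lowerVal_lt_upperVal (hρ : IsStrictDist ρ) {v : ℕ → ℝ} {n : ℕ}
    (hv : ∀ i < n, v i ∈ Icc (0 : ℝ) 1) (hv' : ∀ i < n, ∀ j < n, |v i - v j| ≤ ρ i j) :
    lowerVal ρ v n < upperVal ρ v n := by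
  have h0 : ∀ i < n, 0 < ρ i n := fun i hi => hρ.pos i n hi.ne
  refine lowerVal_lt_iff.2 ⟨lt_upperVal_iff.2 ⟨one_pos, fun i hi => ?_⟩,
    fun i hi => lt_upperVal_iff.2 ⟨?_, fun j hj => ?_⟩⟩
  · linarith [h0 i hi, (hv i hi).1]
  · linarith [h0 i hi, (hv i hi).2]
  · have h1 := hρ.lt i j n hi.ne' hj.ne'
    have h2 := (abs_le.1 (hv' i hi j hj)).2
    linarith

/-- The sequence whose value at `n` divides the interval of admissible values in the ratio
prescribed by `t n`. -/
noncomputable def solveVal (ρ : ℕ → ℕ → ℝ) (t : ℕ → unitInterval) (n : ℕ) : ℝ :=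
  lowerVal ρ (fun i => if _h : i < n then solveVal ρ t i else 0) n +
    t n * (upperVal ρ (fun i => if _h : i < n then solveVal ρ t i else 0) n -
      lowerVal ρ (fun i => if _h : i < n then solveVal ρ t i else 0) n)
termination_by n

lemma solveVal_eq (t : ℕ → unitInterval) (n : ℕ) : solveVal ρ t n =
    lowerVal ρ (solveVal ρ t) n +
      t n * (upperVal ρ (solveVal ρ t) n - lowerVal ρ (solveVal ρ t) n) := by
  have h : ∀ i < n, (if _h : i < n then solveVal ρ t i else 0) = solveVal ρ t i :=
    fun i hi => dif_pos hi
  rw [solveVal, lowerVal_congr h, upperVal_congr h]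

lemma solveVal_spec (hρ : IsStrictDist ρ) (t : ℕ → unitInterval) (n : ℕ) :
    (∀ i < n, solveVal ρ t i ∈ Icc (0 : ℝ) 1) ∧
      ∀ i < n, ∀ j < n, |solveVal ρ t i - solveVal ρ t j| ≤ ρ i j := by
  induction n with
  | zero => simp
  | succ n ih =>
    have hlt := lowerVal_lt_upperVal hρ ih.1 ih.2
    have hl : lowerVal ρ (solveVal ρ t) n ≤ solveVal ρ t n := by
      rw [solveVal_eq]
      nlinarith [(t n).2.1]
    have hu : solveVal ρ t n ≤ upperVal ρ (solveVal ρ t) n := by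
      rw [solveVal_eq]
      nlinarith [(t n).2.2]
    rw [lowerVal_le_iff] at hl
    rw [le_upperVal_iff] at hu
    refine ⟨fun i hi => ?_, fun i hi j hj => ?_⟩
    · rcases Nat.lt_succ_iff_lt_or_eq.1 hi with h | rfl
      · exact ih.1 i h
      · exact ⟨hl.1, hu.1⟩
    · rcases Nat.lt_succ_iff_lt_or_eq.1 hi with h | rfl <;>
        rcases Nat.lt_succ_iff_lt_or_eq.1 hj with h' | rfl
      · exact ih.2 i h j h'
      · rw [abs_le]
        constructor <;> linarith [hl.2 i h, hu.2 i h]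
      · rw [hρ.symm, abs_le]
        constructor <;> linarith [hl.2 j h', hu.2 j h']
      · simp [hρ.self]

end Recursion

section Holder

variable (Z : Type*) [MetricSpace Z]

/-- The functions `Z → [0,1]` which are `1/2`-Hölder with constant `1`. -/
def holderSet : Set (Z → unitInterval) :=
  {φ | ∀ z w, |(φ z : ℝ) - φ w| ≤ √(dist z w)}

lemma isClosed_holderSet : IsClosed (holderSet Z) := by
  simp only [holderSet, Set.ofPred_forall]
  exact isClosed_iInter fun z => isClosed_iInter fun w =>
    isClosed_le (by fun_prop) continuous_const

instance : CompactSpace (holderSet Z) :=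
  isCompact_iff_compactSpace.1 (isClosed_holderSet Z).isCompact

variable {Z}

lemma sqrt_dist_lt {x y z : Z} (hx : z ≠ x) (hy : z ≠ y) :
    √(dist x y) < √(dist x z) + √(dist y z) := by
  have h1 : 0 < √(dist x z) := Real.sqrt_pos.2 (dist_pos.2 hx.symm)
  have h2 : 0 < √(dist y z) := Real.sqrt_pos.2 (dist_pos.2 hy.symm)
  rw [Real.sqrt_lt' (by positivity)]
  have h3 := Real.sq_sqrt (dist_nonneg (x := x) (y := z))
  have h4 := Real.sq_sqrt (dist_nonneg (x := y) (y := z))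
  have h5 := dist_triangle_right x y z
  nlinarith [mul_pos h1 h2]

lemma sqrt_dist_le (x y z : Z) : √(dist x y) ≤ √(dist x z) + √(dist y z) := by
  rcases eq_or_ne z x with rfl | hx
  · simp [dist_comm]
  rcases eq_or_ne z y with rfl | hy
  · simp
  exact (sqrt_dist_lt hx hy).le

lemma isStrictDist_sqrt_dist {c : ℕ → Z} (hc : Function.Injective c) :
    IsStrictDist fun i j => √(dist (c i) (c j)) where
  symm i j := by rw [dist_comm]
  self i := by simp
  pos i j h := Real.sqrt_pos.2 (dist_pos.2 (hc.ne h))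
  lt i j n hi hj := sqrt_dist_lt (hc.ne hi) (hc.ne hj)

lemma continuous_eval_holderSet :
    Continuous fun p : holderSet Z × Z => p.1.1 p.2 := by
  rw [continuous_iff_continuousAt]
  rintro ⟨φ, z⟩
  rw [ContinuousAt, tendsto_iff_dist_tendsto_zero]
  have hc : Continuous fun p : holderSet Z × Z => √(dist p.2 z) + dist (p.1.1 z) (φ.1 z) := by
    have h : Continuous fun p : holderSet Z × Z => p.1.1 z :=
      (continuous_apply z).comp (continuous_subtype_val.comp continuous_fst)
    fun_prop
  refine squeeze_zero (fun _ => dist_nonneg) (fun p => ?_) (hc.tendsto' (φ, z) 0 (by simp))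
  refine (dist_triangle _ (p.1.1 z) _).trans (add_le_add_left ?_ _)
  exact p.1.2 p.2 z

/-- Extension of Hölder functions. -/
lemma exists_holder_extension {c : ℕ → Z} {v : ℕ → ℝ} (hv : ∀ i, v i ∈ Icc (0 : ℝ) 1)
    (hv' : ∀ i j, |v i - v j| ≤ √(dist (c i) (c j))) :
    ∃ φ ∈ holderSet Z, ∀ i, (φ (c i) : ℝ) = v i := by
  let F : Z → ℝ := fun z => ⨅ i, v i + √(dist (c i) z)
  have hF0 : ∀ z i, 0 ≤ v i + √(dist (c i) z) := fun z i =>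
    add_nonneg (hv i).1 (Real.sqrt_nonneg _)
  have hbdd : ∀ z, BddBelow (range fun i => v i + √(dist (c i) z)) := fun z =>
    ⟨0, by rintro _ ⟨i, rfl⟩; exact hF0 z i⟩
  have hFc : ∀ i, F (c i) = v i := by
    intro i
    refine le_antisymm ((ciInf_le (hbdd _) i).trans (by simp)) (le_ciInf fun j => ?_)
    have := (abs_le.1 (hv' i j)).2
    rw [dist_comm] at this
    linarith
  have hFle : ∀ z w, F z ≤ F w + √(dist z w) := by
    intro z w
    rw [← sub_le_iff_le_add]
    refine le_ciInf fun i => ?_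
    have h1 := ciInf_le (hbdd z) i
    have h2 := sqrt_dist_le (c i) z w
    change F z ≤ _ at h1
    linarith
  refine ⟨fun z => ⟨min 1 (F z), le_min zero_le_one (le_ciInf (hF0 z)), min_le_left _ _⟩,
    fun z w => ?_, fun i => ?_⟩
  · change |min 1 (F z) - min 1 (F w)| ≤ _
    refine (abs_min_sub_min_le_max _ _ _ _).trans ?_
    rw [sub_self, abs_zero, max_eq_right (abs_nonneg _), abs_le]
    have h1 := hFle z w
    have h2 := hFle w z
    rw [dist_comm w z] at h2
    constructor <;> linarith
  · change min 1 (F (c i)) = _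
    rw [hFc, min_eq_right (hv i).2]

lemma exists_injective_denseRange (Z : Type*) [TopologicalSpace Z] [T1Space Z] [Infinite Z]
    [TopologicalSpace.SeparableSpace Z] :
    ∃ c : ℕ → Z, Function.Injective c ∧ DenseRange c := by
  obtain ⟨s, hs, hd⟩ := TopologicalSpace.exists_countable_dense Z
  have hi : s.Infinite := fun hf => by
    have h1 : s = univ := by rw [← hf.isClosed.closure_eq, hd.closure_eq]
    exact infinite_univ (h1 ▸ hf)
  have : Infinite s := hi.to_subtype
  have : Countable s := hs
  obtain ⟨e⟩ := nonempty_equiv_of_countable (α := ℕ) (β := s)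
  refine ⟨fun n => e n, Subtype.val_injective.comp e.injective, ?_⟩
  have : range (fun n => (e n : Z)) = s := by
    rw [show (fun n => (e n : Z)) = Subtype.val ∘ e from rfl, e.surjective.range_comp]
    exact Subtype.range_coe
  rw [DenseRange, this]
  exact hd

/-- The space of Hölder functions is a Hilbert cube, in such a way that the strictly Hölder
functions lie in the pseudo-interior. -/
lemma exists_holder_homeo (Z : Type*) [MetricSpace Z] [Infinite Z]
    [TopologicalSpace.SeparableSpace Z] :
    ∃ e : holderSet Z ≃ₜ (ℕ → unitInterval), ∀ φ : holderSet Z,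
      (∀ z, (φ.1 z : ℝ) ∈ Ioo (0 : ℝ) 1) →
      (∀ z w, z ≠ w → |(φ.1 z : ℝ) - φ.1 w| < √(dist z w)) →
      ∀ n, (e φ n : ℝ) ∈ Ioo (0 : ℝ) 1 := by
  obtain ⟨c, hc, hd⟩ := exists_injective_denseRange Z
  set ρ : ℕ → ℕ → ℝ := fun i j => √(dist (c i) (c j)) with hρdef
  have hρ : IsStrictDist ρ := isStrictDist_sqrt_dist hc
  let V : holderSet Z → ℕ → ℝ := fun φ i => φ.1 (c i)
  have hV : Continuous V := continuous_pi fun i =>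
    continuous_subtype_val.comp ((continuous_apply (c i)).comp continuous_subtype_val)
  let a : holderSet Z → ℕ → ℝ := fun φ n => lowerVal ρ (V φ) n
  let b : holderSet Z → ℕ → ℝ := fun φ n => upperVal ρ (V φ) n
  have hab : ∀ φ n, a φ n < b φ n := fun φ n =>
    lowerVal_lt_upperVal hρ (fun i _ => (φ.1 (c i)).2) fun i _ j _ => φ.2 _ _
  have ha : ∀ φ n, a φ n ≤ V φ n := fun φ n => by
    refine lowerVal_le_iff.2 ⟨(φ.1 (c n)).2.1, fun i _ => ?_⟩
    have := (abs_le.1 (φ.2 (c i) (c n))).2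
    change (φ.1 (c i) : ℝ) - √(dist (c i) (c n)) ≤ φ.1 (c n)
    linarith
  have hb : ∀ φ n, V φ n ≤ b φ n := fun φ n => by
    refine le_upperVal_iff.2 ⟨(φ.1 (c n)).2.2, fun i _ => ?_⟩
    have := (abs_le.1 (φ.2 (c i) (c n))).1
    change (φ.1 (c n) : ℝ) ≤ φ.1 (c i) + √(dist (c i) (c n))
    linarith
  let E : holderSet Z → ℕ → unitInterval := fun φ n =>
    ⟨(V φ n - a φ n) / (b φ n - a φ n),
      div_nonneg (sub_nonneg.2 (ha φ n)) (sub_nonneg.2 (hab φ n).le),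
      (div_le_one (sub_pos.2 (hab φ n))).2 (sub_le_sub_right (hb φ n) _)⟩
  have hEV : ∀ φ n, V φ n = a φ n + E φ n * (b φ n - a φ n) := fun φ n => by
    change V φ n = a φ n + (V φ n - a φ n) / (b φ n - a φ n) * (b φ n - a φ n)
    rw [div_mul_cancel₀ _ (sub_pos.2 (hab φ n)).ne']
    ring
  have hE : Continuous E := by
    refine continuous_pi fun n => Continuous.subtype_mk ?_ _
    have h1 : Continuous fun φ => a φ n := (continuous_lowerVal n).comp hV
    have h2 : Continuous fun φ => b φ n := (continuous_upperVal n).comp hV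
    exact (((continuous_apply n).comp hV).sub h1).div (h2.sub h1) fun φ =>
      (sub_pos.2 (hab φ n)).ne'
  have hinj : Function.Injective E := by
    intro φ ψ h
    have h1 : ∀ n, V φ n = V ψ n := by
      intro n
      induction n using Nat.strong_induction_on with
      | _ n ih =>
        have h2 : a φ n = a ψ n := lowerVal_congr ih
        have h3 : b φ n = b ψ n := upperVal_congr ih
        rw [hEV φ n, hEV ψ n, h, h2, h3]
    refine Subtype.ext (hd.equalizer ?_ ?_ (funext fun n => Subtype.ext (h1 n)))
    · exact continuous_eval_holderSet.comp (continuous_const.prodMk continuous_id)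
    · exact continuous_eval_holderSet.comp (continuous_const.prodMk continuous_id)
  have hsurj : Function.Surjective E := by
    intro t
    obtain ⟨φ, hφ, hφv⟩ := exists_holder_extension (c := c) (v := solveVal ρ t)
      (fun i => (solveVal_spec hρ t (i + 1)).1 i (by omega))
      (fun i j => (solveVal_spec hρ t (i + j + 1)).2 i (by omega) j (by omega))
    refine ⟨⟨φ, hφ⟩, funext fun n => Subtype.ext ?_⟩
    have hVs : V ⟨φ, hφ⟩ = solveVal ρ t := funext hφv
    have h1 := hEV ⟨φ, hφ⟩ n
    have h2 := solveVal_eq (ρ := ρ) t n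
    have h3 := hab ⟨φ, hφ⟩ n
    rw [← hVs] at h2
    rw [h2] at h1
    exact (mul_right_cancel₀ (sub_pos.2 h3).ne' (add_left_cancel h1)).symm
  refine ⟨hE.homeoOfEquivCompactToT2 (f := Equiv.ofBijective E ⟨hinj, hsurj⟩),
    fun φ h0 h1 n => ?_⟩
  change (V φ n - a φ n) / (b φ n - a φ n) ∈ Ioo (0 : ℝ) 1
  have h2 : a φ n < V φ n := by
    refine lowerVal_lt_iff.2 ⟨(h0 _).1, fun i hi => ?_⟩
    have := (abs_lt.1 (h1 (c i) (c n) (hc.ne hi.ne))).2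
    change (φ.1 (c i) : ℝ) - √(dist (c i) (c n)) < φ.1 (c n)
    linarith
  have h3 : V φ n < b φ n := by
    refine lt_upperVal_iff.2 ⟨(h0 _).2, fun i hi => ?_⟩
    have := (abs_lt.1 (h1 (c i) (c n) (hc.ne hi.ne))).1
    change (φ.1 (c n) : ℝ) < φ.1 (c i) + √(dist (c i) (c n))
    linarith
  exact ⟨div_pos (sub_pos.2 h2) (sub_pos.2 (hab φ n)),
    (div_lt_one (sub_pos.2 (hab φ n))).2 (sub_lt_sub_right h3 _)⟩

end Holder

section Model

variable {K : Type*} [TopologicalSpace K] [CompactSpace K]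

lemma abs_eval_sub_le_sqrt_dist (k : K) (p q : C(K, unitInterval) × ℕ) :
    |(p.1 k : ℝ) - q.1 k| ≤ √(dist p q) := by
  have h1 : |(p.1 k : ℝ) - q.1 k| ≤ dist p q :=
    (ContinuousMap.dist_apply_le_dist (f := p.1) (g := q.1) k).trans (le_max_left _ _)
  have h2 : |(p.1 k : ℝ) - q.1 k| ≤ 1 := by
    rw [abs_le]
    constructor <;> linarith [(p.1 k).2.1, (p.1 k).2.2, (q.1 k).2.1, (q.1 k).2.2]
  refine Real.le_sqrt_of_sq_le ?_
  nlinarith [abs_nonneg ((p.1 k : ℝ) - q.1 k)]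

/-- The point of the model of the Hilbert cube corresponding to a point of `K`. -/
noncomputable def modelPoint (k : K) : holderSet (C(K, unitInterval) × ℕ) :=
  ⟨fun p => ⟨1 / 4 + p.1 k / 2, by linarith [(p.1 k).2.1], by linarith [(p.1 k).2.2]⟩, by
    intro p q
    change |(1 / 4 + (p.1 k : ℝ) / 2) - (1 / 4 + (q.1 k : ℝ) / 2)| ≤ _
    have h3 := abs_eval_sub_le_sqrt_dist k p q
    rw [show (1 / 4 + (p.1 k : ℝ) / 2) - (1 / 4 + (q.1 k : ℝ) / 2) =
      ((p.1 k : ℝ) - q.1 k) / 2 by ring, abs_div, abs_two]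
    linarith [abs_nonneg ((p.1 k : ℝ) - q.1 k)]⟩

lemma coe_modelPoint (k : K) (p : C(K, unitInterval) × ℕ) :
    ((modelPoint k).1 p : ℝ) = 1 / 4 + p.1 k / 2 := rfl

lemma modelPoint_mem_Ioo (k : K) (p : C(K, unitInterval) × ℕ) :
    ((modelPoint k).1 p : ℝ) ∈ Ioo (0 : ℝ) 1 := by
  rw [coe_modelPoint]
  constructor <;> linarith [(p.1 k).2.1, (p.1 k).2.2]

lemma abs_modelPoint_sub_lt (k : K) {p q : C(K, unitInterval) × ℕ} (h : p ≠ q) :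
    |((modelPoint k).1 p : ℝ) - (modelPoint k).1 q| < √(dist p q) := by
  have h3 := abs_eval_sub_le_sqrt_dist k p q
  rw [coe_modelPoint, coe_modelPoint, show (1 / 4 + (p.1 k : ℝ) / 2) - (1 / 4 + (q.1 k : ℝ) / 2) =
    ((p.1 k : ℝ) - q.1 k) / 2 by ring, abs_div, abs_two]
  linarith [Real.sqrt_pos.2 (dist_pos.2 h)]

lemma continuous_modelPoint : Continuous (modelPoint (K := K)) := by
  refine Continuous.subtype_mk (continuous_pi fun p => Continuous.subtype_mk ?_ _) _
  fun_prop

lemma modelPoint_injective [T2Space K] : Function.Injective (modelPoint (K := K)) := by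
  intro k k' h
  by_contra hne
  obtain ⟨f, hf0, hf1, hf⟩ := exists_continuous_zero_one_of_isClosed (isClosed_singleton (x := k))
    (isClosed_singleton (x := k')) (by simpa using hne)
  let F : C(K, unitInterval) := ⟨fun x => ⟨f x, hf x⟩, f.continuous.subtype_mk _⟩
  have h1 := coe_modelPoint k (F, 0)
  rw [h, coe_modelPoint] at h1
  have e1 : ((F k : unitInterval) : ℝ) = 0 := hf0 rfl
  have e2 : ((F k' : unitInterval) : ℝ) = 1 := hf1 rfl
  change (1 / 4 + ((F k' : unitInterval) : ℝ) / 2) = 1 / 4 + ((F k : unitInterval) : ℝ) / 2 at h1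
  rw [e1, e2] at h1
  norm_num at h1

/-- The action of the self-maps of `K` on the model of the Hilbert cube. -/
def modelAct (g : C(K, K)) (φ : holderSet (C(K, unitInterval) × ℕ)) :
    holderSet (C(K, unitInterval) × ℕ) :=
  ⟨fun p => φ.1 (p.1.comp g, p.2), by
    intro p q
    refine (φ.2 _ _).trans (Real.sqrt_le_sqrt (max_le_max ?_ le_rfl))
    exact (ContinuousMap.dist_le dist_nonneg).2 fun x =>
      ContinuousMap.dist_apply_le_dist (f := p.1) (g := q.1) (g x)⟩

lemma modelAct_modelPoint (g : C(K, K)) (k : K) :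
    modelAct g (modelPoint k) = modelPoint (g k) := rfl

lemma modelAct_id (φ : holderSet (C(K, unitInterval) × ℕ)) :
    modelAct (ContinuousMap.id K) φ = φ := rfl

lemma modelAct_comp (g g' : C(K, K)) (φ : holderSet (C(K, unitInterval) × ℕ)) :
    modelAct (g.comp g') φ = modelAct g (modelAct g' φ) := rfl

lemma continuous_modelAct :
    Continuous fun p : C(K, K) × holderSet (C(K, unitInterval) × ℕ) => modelAct p.1 p.2 := by
  refine Continuous.subtype_mk (continuous_pi fun q => ?_) _
  exact continuous_eval_holderSet.comp
    (continuous_snd.prodMk ((continuous_const.compCM continuous_fst).prodMk continuous_const))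

end Model

/-- Self-maps of a `Z`-set extend to the Hilbert cube, continuously and functorially. -/
lemma IsZSet.exists_extension_operator {K : Set HCube} (hK : IsZSet K) :
    ∃ s : C(K, K) → C(HCube, HCube), Continuous s ∧ s (ContinuousMap.id K) = ContinuousMap.id _ ∧
      (∀ g g', s (g.comp g') = (s g).comp (s g')) ∧ ∀ g (k : K), s g k = g k := by
  have : CompactSpace K := isCompact_iff_compactSpace.1 hK.1.isCompact
  obtain ⟨e, he⟩ := exists_holder_homeo (C(K, unitInterval) × ℕ)
  obtain ⟨Ψ, hΨ⟩ := hK.exists_homeo_extend (b := fun k => e (modelPoint k))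
    (e.continuous.comp continuous_modelPoint) (e.injective.comp modelPoint_injective)
    fun k => he _ (modelPoint_mem_Ioo k) fun _ _ => abs_modelPoint_sub_lt k
  let S : C(C(K, K) × HCube, HCube) :=
    ⟨fun p => Ψ.symm (e (modelAct p.1 (e.symm (Ψ p.2).1)), (Ψ p.2).2), by
      have h := continuous_modelAct (K := K).comp (continuous_fst.prodMk
        (e.symm.continuous.comp (continuous_fst.comp (Ψ.continuous.comp continuous_snd))) :
          Continuous fun p : C(K, K) × HCube => (p.1, e.symm (Ψ p.2).1))
      exact Ψ.symm.continuous.comp ((e.continuous.comp h).prodMk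
        (continuous_snd.comp (Ψ.continuous.comp continuous_snd)))⟩
  have hS : ∀ g x, S (g, x) = Ψ.symm (e (modelAct g (e.symm (Ψ x).1)), (Ψ x).2) :=
    fun g x => rfl
  refine ⟨S.curry, S.curry.continuous, ContinuousMap.ext fun x => ?_,
    fun g g' => ContinuousMap.ext fun x => ?_, fun g k => ?_⟩
  · change S (_, x) = x
    rw [hS, modelAct_id, e.apply_symm_apply, Ψ.symm_apply_apply]
  · change S (_, x) = S (g, S (g', x))
    rw [hS, hS g, hS g', Ψ.apply_symm_apply, e.symm_apply_apply, modelAct_comp]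
  · change S (g, k) = g k
    rw [hS, (hΨ k).1, e.symm_apply_apply, modelAct_modelPoint, Ψ.symm_apply_eq]
    refine Prod.ext (hΨ (g k)).1.symm (funext fun i => Subtype.ext ?_)
    rw [(hΨ k).2, (hΨ (g k)).2]

namespace Auth

variable {K : Set HCube}

@[ext] lemma ext {u v : Auth K} (h : ∀ x, u.1 x = v.1 x) : u = v :=
  Subtype.ext (Homeomorph.ext h)

/-- An element of `Auth K` as a continuous map. -/
def toCM (u : Auth K) : C(HCube, HCube) := ⟨u.1, u.1.continuous⟩

lemma isInducing_toCM : IsInducing (toCM (K := K)) := ⟨unifTop_eq_induced toCM⟩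

lemma continuous_authComp : Continuous fun p : Auth K × Auth K => authComp p.1 p.2 := by
  rw [isInducing_toCM.continuous_iff]
  exact (isInducing_toCM.continuous.comp continuous_fst).compCM
    (isInducing_toCM.continuous.comp continuous_snd)

lemma continuous_authInv : Continuous (authInv (K := K)) := by
  rw [isInducing_toCM.continuous_iff, ContinuousMap.continuous_compactOpen]
  intro C hC U hU
  have h : {u : Auth K | MapsTo (toCM (authInv u)) C U} =
      {u | MapsTo (toCM u) Uᶜ Cᶜ} := by
    ext u
    constructor
    · intro h x hx hxC
      refine hx ?_
      have := h hxC
      rwa [show toCM (authInv u) (toCM u x) = x from u.1.symm_apply_apply x] at this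
    · intro h x hx
      by_contra hxU
      refine h hxU ?_
      rwa [show toCM u (toCM (authInv u) x) = x from u.1.apply_symm_apply x]
  change IsOpen {u : Auth K | MapsTo (toCM (authInv u)) C U}
  rw [h]
  exact (ContinuousMap.isOpen_setOfPred_mapsTo hU.isClosed_compl.isCompact
    hC.isClosed.isOpen_compl).preimage isInducing_toCM.continuous

lemma apply_mem (u : Auth K) {x : HCube} (hx : x ∈ K) : u.1 x ∈ K := by
  have := mem_image_of_mem u.1 hx
  rwa [u.2] at this

/-- The restriction of an element of `Auth K` to `K`. -/
def res (u : Auth K) : C(K, K) :=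
  ⟨fun k => ⟨u.1 k, u.apply_mem k.2⟩, by
    exact (u.1.continuous.comp continuous_subtype_val).subtype_mk _⟩

lemma continuous_res : Continuous (res (K := K)) := by
  rw [(ContinuousMap.isInducing_postcomp (⟨Subtype.val, continuous_subtype_val⟩ : C(K, HCube))
    IsInducing.subtypeVal).continuous_iff]
  exact (ContinuousMap.continuous_precomp
    (⟨Subtype.val, continuous_subtype_val⟩ : C(K, HCube))).comp isInducing_toCM.continuous

lemma res_comp (u v : Auth K) : (authComp u v).res = u.res.comp v.res := rfl

lemma res_id : (authId K).res = ContinuousMap.id K := rfl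

lemma comp_inv (u : Auth K) : authComp u (authInv u) = authId K :=
  ext fun x => u.1.apply_symm_apply x

lemma inv_comp (u : Auth K) : authComp (authInv u) u = authId K :=
  ext fun x => u.1.symm_apply_apply x

lemma comp_assoc (u v w : Auth K) : authComp (authComp u v) w = authComp u (authComp v w) := rfl

lemma comp_id (u : Auth K) : authComp u (authId K) = u := rfl

lemma id_comp (u : Auth K) : authComp (authId K) u = u := rfl

lemma mem_Auth₀_iff {u : Auth K} : u ∈ Auth₀ K ↔ u.res = ContinuousMap.id K :=
  ⟨fun h => ContinuousMap.ext fun k => Subtype.ext (h k k.2),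
    fun h x hx => congrArg Subtype.val (DFunLike.congr_fun h (⟨x, hx⟩ : K))⟩

end Auth

/-- A continuous homomorphic extension operator for the homeomorphisms of a `Z`-set. -/
lemma IsZSet.exists_section {K : Set HCube} (hK : IsZSet K) :
    ∃ S : Auth K → Auth K, Continuous S ∧ S (authId K) = authId K ∧
      (∀ u v, S (authComp u v) = authComp (S u) (S v)) ∧ (∀ u, (S u).res = u.res) ∧
      ∀ u v : Auth K, u.res = v.res → S u = S v := by
  obtain ⟨s, hs, hs1, hsc, hsK⟩ := hK.exists_extension_operator
  have hinv : ∀ u v : Auth K, authComp u v = authId K → ∀ x, s u.res (s v.res x) = x := by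
    intro u v h x
    rw [← ContinuousMap.comp_apply, ← hsc, ← Auth.res_comp, h, Auth.res_id, hs1]
    rfl
  have hmem : ∀ (u : Auth K), ∀ x ∈ K, s u.res x = u.1 x := fun u x hx => hsK u.res ⟨x, hx⟩
  let S : Auth K → Auth K := fun u =>
    ⟨{  toFun := s u.res
        invFun := s (authInv u).res
        left_inv := hinv _ _ u.inv_comp
        right_inv := hinv _ _ u.comp_inv
        continuous_toFun := (s u.res).continuous
        continuous_invFun := (s (authInv u).res).continuous }, by
      change s u.res '' K = K
      rw [image_congr (hmem u), u.2]⟩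
  have hS : ∀ u x, (S u).1 x = s u.res x := fun u x => rfl
  refine ⟨S, ?_, ?_, fun u v => ?_, fun u => ?_, fun u v h => ?_⟩
  · rw [Auth.isInducing_toCM.continuous_iff]
    exact hs.comp Auth.continuous_res
  · refine Auth.ext fun x => ?_
    rw [hS, Auth.res_id, hs1]
    rfl
  · refine Auth.ext fun x => ?_
    rw [hS, Auth.res_comp, hsc]
    rfl
  · exact ContinuousMap.ext fun k => Subtype.ext (hsK u.res k)
  · exact Auth.ext fun x => by rw [hS, hS, h]

/-- **Decomposition of the homeomorphism group `Auth(Q,K)` over a `Z`-set `K`.**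
There is a closed subgroup `G` of `Auth(Q,K)` such that
`Φ : Auth₀(Q,K) × G → Auth(Q,K)`, `Φ(u,v) = u ∘ v`, is a homeomorphism. -/
theorem auth_decomposition (K : Set HCube) (hK : IsZSet K) :
    ∃ G : Set (Auth K),
      authId K ∈ G ∧
      (∀ u ∈ G, ∀ v ∈ G, authComp u v ∈ G) ∧
      (∀ u ∈ G, authInv u ∈ G) ∧
      IsClosed G ∧
      IsHomeomorph (fun p : ↥(Auth₀ K) × ↥G => authComp p.1.1 p.2.1) := by
  obtain ⟨S, hS, hS1, hSc, hSr, hSK⟩ := hK.exists_section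
  have hSi : ∀ u, S (authInv u) = authInv (S u) := fun u => by
    rw [← Auth.id_comp (S (authInv u)), ← (S u).inv_comp, Auth.comp_assoc, ← hSc, u.comp_inv, hS1,
      Auth.comp_id]
  have hSS : ∀ u, S (S u) = S u := fun u => hSK _ _ (hSr u)
  refine ⟨{u | S u = u}, hS1, fun u hu v hv => ?_, fun u hu => ?_, ?_, ?_⟩
  · change S _ = _
    rw [hSc, hu, hv]
  · change S _ = _
    rw [hSi, hu]
  · have : {u | S u = u} = {u | (S u).toCM = u.toCM} := by
      ext u
      exact ⟨fun h => congrArg Auth.toCM h, fun h => Auth.ext fun x => DFunLike.congr_fun h x⟩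
    rw [this]
    exact isClosed_eq (Auth.isInducing_toCM.continuous.comp hS) Auth.isInducing_toCM.continuous
  · have hcomp : ∀ u ∈ Auth₀ K, ∀ v, S v = v → S (authComp u v) = v := by
      intro u hu v hv
      rw [← hv]
      conv_rhs => rw [← hSS]
      refine hSK _ _ ?_
      rw [Auth.res_comp, Auth.mem_Auth₀_iff.1 hu, ContinuousMap.id_comp]
    have hdiv : ∀ u, authComp u (authInv (S u)) ∈ Auth₀ K := fun u => by
      rw [Auth.mem_Auth₀_iff, Auth.res_comp, ← hSi, hSr, ← Auth.res_comp, u.comp_inv,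
        Auth.res_id]
    let Φ : ↥(Auth₀ K) × ↥{u : Auth K | S u = u} ≃ₜ Auth K :=
      { toFun := fun p => authComp p.1.1 p.2.1
        invFun := fun h => (⟨_, hdiv h⟩, ⟨S h, hSS h⟩)
        left_inv := by
          rintro ⟨⟨u, hu⟩, v, hv⟩
          have h := hcomp u hu v hv
          refine Prod.ext (Subtype.ext ?_) (Subtype.ext h)
          change authComp (authComp u v) (authInv (S (authComp u v))) = u
          rw [h, Auth.comp_assoc, v.comp_inv, Auth.comp_id]
        right_inv := fun h => by
          change authComp (authComp h (authInv (S h))) (S h) = h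
          rw [Auth.comp_assoc, (S h).inv_comp, Auth.comp_id]
        continuous_toFun := Auth.continuous_authComp.comp
          ((continuous_subtype_val.comp continuous_fst).prodMk
            (continuous_subtype_val.comp continuous_snd))
        continuous_invFun := ((Auth.continuous_authComp.comp
          (continuous_id.prodMk (Auth.continuous_authInv.comp hS))).subtype_mk hdiv).prodMk
            (hS.subtype_mk hSS) }
    exact Φ.isHomeomorph
end

section
/- Let X be a nonempty separable completely metrizable (Polish) space, let Y be a separable metrizable space, and let f : X → Y be continuous. Then for every Borel measurable function v : [0,1] → Y whose range is contained in f(X), there exists a Lebesgue measurable function u : [0,1] → X such that f(u(t)) = v(t) for every t ∈ [0,1]. Consequently, for every Lebesgue measurable v : [0,1] → Y with v(t) ∈ f(X) for almost every t, there exists a Lebesgue measurable u : [0,1] → X with f(u(t)) = v(t) for almost every t ∈ [0,1]. -/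
open MeasureTheory Set

/-- The unit interval `[0,1]` with the (completed) Lebesgue measure. -/
abbrev I01 : Type := Set.Icc (0 : ℝ) 1

open Filter TopologicalSpace
open scoped Topology ENNReal

/-- A continuous map from a nonempty compact set of reals has a Borel section over its range. -/
theorem IsCompact.exists_measurable_section {Y : Type*} [TopologicalSpace Y] [T2Space Y]
    [MeasurableSpace Y] [OpensMeasurableSpace Y] {C : Set ℝ} (hC : IsCompact C)
    (hne : C.Nonempty) (g : C → Y) (hg : Continuous g) :
    ∃ s : Y → C, Measurable s ∧ ∀ y ∈ range g, g (s y) = y := by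
  obtain ⟨M, hM⟩ := hC.bddAbove
  have : CompactSpace C := isCompact_iff_compactSpace.1 hC
  let F : Y → Set ℝ := fun y => (↑) '' (g ⁻¹' {y})
  have hFc (y : Y) : IsCompact (F y) :=
    ((isClosed_singleton.preimage hg).isCompact).image continuous_subtype_val
  have hFb (y : Y) : BddBelow (insert M (F y)) := ((hFc y).insert M).bddBelow
  have hFm (y : Y) : sInf (insert M (F y)) ∈ insert M (F y) :=
    ((hFc y).insert M).sInf_mem (insert_nonempty _ _)
  have hmeas : Measurable fun y => sInf (insert M (F y)) := by
    refine measurable_of_Iic fun a => ?_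
    have : (fun y => sInf (insert M (F y))) ⁻¹' Iic a
        = g '' {c | (c : ℝ) ≤ a} ∪ {_y | M ≤ a} := by
      ext y
      constructor
      · intro h
        rcases hFm y with h' | ⟨c, hc, h'⟩
        · exact Or.inr (h'.symm.trans_le h)
        · exact Or.inl ⟨c, h'.trans_le h, hc⟩
      · rintro (⟨c, hc, rfl⟩ | h)
        · exact (csInf_le (hFb _) (Or.inr ⟨c, rfl, rfl⟩)).trans hc
        · exact (csInf_le (hFb _) (Or.inl rfl)).trans h
    rw [this]
    refine MeasurableSet.union ?_ (MeasurableSet.const _)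
    exact (((isClosed_le continuous_subtype_val continuous_const).isCompact).image
      hg).isClosed.measurableSet
  obtain ⟨r, hr, hrC⟩ := (MeasurableEmbedding.subtype_coe hC.measurableSet).exists_measurable_extend
    measurable_id fun _ => hne.to_subtype
  refine ⟨fun y => r (sInf (insert M (F y))), hr.comp hmeas, ?_⟩
  rintro _ ⟨c, rfl⟩
  have key : sInf (insert M (F (g c))) ∈ F (g c) := by
    rcases hFm (g c) with h | h
    · have h1 : sInf (insert M (F (g c))) ≤ c := csInf_le (hFb _) (Or.inr ⟨c, rfl, rfl⟩)
      have h2 : (c : ℝ) = M := le_antisymm (hM c.2) (h ▸ h1)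
      rw [h, ← h2]
      exact ⟨c, rfl, rfl⟩
    · exact h
  obtain ⟨d, hd, hd'⟩ := key
  beta_reduce
  rw [← hd', show r d = d from congrFun hrC d]
  exact hd

/-- A continuous map on a nonempty compact metrizable space has a Borel section over its range. -/
theorem Continuous.exists_measurable_section {K Y : Type*} [TopologicalSpace K]
    [MetrizableSpace K] [CompactSpace K] [Nonempty K] [MeasurableSpace K] [BorelSpace K]
    [TopologicalSpace Y] [T2Space Y] [MeasurableSpace Y] [OpensMeasurableSpace Y]
    {g : K → Y} (hg : Continuous g) :
    ∃ s : Y → K, Measurable s ∧ ∀ y ∈ range g, g (s y) = y := by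
  let _ : MetricSpace K := metrizableSpaceMetric K
  obtain ⟨p, hp, hps⟩ := exists_nat_bool_continuous_surjective_of_compact K
  have hq : Continuous (p ∘ cantorSetHomeomorphNatToBool) :=
    hp.comp cantorSetHomeomorphNatToBool.continuous
  obtain ⟨s, hs, hsg⟩ := isCompact_cantorSet.exists_measurable_section ⟨0, zero_mem_cantorSet⟩
    (g ∘ p ∘ cantorSetHomeomorphNatToBool) (hg.comp hq)
  refine ⟨p ∘ cantorSetHomeomorphNatToBool ∘ s, hq.measurable.comp hs, ?_⟩
  rintro _ ⟨k, rfl⟩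
  obtain ⟨c, rfl⟩ := (hps.comp cantorSetHomeomorphNatToBool.surjective) k
  exact hsg _ ⟨c, rfl⟩

/-- An open set of the Baire space that contains all points bounded coordinatewise by `b` already
contains all points whose first `n` coordinates are bounded by those of `b`, for some `n`. -/
theorem exists_coordinates_le_subset_of_Iic_subset {b : ℕ → ℕ} {V : Set (ℕ → ℕ)}
    (hV : IsOpen V) (hb : Iic b ⊆ V) : ∃ n, {x : ℕ → ℕ | ∀ i < n, x i ≤ b i} ⊆ V := by
  by_contra! H
  simp only [not_subset] at H
  choose x hx hxV using H
  have hK : IsCompact (Iic b) := by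
    rw [← Icc_bot]
    exact isCompact_Icc
  obtain ⟨z, hz, φ, hφ, hlim⟩ :=
    hK.tendsto_subseq (x := fun n => x n ⊓ b) fun n => (inf_le_right : x n ⊓ b ≤ b)
  have hlim' : Tendsto (x ∘ φ) atTop (𝓝 z) := by
    rw [tendsto_pi_nhds] at hlim ⊢
    intro i
    refine (hlim i).congr' ?_
    filter_upwards [eventually_gt_atTop i] with n hn
    exact inf_eq_left.2 (hx _ i (hn.trans_le (hφ.id_le n)))
  obtain ⟨n, hn⟩ := (hlim'.eventually (hV.mem_nhds (hb hz))).exists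
  exact hxV _ hn

/-- The range of a continuous map on the Baire space is inner regular with respect to images of
the compact sets `Iic b`. -/
theorem Continuous.exists_le_measure_image_Iic {Y : Type*} [TopologicalSpace Y]
    [MeasurableSpace Y] {ν : Measure Y} [ν.OuterRegular] {h : (ℕ → ℕ) → Y} (hh : Continuous h)
    {c : ℝ≥0∞} (hc : c < ν (range h)) : ∃ b : ℕ → ℕ, c ≤ ν (h '' Iic b) := by
  have step (n : ℕ) (A : {A : Set (ℕ → ℕ) // c < ν (h '' A)}) :
      ∃ m : ℕ, c < ν (h '' (A ∩ {x | x n ≤ m})) := by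
    have hmono : Monotone fun m : ℕ => h '' (A.1 ∩ {x | x n ≤ m}) := fun m m' hm =>
      image_mono (inter_subset_inter_right _ fun x (hx : x n ≤ m) => hx.trans hm)
    have hU : ⋃ m : ℕ, h '' (A.1 ∩ {x | x n ≤ m}) = h '' A := by
      rw [← image_iUnion, ← inter_iUnion]
      congr 1
      exact inter_eq_left.2 fun x _ => mem_iUnion.2 ⟨x n, le_refl (x n)⟩
    have := A.2
    rw [← hU, hmono.measure_iUnion] at this
    exact lt_iSup_iff.1 this
  choose m hm using step
  let F : ℕ → {A : Set (ℕ → ℕ) // c < ν (h '' A)} := fun n =>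
    Nat.rec ⟨univ, by rwa [image_univ]⟩ (fun n A => ⟨A ∩ {x | x n ≤ m n A}, hm n A⟩) n
  let b : ℕ → ℕ := fun n => m n (F n)
  have hF (n : ℕ) : (F n).1 ⊆ {x | ∀ i < n, x i ≤ b i} := by
    induction n with
    | zero => simp
    | succ n ih =>
      intro x hx i hi
      rcases Nat.lt_succ_iff_lt_or_eq.1 hi with hi | rfl
      · exact ih hx.1 i hi
      · exact hx.2
  refine ⟨b, ?_⟩
  rw [(h '' Iic b).measure_eq_iInf_isOpen]
  refine le_iInf₂ fun U hU => le_iInf fun hUo => ?_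
  obtain ⟨n, hn⟩ := exists_coordinates_le_subset_of_Iic_subset (hUo.preimage hh)
    (image_subset_iff.1 hU)
  exact (F n).2.le.trans (measure_mono (image_subset_iff.2 ((hF n).trans hn)))

/-- A continuous map from a Polish space whose range has full outer measure has a Borel section
almost everywhere. -/
theorem Continuous.exists_measurable_ae_section {X Y : Type*} [TopologicalSpace X]
    [PolishSpace X] [Nonempty X] [MeasurableSpace X] [BorelSpace X] [TopologicalSpace Y]
    [T2Space Y] [MeasurableSpace Y] [BorelSpace Y] {ν : Measure Y} [IsFiniteMeasure ν]
    [ν.OuterRegular] {f : X → Y} (hf : Continuous f) (hfull : ν (range f) = ν univ) :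
    ∃ s : Y → X, Measurable s ∧ ∀ᵐ y ∂ν, f (s y) = y := by
  rcases eq_zero_or_pos (ν univ) with h0 | hpos
  · obtain rfl := Measure.measure_univ_eq_zero.1 h0
    exact ⟨fun _ => Classical.arbitrary X, measurable_const, by simp⟩
  obtain ⟨p, hp, hps⟩ := PolishSpace.exists_nat_nat_continuous_surjective X
  have hfp : Continuous (f ∘ p) := hf.comp hp
  have hrange : ν (range (f ∘ p)) = ν univ := by rw [hps.range_comp, hfull]
  obtain ⟨c, -, hc, hlim⟩ := exists_seq_strictMono_tendsto' hpos
  choose b hb using fun n => hfp.exists_le_measure_image_Iic (ν := ν) (hrange ▸ (hc n).2)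
  have hK (n : ℕ) : IsCompact (Iic (b n)) := by
    rw [← Icc_bot]
    exact isCompact_Icc
  have hA (n : ℕ) : MeasurableSet (f ∘ p '' Iic (b n)) :=
    ((hK n).image hfp).isClosed.measurableSet
  have hsec (n : ℕ) : ∃ s : Y → X, Measurable s ∧ ∀ y ∈ f ∘ p '' Iic (b n), f (s y) = y := by
    have : CompactSpace (Iic (b n)) := isCompact_iff_compactSpace.1 (hK n)
    have : Nonempty (Iic (b n)) := ⟨⟨b n, self_mem_Iic⟩⟩
    obtain ⟨s, hs, hsy⟩ :=
      (hfp.comp (continuous_subtype_val (p := (· ∈ Iic (b n))))).exists_measurable_section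
    refine ⟨fun y => p (s y), (hp.comp continuous_subtype_val).measurable.comp hs, ?_⟩
    rintro _ ⟨k, hk, rfl⟩
    exact hsy _ ⟨⟨k, hk⟩, rfl⟩
  choose s hs hsy using hsec
  obtain ⟨u, hu, hus⟩ := exists_measurable_piecewise (disjointed fun n => f ∘ p '' Iic (b n))
    (fun n => MeasurableSet.disjointed hA n) s hs fun i j hij y hy =>
      (Set.disjoint_left.1 (disjoint_disjointed _ hij) hy.1 hy.2).elim
  refine ⟨u, hu, ?_⟩
  have hcover : ∀ᵐ y ∂ν, y ∈ ⋃ n, f ∘ p '' Iic (b n) := by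
    rw [ae_mem_iff_measure_eq (MeasurableSet.iUnion hA).nullMeasurableSet]
    exact (measure_mono (subset_univ _)).antisymm <| le_of_tendsto' hlim fun n =>
      (hb n).trans (measure_mono (subset_iUnion (fun n => f ∘ p '' Iic (b n)) n))
  filter_upwards [hcover] with y hy
  rw [← iUnion_disjointed] at hy
  obtain ⟨n, hn⟩ := mem_iUnion.1 hy
  rw [hus n hn]
  exact hsy n y (disjointed_subset _ n hn)

/-- An almost everywhere measurable map taking almost all values in the range of a continuous map
on a Polish space lifts almost everywhere to a measurable map. -/
theorem Continuous.exists_measurable_ae_lift {X Y T : Type*} [TopologicalSpace X]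
    [PolishSpace X] [Nonempty X] [MeasurableSpace X] [BorelSpace X] [TopologicalSpace Y]
    [MetrizableSpace Y] [MeasurableSpace Y] [BorelSpace Y] [MeasurableSpace T] {μ : Measure T}
    [IsFiniteMeasure μ] {f : X → Y} (hf : Continuous f) {v : T → Y} (hv : AEMeasurable v μ)
    (hvf : ∀ᵐ t ∂μ, v t ∈ range f) :
    ∃ u : T → X, AEMeasurable u μ ∧ ∀ᵐ t ∂μ, f (u t) = v t := by
  let _ : MetricSpace Y := metrizableSpaceMetric Y
  have hfull : μ.map v (range f) = μ.map v univ := by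
    refine (measure_mono (subset_univ _)).antisymm ?_
    rw [← measure_toMeasurable (range f), Measure.map_apply_of_aemeasurable hv .univ,
      Measure.map_apply_of_aemeasurable hv (measurableSet_toMeasurable _ _)]
    refine measure_mono_ae ?_
    filter_upwards [hvf] with t ht _
    exact subset_toMeasurable _ _ ht
  obtain ⟨s, hs, hsv⟩ := hf.exists_measurable_ae_section hfull
  exact ⟨s ∘ v, hs.comp_aemeasurable hv, ae_of_ae_map hv hsv⟩

/-- **Measurable selection of preimages.**
If `X` is a nonempty Polish space, `Y` a separable metrizable space and `f : X → Y`
continuous, then every Borel `v : [0,1] → Y` with range in `f(X)` lifts to a Lebesgue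
measurable `u : [0,1] → X` with `f ∘ u = v` everywhere; consequently every Lebesgue
measurable `v` with `v(t) ∈ f(X)` a.e. lifts a.e. -/
theorem measurable_selection_through_map
    {X Y : Type*} [TopologicalSpace X] [PolishSpace X] [Nonempty X]
    [MeasurableSpace X] [BorelSpace X]
    [TopologicalSpace Y] [TopologicalSpace.MetrizableSpace Y]
    [SecondCountableTopology Y] [MeasurableSpace Y] [BorelSpace Y]
    (f : X → Y) (hf : Continuous f) :
    (∀ v : I01 → Y, Measurable v → (∀ t : I01, v t ∈ Set.range f) →
      ∃ u : I01 → X, NullMeasurable u (volume : Measure I01) ∧ ∀ t : I01, f (u t) = v t) ∧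
    (∀ v : I01 → Y, NullMeasurable v (volume : Measure I01) →
      (∀ᵐ t ∂(volume : Measure I01), v t ∈ Set.range f) →
      ∃ u : I01 → X, NullMeasurable u (volume : Measure I01) ∧
        ∀ᵐ t ∂(volume : Measure I01), f (u t) = v t) := by
  have lift (v : I01 → Y) (hv : NullMeasurable v (volume : Measure I01))
      (hvf : ∀ᵐ t ∂(volume : Measure I01), v t ∈ range f) :
      ∃ u : I01 → X, NullMeasurable u (volume : Measure I01) ∧
        ∀ᵐ t ∂(volume : Measure I01), f (u t) = v t := by
    obtain ⟨u, hu, huv⟩ := hf.exists_measurable_ae_lift hv.aemeasurable hvf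
    exact ⟨u, hu.nullMeasurable, huv⟩
  refine ⟨fun v hv hvf => ?_, lift⟩
  classical
  obtain ⟨u, hu, huv⟩ := lift v hv.nullMeasurable (ae_of_all _ hvf)
  choose w hw using hvf
  refine ⟨fun t => if f (u t) = v t then u t else w t, hu.congr ?_, fun t => ?_⟩
  · filter_upwards [huv] with t ht
    exact (if_pos ht).symm
  · dsimp only
    split_ifs with h
    exacts [h, hw t]
end

section
/- Let C be an infinite compact metrizable space. Then the space of Borel probability measures on C, equipped with the topology of weak convergence (the coarsest topology making μ ↦ ∫_C f dμ continuous for every continuous f : C → ℝ), is homeomorphic to the Hilbert cube ℕ → [0,1] with the product topology. -/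
open MeasureTheory Topology
open Set Filter Bornology Pointwise

/-- Over the projection of its interior, a convex compactum in `E × ℝ` is the region between the
graphs of two continuous functions. -/
theorem Convex.exists_fiber_bounds {E : Type*} [NormedAddCommGroup E] [NormedSpace ℝ E]
    [FiniteDimensional ℝ E] {L : Set (E × ℝ)} (hL : IsCompact L) (hc : Convex ℝ L) :
    ∃ a b : E → ℝ, ContinuousOn a (Prod.fst '' interior L) ∧
      ContinuousOn b (Prod.fst '' interior L) ∧ (∀ e ∈ Prod.fst '' interior L, a e < b e) ∧
      ∀ e ∈ Prod.fst '' interior L, ∀ y, (e, y) ∈ L ↔ a e ≤ y ∧ y ≤ b e := by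
  have hU : IsOpen (Prod.fst '' interior L) := isOpenMap_fst _ isOpen_interior
  have hUc : Convex ℝ (Prod.fst '' interior L) :=
    hc.interior.linear_image (LinearMap.fst ℝ E ℝ)
  have hS : ∀ e, IsCompact {y | (e, y) ∈ L} := fun e ↦ by
    have : {y | (e, y) ∈ L} = Prod.snd '' (L ∩ Prod.fst ⁻¹' {e}) := by
      ext y
      constructor
      · intro h
        exact ⟨(e, y), ⟨h, rfl⟩, rfl⟩
      · rintro ⟨⟨e', y'⟩, ⟨h, rfl⟩, rfl⟩
        exact h
    rw [this]
    exact (hL.inter_right (isClosed_singleton.preimage continuous_fst)).image continuous_snd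
  have hne : ∀ e ∈ Prod.fst '' interior L, {y | (e, y) ∈ L}.Nonempty := by
    rintro _ ⟨⟨e, y⟩, h, rfl⟩
    exact ⟨y, (interior_subset h : (e, y) ∈ L)⟩
  have hinf : ∀ e ∈ Prod.fst '' interior L, (e, sInf {y | (e, y) ∈ L}) ∈ L := fun e he ↦
    (hS e).sInf_mem (hne e he)
  have hsup : ∀ e ∈ Prod.fst '' interior L, (e, sSup {y | (e, y) ∈ L}) ∈ L := fun e he ↦
    (hS e).sSup_mem (hne e he)
  refine ⟨fun e ↦ sInf {y | (e, y) ∈ L}, fun e ↦ sSup {y | (e, y) ∈ L}, ?_, ?_, ?_, ?_⟩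
  · refine ConvexOn.continuousOn hU ⟨hUc, fun x hx y hy s t hs ht hst ↦ ?_⟩
    exact csInf_le (hS _).bddBelow (hc (hinf x hx) (hinf y hy) hs ht hst)
  · refine ConcaveOn.continuousOn hU ⟨hUc, fun x hx y hy s t hs ht hst ↦ ?_⟩
    exact le_csSup (hS _).bddAbove (hc (hsup x hx) (hsup y hy) hs ht hst)
  · rintro _ ⟨⟨e, y⟩, h, rfl⟩
    have hn : {z | (e, z) ∈ L} ∈ 𝓝 y :=
      (Continuous.prodMk_right e).continuousAt.preimage_mem_nhds (mem_interior_iff_mem_nhds.1 h)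
    obtain ⟨r, hr, hb⟩ := Metric.nhds_basis_closedBall.mem_iff.1 hn
    have h1 : y - r ∈ {z | (e, z) ∈ L} := hb (by simp [abs_of_pos hr])
    have h2 : y + r ∈ {z | (e, z) ∈ L} := hb (by simp [abs_of_pos hr])
    have h3 := csInf_le (hS e).bddBelow h1
    have h4 := le_csSup (hS e).bddAbove h2
    change sInf _ < sSup _
    linarith
  · intro e he y
    refine ⟨fun h ↦ ⟨csInf_le (hS e).bddBelow h, le_csSup (hS e).bddAbove h⟩, fun h ↦ ?_⟩
    have hconv : Convex ℝ {y | (e, y) ∈ L} := by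
      intro y hy z hz s t hs ht hst
      have := hc hy hz hs ht hst
      rwa [Prod.smul_mk, Prod.smul_mk, Prod.mk_add_mk, ← add_smul, hst, one_smul] at this
    exact hconv.ordConnected.out (hinf e he) (hsup e he) h

/-- A convex body `D` with `(1 - δ) • L ⊆ D ⊆ L` is carried onto `L` by a radial map that moves
points by at most `δ * R`, where `R` bounds the norm on `L`. -/
theorem Convex.exists_radial_map {V : Type*} [NormedAddCommGroup V] [NormedSpace ℝ V]
    {D L : Set V} (hD : IsCompact D) (hDc : Convex ℝ D) (hD0 : D ∈ 𝓝 0)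
    (hL : IsCompact L) (hLc : Convex ℝ L) (hDL : D ⊆ L) {δ R : ℝ} (hδ0 : 0 ≤ δ)
    (hδ : δ < 1)
    (hLD : (1 - δ) • L ⊆ D) (hR : ∀ v ∈ L, ‖v‖ ≤ R) :
    ∃ f : V → V, Continuous f ∧ Function.Injective f ∧ f '' D = L ∧
      ∀ v ∈ D, ‖f v - v‖ ≤ δ * R := by
  have hL0 : L ∈ 𝓝 0 := mem_of_superset hD0 hDL
  have hDb := hD.isVonNBounded ℝ
  have hLb := hL.isVonNBounded ℝ
  have him := image_gaugeRescaleHomeomorph_closure hDc hD0 hDb hLc hL0 hLb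
  rw [hD.isClosed.closure_eq, hL.isClosed.closure_eq] at him
  refine ⟨gaugeRescaleHomeomorph D L hDc hD0 hDb hLc hL0 hLb, Homeomorph.continuous _,
    Homeomorph.injective _, him, fun v hv ↦ ?_⟩
  have hfv : gaugeRescale D L v ∈ L := him.subset (mem_image_of_mem _ hv)
  change ‖gaugeRescale D L v - v‖ ≤ _
  rcases eq_or_ne v 0 with rfl | hv0
  · have := (norm_nonneg _).trans (hR _ hfv)
    simp only [gaugeRescale_zero, sub_zero, norm_zero]
    exact mul_nonneg hδ0 this
  have hpL : 0 < gauge L v := (gauge_pos (absorbent_nhds_zero hL0) hLb).2 hv0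
  have hpD : 0 < gauge D v := (gauge_pos (absorbent_nhds_zero hD0) hDb).2 hv0
  have h1 : gauge D v ≤ (1 - δ)⁻¹ * gauge L v := by
    have hL0' : (1 - δ) • L ∈ 𝓝 (0 : V) := by
      simpa using smul_mem_nhds_smul₀ (sub_pos.2 hδ).ne' hL0
    have := gauge_mono (absorbent_nhds_zero hL0') hLD v
    rwa [gauge_smul_left_of_nonneg (sub_pos.2 hδ).le, Pi.smul_apply, smul_eq_mul] at this
  have h2 : gauge L v ≤ gauge D v := gauge_mono (absorbent_nhds_zero hD0) hDL v
  have h3 : v = (gauge L v / gauge D v) • gaugeRescale D L v := by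
    rw [gaugeRescale, smul_smul]; field_simp; simp
  have h4 : gaugeRescale D L v - v = (1 - gauge L v / gauge D v) • gaugeRescale D L v := by
    rw [sub_smul, one_smul, ← h3]
  have h5 : 1 - δ ≤ gauge L v / gauge D v := by
    rw [le_div_iff₀ hpD]
    rwa [le_inv_mul_iff₀ (sub_pos.2 hδ)] at h1
  have h6 : gauge L v / gauge D v ≤ 1 := (div_le_one hpD).2 h2
  rw [h4, norm_smul, Real.norm_of_nonneg (by linarith)]
  exact mul_le_mul (by linarith) (hR _ hfv) (norm_nonneg _) (by linarith)

theorem Convex.exists_lift_of_zero_mem_interior {X E : Type*} [TopologicalSpace X]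
    [NormedAddCommGroup E] [NormedSpace ℝ E] [FiniteDimensional ℝ E] {L : Set (E × ℝ)}
    (hL : IsCompact L) (hc : Convex ℝ L) (h0 : 0 ∈ interior L) {g : X → E} (hg : Continuous g)
    (hgL : range g = Prod.fst '' L) {ε : ℝ} (hε : 0 < ε) :
    ∃ G : X × unitInterval → E × ℝ, Continuous G ∧ range G = L ∧
      (∀ p q, G p = G q ↔ g p.1 = g q.1 ∧ p.2 = q.2) ∧ ∀ p, ‖(G p).1 - g p.1‖ < ε := by
  obtain ⟨R, hR0, hR⟩ := hL.isBounded.exists_pos_norm_le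
  obtain ⟨a, b, ha, hb, hab, hfib⟩ := hc.exists_fiber_bounds hL
  obtain ⟨δ, hδ0, hδ1, hδε⟩ : ∃ δ : ℝ, 0 < δ ∧ δ < 1 ∧ 2 * δ * R < ε := by
    refine ⟨min (1 / 2) (ε / (4 * R)), by positivity, by
      have := min_le_left (1 / 2) (ε / (4 * R)); linarith, ?_⟩
    have := min_le_right (1 / 2) (ε / (4 * R))
    rw [le_div_iff₀ (by positivity)] at this
    linarith
  have hδ' : 0 < 1 - δ := by linarith
  have hLint : ∀ v ∈ L, (1 - δ) • v ∈ interior L := fun v hv ↦ by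
    simpa using hc.combo_interior_self_mem_interior h0 hv hδ0 hδ'.le (by ring)
  have hgU : ∀ x, (1 - δ) • g x ∈ Prod.fst '' interior L := fun x ↦ by
    obtain ⟨v, hv, hvx⟩ : g x ∈ Prod.fst '' L := hgL ▸ mem_range_self x
    exact ⟨_, hLint v hv, by rw [← hvx, Prod.smul_fst]⟩
  set D : Set (E × ℝ) := L ∩ Prod.fst ⁻¹' ((1 - δ) • Prod.fst '' L)
  have hLD : (1 - δ) • L ⊆ D := by
    rintro _ ⟨v, hv, rfl⟩
    exact ⟨interior_subset (hLint v hv), smul_mem_smul_set (mem_image_of_mem _ hv)⟩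
  have hMc : IsCompact ((1 - δ) • Prod.fst '' L) := (hL.image continuous_fst).smul _
  have hD : IsCompact D := hL.inter_right (hMc.isClosed.preimage continuous_fst)
  have hDc : Convex ℝ D :=
    hc.inter (((hc.linear_image (LinearMap.fst ℝ E ℝ)).smul _).linear_preimage
      (LinearMap.fst ℝ E ℝ))
  have hD0 : D ∈ 𝓝 0 := by
    refine mem_of_superset ?_ hLD
    simpa using smul_mem_nhds_smul₀ hδ'.ne' (mem_interior_iff_mem_nhds.1 h0)
  obtain ⟨f, hf, hfi, hfD, hfδ⟩ := hDc.exists_radial_map hD hD0 hL hc inter_subset_left hδ0.le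
    hδ1 hLD hR
  let H : X × unitInterval → E × ℝ := fun p ↦ ((1 - δ) • g p.1,
    a ((1 - δ) • g p.1) + p.2 * (b ((1 - δ) • g p.1) - a ((1 - δ) • g p.1)))
  have hg1 : Continuous fun p : X × unitInterval ↦ (1 - δ) • g p.1 := by fun_prop
  have ha' : Continuous fun p : X × unitInterval ↦ a ((1 - δ) • g p.1) :=
    ha.comp_continuous hg1 fun p ↦ hgU p.1
  have hb' : Continuous fun p : X × unitInterval ↦ b ((1 - δ) • g p.1) :=
    hb.comp_continuous hg1 fun p ↦ hgU p.1
  have hH : Continuous H := hg1.prodMk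
    (ha'.add ((continuous_subtype_val.comp continuous_snd).mul (hb'.sub ha')))
  have hHD : ∀ p, H p ∈ D := by
    rintro ⟨x, t⟩
    have h1 := hab _ (hgU x)
    refine ⟨(hfib _ (hgU x) _).2 ⟨?_, ?_⟩, smul_mem_smul_set (hgL ▸ mem_range_self x)⟩
    · nlinarith [t.2.1]
    · nlinarith [t.2.2]
  have hHr : range H = D := by
    refine (range_subset_iff.2 hHD).antisymm ?_
    rintro ⟨e, y⟩ ⟨hL', m, hm, hme⟩
    obtain ⟨x, rfl⟩ : m ∈ range g := hgL ▸ hm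
    obtain rfl : (1 - δ) • g x = e := hme
    obtain ⟨h1, h2⟩ := (hfib _ (hgU x) _).1 hL'
    have h3 := sub_pos.2 (hab _ (hgU x))
    refine ⟨(x, ⟨(y - a ((1 - δ) • g x)) / (b ((1 - δ) • g x) - a ((1 - δ) • g x)),
      div_nonneg (by linarith) h3.le, (div_le_one h3).2 (by linarith)⟩), ?_⟩
    refine Prod.ext rfl ?_
    change a _ + _ / _ * _ = y
    rw [div_mul_cancel₀ _ h3.ne']
    ring
  refine ⟨f ∘ H, hf.comp hH, by rw [range_comp, hHr, hfD], ?_, fun p ↦ ?_⟩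
  · rintro ⟨x, t⟩ ⟨y, s⟩
    refine hfi.eq_iff.trans ⟨fun h ↦ ?_, ?_⟩
    · have h1 : g x = g y := smul_right_injective E hδ'.ne' (congrArg Prod.fst h)
      have h2 := congrArg Prod.snd h
      have h3 := sub_pos.2 (hab _ (hgU y))
      simp only [H, h1] at h2
      exact ⟨h1, Subtype.ext (mul_right_cancel₀ h3.ne' (add_left_cancel h2))⟩
    · rintro ⟨h1, h2⟩
      dsimp only at h1 h2
      simp only [H, h1, h2]
  · have h1 : ‖(f (H p)).1 - (1 - δ) • g p.1‖ ≤ δ * R :=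
      (norm_fst_le (f (H p) - H p)).trans (hfδ _ (hHD p))
    have h2 : ‖g p.1‖ ≤ R := by
      obtain ⟨v, hv, hvx⟩ : g p.1 ∈ Prod.fst '' L := hgL ▸ mem_range_self p.1
      exact hvx ▸ (norm_fst_le v).trans (hR v hv)
    have h3 : ‖(1 - δ) • g p.1 - g p.1‖ ≤ δ * R := by
      rw [sub_smul, one_smul, sub_sub_cancel_left, norm_neg, norm_smul, Real.norm_of_nonneg hδ0.le]
      gcongr
    have h4 := norm_sub_le_norm_sub_add_norm_sub (f (H p)).1 ((1 - δ) • g p.1) (g p.1)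
    change ‖(f (H p)).1 - g p.1‖ < ε
    linarith

/-- A parametrization of the projection of a convex body `L ⊆ E × ℝ` lifts, up to an arbitrarily
small error, to a parametrization of `L` with one more parameter in the unit interval. -/
theorem Convex.exists_lift {X E : Type*} [TopologicalSpace X]
    [NormedAddCommGroup E] [NormedSpace ℝ E] [FiniteDimensional ℝ E] {L : Set (E × ℝ)}
    (hL : IsCompact L) (hc : Convex ℝ L) (h0 : (interior L).Nonempty) {g : X → E}
    (hg : Continuous g) (hgL : range g = Prod.fst '' L) {ε : ℝ} (hε : 0 < ε) :
    ∃ G : X × unitInterval → E × ℝ, Continuous G ∧ range G = L ∧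
      (∀ p q, G p = G q ↔ g p.1 = g q.1 ∧ p.2 = q.2) ∧ ∀ p, ‖(G p).1 - g p.1‖ < ε := by
  obtain ⟨c, hc0⟩ := h0
  obtain ⟨G, hG, hGL, hGi, hGε⟩ := Convex.exists_lift_of_zero_mem_interior
    (hL.image (continuous_const_add (-c))) (hc.translate (-c))
    (by
      change 0 ∈ interior (Homeomorph.addLeft (-c) '' L)
      rw [← Homeomorph.image_interior]
      exact ⟨c, hc0, by simp⟩) (g := fun x ↦ -c.1 + g x) (by fun_prop) (by
      rw [image_image]
      change range ((fun y ↦ -c.1 + y) ∘ g) = (fun v ↦ -c.1 + v.1) '' L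
      rw [range_comp, hgL, image_image]) hε
  refine ⟨fun p ↦ c + G p, by fun_prop, ?_, fun p q ↦ ?_, fun p ↦ ?_⟩
  · change range ((fun v ↦ c + v) ∘ G) = L
    rw [range_comp, hGL, image_image]
    simp
  · simpa using hGi p q
  · have := hGε p
    rwa [neg_add_eq_sub, ← sub_add, sub_add_eq_add_sub, add_comm (G p).1] at this

/-- A rapidly converging sequence of maps that separate more and more points, and whose images
agree with `K` in more and more coordinates, converges to an embedding with image `K`. -/
theorem exists_injective_range_eq_of_approx {X : Type*} [TopologicalSpace X] [CompactSpace X]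
    {K : Set (ℕ → ℝ)} (hK : IsClosed K) (φ : ℕ → X → ℕ → ℝ) (η : ℕ → ℝ)
    (hφ : ∀ n, Continuous (φ n)) (hη : ∀ n, 0 < η n) (hη' : ∀ n, η (n + 1) ≤ η n / 2)
    (hstep : ∀ n x, ∀ i < n, |φ (n + 1) x i - φ n x i| ≤ η n / 2)
    (hsep : ∀ x y, x ≠ y → ∃ n, ∃ i < n, 4 * η n ≤ |φ n x i - φ n y i|)
    (hφK : ∀ n x, ∃ k ∈ K, ∀ i < n, φ n x i = k i)
    (hKφ : ∀ n, ∀ k ∈ K, ∃ x, ∀ i < n, φ n x i = k i) :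
    ∃ F : X → ℕ → ℝ, Continuous F ∧ Function.Injective F ∧ range F = K := by
  have hη0 : Tendsto η atTop (𝓝 0) := by
    have hle : ∀ n, η n ≤ η 0 * (1 / 2) ^ n := fun n ↦ by
      induction n with
      | zero => simp
      | succ n ih => rw [pow_succ]; linarith [hη' n]
    refine squeeze_zero (fun n ↦ (hη n).le) hle ?_
    simpa using (tendsto_pow_atTop_nhds_zero_of_lt_one (r := (1 / 2 : ℝ)) (by norm_num)
      (by norm_num)).const_mul (η 0)
  have hclose : ∀ n m, n ≤ m → ∀ x, ∀ i < n, |φ m x i - φ n x i| ≤ η n - η m := by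
    intro n m hnm x i hi
    induction m, hnm using Nat.le_induction with
    | base => simp
    | succ m hm ih =>
      have h1 := hstep m x i (by lia)
      have h2 := abs_sub_le (φ (m + 1) x i) (φ m x i) (φ n x i)
      linarith [hη' m]
  have hlim : ∀ x i, ∃ l, Tendsto (fun n ↦ φ n x i) atTop (𝓝 l) := by
    intro x i
    refine cauchySeq_tendsto_of_complete (Metric.cauchySeq_iff'.2 fun ε hε ↦ ?_)
    obtain ⟨N, hN, hiN⟩ := ((hη0.eventually_lt_const hε).and (eventually_gt_atTop i)).exists
    refine ⟨N, fun m hm ↦ ?_⟩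
    rw [Real.dist_eq]
    linarith [hclose N m hm x i hiN, hη m]
  choose F hF using hlim
  have hFφ : ∀ n x, ∀ i < n, |F x i - φ n x i| ≤ η n := by
    intro n x i hi
    refine le_of_tendsto ((hF x i).sub_const _).abs ?_
    filter_upwards [eventually_ge_atTop n] with m hm
    linarith [hclose n m hm x i hi, hη m]
  have hFc : Continuous F := by
    refine continuous_pi fun i ↦ continuous_of_uniform_approx_of_continuous fun u hu ↦ ?_
    obtain ⟨ε, hε, hu⟩ := Metric.mem_uniformity_dist.1 hu
    obtain ⟨N, hN, hiN⟩ := ((hη0.eventually_lt_const hε).and (eventually_gt_atTop i)).exists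
    refine ⟨fun x ↦ φ N x i, (continuous_apply i).comp (hφ N), fun x ↦ hu ?_⟩
    rw [Real.dist_eq]
    linarith [hFφ N x i hiN]
  have hlim' : ∀ (k p : ℕ → ℕ → ℝ) (q : ℕ → ℝ), (∀ n, ∀ i < n, |k n i - p n i| ≤ η n) →
      (∀ n, ∀ i < n, p n i = q i) → Tendsto k atTop (𝓝 q) := by
    intro k p q h1 h2
    refine tendsto_pi_nhds.2 fun i ↦ tendsto_iff_dist_tendsto_zero.2 ?_
    refine squeeze_zero' (Eventually.of_forall fun _ ↦ dist_nonneg) ?_ hη0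
    filter_upwards [eventually_gt_atTop i] with n hn
    rw [Real.dist_eq, ← h2 n i hn]
    exact h1 n i hn
  refine ⟨F, hFc, fun x y hxy ↦ ?_, Subset.antisymm ?_ ?_⟩
  · by_contra hne
    obtain ⟨n, i, hi, h⟩ := hsep x y hne
    have h1 := hFφ n x i hi
    have h2 := hFφ n y i hi
    rw [hxy, abs_sub_comm] at h1
    have h3 := abs_sub_le (φ n x i) (F y i) (φ n y i)
    linarith [hη n]
  · rintro _ ⟨x, rfl⟩
    choose k hk hkφ using fun n ↦ hφK n x
    refine hK.mem_of_tendsto (hlim' k (fun _ ↦ F x) (F x) (fun n i hi ↦ ?_) fun _ _ _ ↦ rfl)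
      (Eventually.of_forall hk)
    rw [← hkφ n i hi, abs_sub_comm]
    exact hFφ n x i hi
  · intro k hk
    choose x hx using fun n ↦ hKφ n k hk
    exact (isCompact_range hFc).isClosed.mem_of_tendsto
      (hlim' (fun n ↦ F (x n)) (fun n ↦ φ n (x n)) k (fun n i hi ↦ hFφ n _ i hi) hx)
      (Eventually.of_forall fun n ↦ mem_range_self _)

/-- The linear map recording the first `n + 1` coordinates of a real sequence, the last of them
separately. -/
def truncLast (n : ℕ) : (ℕ → ℝ) →ₗ[ℝ] (Fin n → ℝ) × ℝ :=
  (LinearMap.funLeft ℝ ℝ ((↑) : Fin n → ℕ)).prod (LinearMap.proj n)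

theorem continuous_truncLast (n : ℕ) : Continuous (truncLast n) :=
  (continuous_pi (f := fun (k : ℕ → ℝ) (i : Fin n) ↦ k i) fun i ↦
    continuous_apply (i : ℕ)).prodMk (continuous_apply n)

theorem truncLast_eq_iff {n : ℕ} {k l : ℕ → ℝ} :
    truncLast n k = truncLast n l ↔ ∀ i < n + 1, k i = l i := by
  rw [Nat.forall_lt_succ_right, Prod.ext_iff, funext_iff, Fin.forall_iff]
  rfl

theorem truncLast_surjective (n : ℕ) : Function.Surjective (truncLast n) := fun p ↦
  ⟨fun i ↦ if h : i < n then p.1 ⟨i, h⟩ else p.2,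
    Prod.ext (funext fun i ↦ dif_pos i.2) (dif_neg (lt_irrefl n))⟩

/-- `f` parametrizes the projection of `K` to the first `n` coordinates by the first `n`
coordinates of the Hilbert cube. -/
structure IsCubeChart (K : Set (ℕ → ℝ)) (n : ℕ) (f : (ℕ → unitInterval) → ℕ → ℝ) : Prop where
  continuous : Continuous f
  exists_mem : ∀ x, ∃ k ∈ K, ∀ i < n, f x i = k i
  exists_eq : ∀ k ∈ K, ∃ x, ∀ i < n, f x i = k i
  eq_iff : ∀ x y, (∀ i < n, f x i = f y i) ↔ ∀ i < n, x i = y i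

theorem IsCubeChart.exists_separation {K : Set (ℕ → ℝ)} {n : ℕ}
    {f : (ℕ → unitInterval) → ℕ → ℝ} (hf : IsCubeChart K n f) {δ r : ℝ} (hδ : 0 < δ)
    (hr : 0 < r) :
    ∃ η, 0 < η ∧ η ≤ r ∧ ∀ x y, (∃ i < n, δ ≤ dist (x i) (y i)) →
      ∃ i < n, 4 * η ≤ |f x i - f y i| := by
  let g : (ℕ → unitInterval) → Fin n → ℝ := fun x i ↦ f x i
  have hg : Continuous g :=
    continuous_pi fun i ↦ (continuous_apply (i : ℕ)).comp hf.continuous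
  let A : Set ((ℕ → unitInterval) × (ℕ → unitInterval)) :=
    ⋃ i : Fin n, {p | δ ≤ dist (p.1 i) (p.2 i)}
  have hA : IsCompact A := by
    refine (isClosed_iUnion_of_finite fun i ↦ ?_).isCompact
    exact isClosed_le continuous_const (by fun_prop)
  obtain ⟨a, ha, hA'⟩ := hA.exists_forall_le' (f := fun p ↦ dist (g p.1) (g p.2)) (a := 0)
    (by fun_prop) (by
      rintro ⟨x, y⟩ hxy
      obtain ⟨i, hi⟩ := mem_iUnion.1 hxy
      refine dist_pos.2 fun h ↦ ?_
      have := (hf.eq_iff x y).1 (fun j hj ↦ congrFun h ⟨j, hj⟩) i i.2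
      simp only [mem_ofPred_eq, this, dist_self] at hi
      exact hδ.not_ge hi)
  refine ⟨min r (a / 4), by positivity, min_le_left _ _, ?_⟩
  rintro x y ⟨i, hi, hxy⟩
  have h1 := hA' (x, y) (mem_iUnion.2 ⟨⟨i, hi⟩, hxy⟩)
  by_contra! h
  refine h1.not_gt ((dist_pi_lt_iff ha).2 fun j ↦ ?_)
  have h2 := h j j.2
  have h3 := min_le_right r (a / 4)
  rw [Real.dist_eq]
  change |f x j - f y j| < a
  linarith

theorem IsCubeChart.exists_succ {K : Set (ℕ → ℝ)} (hK : IsCompact K) (hc : Convex ℝ K) {n : ℕ}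
    (hi : (interior (truncLast n '' K)).Nonempty) {f : (ℕ → unitInterval) → ℕ → ℝ}
    (hf : IsCubeChart K n f) {ε : ℝ} (hε : 0 < ε) :
    ∃ f', IsCubeChart K (n + 1) f' ∧ ∀ x, ∀ i < n, |f' x i - f x i| ≤ ε := by
  let g : (ℕ → unitInterval) → Fin n → ℝ := fun x i ↦ f x i
  have hg : Continuous g :=
    continuous_pi fun i ↦ (continuous_apply (i : ℕ)).comp hf.continuous
  have hgr : range g = Prod.fst '' (truncLast n '' K) := by
    ext v
    constructor
    · rintro ⟨x, rfl⟩
      obtain ⟨k, hk, hxk⟩ := hf.exists_mem x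
      exact ⟨_, mem_image_of_mem _ hk, funext fun i ↦ (hxk i i.2).symm⟩
    · rintro ⟨_, ⟨k, hk, rfl⟩, rfl⟩
      obtain ⟨x, hx⟩ := hf.exists_eq k hk
      exact ⟨x, funext fun i ↦ hx i i.2⟩
  have hgi : ∀ x y, g x = g y ↔ ∀ i < n, x i = y i := fun x y ↦ by
    rw [← hf.eq_iff]
    exact ⟨fun h i hi ↦ congrFun h ⟨i, hi⟩, fun h ↦ funext fun i ↦ h i i.2⟩
  obtain ⟨G, hG, hGr, hGi, hGε⟩ := (hc.linear_image (truncLast n)).exists_lift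
    (hK.image (continuous_truncLast n)) hi hg hgr hε
  let f' : (ℕ → unitInterval) → ℕ → ℝ := fun x i ↦
    if h : i < n then (G (x, x n)).1 ⟨i, h⟩ else (G (x, x n)).2
  have hlt : ∀ x i (h : i < n), f' x i = (G (x, x n)).1 ⟨i, h⟩ := fun x i h ↦ dif_pos h
  have hlast : ∀ x, f' x n = (G (x, x n)).2 := fun x ↦ dif_neg (lt_irrefl n)
  have hGc : Continuous fun x : ℕ → unitInterval ↦ G (x, x n) := by fun_prop
  have hfk : ∀ x k, (∀ i < n + 1, f' x i = k i) ↔ G (x, x n) = truncLast n k := by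
    intro x k
    rw [Nat.forall_lt_succ_right, hlast]
    refine ⟨fun h ↦ Prod.ext (funext fun i ↦ ?_) h.2, fun h ↦ ⟨fun i hi ↦ ?_, ?_⟩⟩
    · rw [← hlt]
      exact h.1 i i.2
    · rw [hlt _ _ hi, h]
      rfl
    · rw [h]
      rfl
  have hff : ∀ x y, (∀ i < n + 1, f' x i = f' y i) ↔ G (x, x n) = G (y, y n) := by
    intro x y
    rw [hfk, ← (hfk y (f' y)).1 fun _ _ ↦ rfl]
  refine ⟨f', ⟨?_, fun x ↦ ?_, fun k hk ↦ ?_, fun x y ↦ ?_⟩, fun x i hi ↦ ?_⟩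
  · refine continuous_pi fun i ↦ ?_
    by_cases h : i < n
    · simp only [hlt _ _ h]
      fun_prop
    · simp only [f', dif_neg h]
      fun_prop
  · obtain ⟨k, hk, h⟩ : G (x, x n) ∈ truncLast n '' K := hGr ▸ mem_range_self _
    exact ⟨k, hk, (hfk x k).2 h.symm⟩
  · obtain ⟨⟨x, t⟩, h⟩ : truncLast n k ∈ range G := hGr ▸ mem_image_of_mem _ hk
    refine ⟨Function.update x n t, (hfk _ _).2 (h ▸ (hGi _ _).2 ⟨(hgi _ _).2 fun i hi ↦ ?_, ?_⟩)⟩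
    · exact Function.update_of_ne hi.ne _ _
    · exact Function.update_self _ _ _
  · rw [hff, hGi, hgi, Nat.forall_lt_succ_right]
  · rw [hlt _ _ hi]
    exact ((norm_le_pi_norm ((G (x, x n)).1 - g x) ⟨i, hi⟩).trans_lt (hGε _)).le

/-- **Keller's theorem** for convex compacta in the space of real sequences. -/
theorem Convex.nonempty_homeomorph_hilbertCube {K : Set (ℕ → ℝ)} (hc : Convex ℝ K)
    (hK : IsCompact K) (hi : ∀ n, (interior (truncLast n '' K)).Nonempty) :
    Nonempty (K ≃ₜ (ℕ → unitInterval)) := by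
  obtain ⟨k₀, hk₀⟩ : K.Nonempty := by
    obtain ⟨_, h⟩ := hi 0
    exact (interior_subset.trans_eq rfl h).imp fun _ h ↦ h.1
  let S : ℕ → Type := fun n ↦ {p : ((ℕ → unitInterval) → ℕ → ℝ) × ℝ //
    IsCubeChart K n p.1 ∧ 0 < p.2 ∧ ∀ x y, (∃ i < n, 1 / ((n : ℝ) + 1) ≤ dist (x i) (y i)) →
      ∃ i < n, 4 * p.2 ≤ |p.1 x i - p.1 y i|}
  let s₀ : S 0 := ⟨(fun _ _ ↦ 0, 1), ⟨continuous_const, fun _ ↦ ⟨k₀, hk₀, by simp⟩,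
    fun _ _ ↦ ⟨fun _ ↦ 0, by simp⟩, by simp⟩, one_pos, by simp⟩
  have hS : ∀ n (s : S n), ∃ s' : S (n + 1), s'.1.2 ≤ s.1.2 / 2 ∧
      ∀ x, ∀ i < n, |s'.1.1 x i - s.1.1 x i| ≤ s.1.2 / 2 := by
    rintro n ⟨⟨f, η⟩, hf, hη, -⟩
    obtain ⟨f', hf', hff'⟩ := hf.exists_succ hK hc (hi n) (half_pos hη)
    obtain ⟨η', h1, h2, h3⟩ := hf'.exists_separation (δ := 1 / (((n + 1 : ℕ) : ℝ) + 1))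
      (by positivity) (half_pos hη)
    exact ⟨⟨(f', η'), hf', h1, h3⟩, h2, hff'⟩
  choose step hstep using hS
  let s : ∀ n, S n := fun n ↦ Nat.rec s₀ (fun n t ↦ step n t) n
  have hs : ∀ n, (s (n + 1)).1.2 ≤ (s n).1.2 / 2 ∧
      ∀ x, ∀ i < n, |(s (n + 1)).1.1 x i - (s n).1.1 x i| ≤ (s n).1.2 / 2 :=
    fun n ↦ hstep n (s n)
  obtain ⟨F, hF, hFi, rfl⟩ := exists_injective_range_eq_of_approx hK.isClosed
    (fun n ↦ (s n).1.1) (fun n ↦ (s n).1.2) (fun n ↦ (s n).2.1.continuous)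
    (fun n ↦ (s n).2.2.1) (fun n ↦ (hs n).1) (fun n ↦ (hs n).2) (fun x y hxy ↦ by
      obtain ⟨i, hi⟩ := Function.ne_iff.1 hxy
      obtain ⟨n, hn, hin⟩ := ((tendsto_one_div_add_atTop_nhds_zero_nat.eventually_lt_const
        (dist_pos.2 hi)).and (eventually_gt_atTop i)).exists
      exact ⟨n, (s n).2.2.2 x y ⟨i, hin, hn.le⟩⟩)
    (fun n ↦ (s n).2.1.exists_mem) (fun n ↦ (s n).2.1.exists_eq)
  exact ⟨(hF.isClosedEmbedding hFi).isEmbedding.toHomeomorph.symm⟩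

theorem ContinuousMap.not_finite_of_infinite (C : Type*) [TopologicalSpace C] [CompactSpace C]
    [T2Space C] [Infinite C] : ¬ Module.Finite ℝ C(C, ℝ) := by
  intro _
  let ev : C → C(C, ℝ) →* ℝ := fun x ↦
    { toFun := fun f ↦ f x, map_one' := rfl, map_mul' := fun _ _ ↦ rfl }
  let ev' : C → Module.Dual ℝ C(C, ℝ) := fun x ↦
    { toFun := fun f ↦ f x, map_add' := fun _ _ ↦ rfl, map_smul' := fun _ _ ↦ rfl }
  have hev : Function.Injective ev := fun x y hxy ↦ by
    by_contra hne
    obtain ⟨f, hf0, hf1, -⟩ := exists_continuous_zero_one_of_isClosed (isClosed_singleton (x := x))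
      (isClosed_singleton (x := y)) (by simpa using hne)
    have h : f x = f y := DFunLike.congr_fun hxy f
    rw [hf0 rfl, hf1 rfl] at h
    simp at h
  have hli : LinearIndependent ℝ ev' :=
    LinearIndependent.of_comp (LinearMap.ltoFun ℝ C(C, ℝ) ℝ ℝ)
      ((linearIndependent_monoidHom C(C, ℝ) ℝ).comp ev hev)
  exact not_finite_iff_infinite.2 ‹Infinite C› hli.finite

theorem ContinuousMap.exists_linearIndependent_dense_span (C : Type*) [TopologicalSpace C]
    [CompactSpace C] [TopologicalSpace.MetrizableSpace C] [Infinite C] :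
    ∃ w : ℕ → C(C, ℝ), w 0 = 1 ∧ LinearIndependent ℝ w ∧
      Dense (Submodule.span ℝ (range w) : Set C(C, ℝ)) := by
  let _ := TopologicalSpace.metrizableSpaceMetric C
  let v := TopologicalSpace.denseSeq C(C, ℝ)
  have h1 : LinearIndepOn ℝ id {(1 : C(C, ℝ))} := LinearIndepOn.singleton (v := id) one_ne_zero
  obtain ⟨b, hbt, hb1, hspan, hb⟩ := exists_linearIndepOn_id_extension h1
    (subset_insert_iff.2 (by simp) : {(1 : C(C, ℝ))} ⊆ insert 1 (range v))
  have hd : Dense (Submodule.span ℝ b : Set C(C, ℝ)) :=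
    (TopologicalSpace.denseRange_denseSeq C(C, ℝ)).mono ((subset_insert _ _).trans hspan)
  have hbc : Countable b := ((countable_range v).insert 1).mono hbt
  have hbi : Infinite b := by
    refine not_finite_iff_infinite.1 fun hfin ↦ ?_
    refine ContinuousMap.not_finite_of_infinite C ?_
    have : FiniteDimensional ℝ (Submodule.span ℝ b) :=
      FiniteDimensional.span_of_finite ℝ (toFinite b)
    have htop : Submodule.span ℝ b = ⊤ := by
      rw [← SetLike.coe_set_eq, ← (Submodule.closed_of_finiteDimensional _).closure_eq,
        hd.closure_eq, Submodule.top_coe]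
    exact Module.Finite.of_fg_top (htop ▸ Submodule.fg_span (toFinite b))
  obtain ⟨e⟩ : Nonempty (ℕ ≃ b) := nonempty_equiv_of_countable
  let e' : ℕ ≃ b := (Equiv.swap 0 (e.symm ⟨1, hb1 rfl⟩)).trans e
  refine ⟨fun n ↦ e' n, by simp [e'], ?_, ?_⟩
  · exact LinearIndependent.comp hb e' e'.injective
  · have : range (fun n ↦ (e' n : C(C, ℝ))) = b := by
      rw [range_comp' Subtype.val e', e'.range_eq_univ, image_univ, Subtype.range_coe]
    rwa [this]

section integralSeq

variable {C : Type*} [TopologicalSpace C] [CompactSpace C] [MeasurableSpace C] [BorelSpace C]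

theorem ContinuousMap.integrable_of_compactSpace (f : C(C, ℝ)) (μ : Measure C)
    [IsFiniteMeasure μ] : Integrable f μ :=
  (BoundedContinuousFunction.mkOfCompact f).integrable μ

/-- The integrals of a probability measure against a sequence of continuous functions. -/
noncomputable def integralSeq (u : ℕ → C(C, ℝ)) (μ : ProbabilityMeasure C) : ℕ → ℝ :=
  fun i ↦ ∫ x, u i x ∂(μ : Measure C)

theorem continuous_integralSeq (u : ℕ → C(C, ℝ)) : Continuous (integralSeq u) :=
  continuous_pi fun i ↦ ProbabilityMeasure.continuous_integral_boundedContinuousFunction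
    (BoundedContinuousFunction.mkOfCompact (u i))

theorem injective_integralSeq [HasOuterApproxClosed C] {w : ℕ → C(C, ℝ)} (h1 : w 0 = 1)
    (hw : Dense (Submodule.span ℝ (range w) : Set C(C, ℝ))) :
    Function.Injective (integralSeq fun i ↦ w (i + 1)) := by
  intro μ ν h
  have hc : ∀ μ : ProbabilityMeasure C, Continuous fun f : C(C, ℝ) ↦ ∫ x, f x ∂(μ : Measure C) :=
    fun μ ↦ by
      refine (LipschitzWith.mk_one fun f g ↦ ?_).continuous
      rw [dist_eq_norm, dist_eq_norm, ← integral_sub (f.integrable_of_compactSpace _)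
        (g.integrable_of_compactSpace _)]
      simpa using norm_integral_le_of_norm_le_const (μ := (μ : Measure C))
        (Eventually.of_forall fun x ↦ (f - g).norm_coe_le_norm x)
  have hall : ∀ f : C(C, ℝ), ∫ x, f x ∂(μ : Measure C) = ∫ x, f x ∂(ν : Measure C) := by
    refine congrFun ((hc μ).ext_on hw (hc ν) fun f hf ↦ ?_)
    induction hf using Submodule.span_induction with
    | mem f hf =>
      obtain ⟨n, rfl⟩ := hf
      cases n with
      | zero => simp [h1]
      | succ n => exact congrFun h n
    | zero => simp
    | add f g _ _ hf hg =>
      simp only [ContinuousMap.add_apply] at *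
      rw [integral_add (f.integrable_of_compactSpace _) (g.integrable_of_compactSpace _), hf, hg,
        integral_add (f.integrable_of_compactSpace _) (g.integrable_of_compactSpace _)]
    | smul c f _ hf =>
      simp only [ContinuousMap.smul_apply] at *
      rw [integral_smul, hf, integral_smul]
  exact Subtype.ext (ext_of_forall_integral_eq_of_IsFiniteMeasure (μ := (μ : Measure C))
    (ν := (ν : Measure C)) fun f ↦ hall f.toContinuousMap)

theorem convex_range_integralSeq (u : ℕ → C(C, ℝ)) : Convex ℝ (range (integralSeq u)) := by
  rintro _ ⟨μ, rfl⟩ _ ⟨ν, rfl⟩ s t hs ht hst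
  lift s to NNReal using hs
  lift t to NNReal using ht
  refine ⟨⟨s • (μ : Measure C) + t • (ν : Measure C), ⟨?_⟩⟩, funext fun i ↦ ?_⟩
  · simp only [Measure.add_apply, Measure.smul_apply, measure_univ, ENNReal.smul_def]
    simp only [smul_eq_mul, mul_one]
    exact_mod_cast hst
  · simp only [integralSeq, ProbabilityMeasure.coe_mk, Pi.add_apply, Pi.smul_apply]
    have hi : ∀ μ : ProbabilityMeasure C, Integrable (u i) (μ : Measure C) := fun μ ↦
      (u i).integrable_of_compactSpace _
    rw [integral_add_measure (hi μ).smul_measure_nnreal (hi ν).smul_measure_nnreal, integral_smul_nnreal_measure,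
      integral_smul_nnreal_measure]
    rfl

theorem interior_truncLast_integralSeq_nonempty [T2Space C] [Nonempty C] {w : ℕ → C(C, ℝ)}
    (h1 : w 0 = 1) (hw : LinearIndependent ℝ w) (n : ℕ) :
    (interior (truncLast n '' range (integralSeq fun i ↦ w (i + 1)))).Nonempty := by
  set L := truncLast n '' range (integralSeq fun i ↦ w (i + 1)) with hL
  have hc : Convex ℝ L := (convex_range_integralSeq _).linear_image _
  rw [hc.interior_nonempty_iff_affineSpan_eq_top]
  have hdirac : ∀ x : C, truncLast n (fun i ↦ w (i + 1) x) ∈ L := fun x ↦ by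
    refine ⟨_, ⟨⟨Measure.dirac x, inferInstance⟩, rfl⟩, ?_⟩
    congr 1
    funext i
    exact integral_dirac _ _
  obtain ⟨x₀⟩ := ‹Nonempty C›
  have hne : (affineSpan ℝ L : Set ((Fin n → ℝ) × ℝ)).Nonempty :=
    ⟨_, subset_affineSpan ℝ L (hdirac x₀)⟩
  rw [← AffineSubspace.direction_eq_top_iff_of_nonempty hne]
  by_contra htop
  obtain ⟨l, hl0, hl⟩ := Submodule.exists_le_ker_of_lt_top _ (lt_top_iff_ne_top.2 htop)
  have hconst : ∀ x, l (truncLast n fun i ↦ w (i + 1) x) =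
      l (truncLast n fun i ↦ w (i + 1) x₀) := fun x ↦ by
    have := hl (AffineSubspace.vsub_mem_direction (subset_affineSpan ℝ L (hdirac x))
      (subset_affineSpan ℝ L (hdirac x₀)))
    rwa [LinearMap.mem_ker, vsub_eq_sub, map_sub, sub_eq_zero] at this
  have hsum : ∀ k, l (truncLast n k) =
      ∑ i ∈ Finset.range (n + 1), l (truncLast n (Pi.single i 1)) * k i := fun k ↦ by
    have : truncLast n k = truncLast n (∑ i ∈ Finset.range (n + 1), k i • Pi.single i (1 : ℝ)) := by
      refine truncLast_eq_iff.2 fun i hi ↦ ?_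
      rw [Finset.sum_apply, Finset.sum_eq_single i (fun j _ hj ↦ by simp [hj.symm])
        (fun h ↦ absurd (Finset.mem_range.2 hi) h)]
      simp
    rw [this, map_sum, map_sum]
    exact Finset.sum_congr rfl fun i _ ↦ by rw [map_smul, map_smul, smul_eq_mul, mul_comm]
  let c : ℕ → ℝ := fun j ↦ Nat.casesOn j (-l (truncLast n fun i ↦ w (i + 1) x₀))
    fun i ↦ l (truncLast n (Pi.single i 1))
  have hc0 : ∑ j ∈ Finset.range (n + 2), c j • w j = 0 := by
    ext x
    rw [Finset.sum_range_succ', ContinuousMap.add_apply, ContinuousMap.sum_apply]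
    have h := (hsum _).symm.trans (hconst x)
    simp only [ContinuousMap.smul_apply, smul_eq_mul, h1, ContinuousMap.one_apply, mul_one,
      ContinuousMap.zero_apply, c, h]
    exact add_neg_cancel _
  have hc' := linearIndependent_iff'.1 hw _ c hc0
  refine hl0 (LinearMap.ext fun p ↦ ?_)
  obtain ⟨k, rfl⟩ := truncLast_surjective n p
  rw [hsum, LinearMap.zero_apply]
  refine Finset.sum_eq_zero fun i hi ↦ ?_
  rw [show l (truncLast n (Pi.single i 1)) = 0 from
    hc' (i + 1) (by simp only [Finset.mem_range] at hi ⊢; lia), zero_mul]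

end integralSeq

/-- **Keller-type theorem for spaces of measures.**
For an infinite compact metrizable space `C`, the space of Borel probability measures
on `C`, with the topology of weak convergence, is homeomorphic to the Hilbert cube
`ℕ → [0,1]` (with the product topology). -/
theorem probabilityMeasure_homeomorph_hilbertCube
    (C : Type*) [TopologicalSpace C] [CompactSpace C]
    [TopologicalSpace.MetrizableSpace C] [Infinite C]
    [MeasurableSpace C] [BorelSpace C] :
    Nonempty (ProbabilityMeasure C ≃ₜ (ℕ → unitInterval)) := by
  obtain ⟨w, h1, hw, hd⟩ := ContinuousMap.exists_linearIndependent_dense_span C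
  have hc := continuous_integralSeq fun i ↦ w (i + 1)
  obtain ⟨e⟩ := (convex_range_integralSeq fun i ↦ w (i + 1)).nonempty_homeomorph_hilbertCube
    (isCompact_range hc) (interior_truncLast_integralSeq_nonempty h1 hw)
  exact ⟨(hc.isClosedEmbedding (injective_integralSeq h1 hd)).isEmbedding.toHomeomorph.trans e⟩
end

section
/- Let C be an infinite compact metrizable space with a compatible metric d, and let P(C) denote the space of Borel probability measures on C with the topology of weak convergence, metrized by the Kantorovich metric K_d(μ,ν) = sup{ |∫_C f dμ − ∫_C f dν| : f : C → ℝ is 1-Lipschitz with respect to d }. Then the set Δ = { δ_a : a ∈ C } of Dirac measures is a Z-set in P(C): Δ is closed, and for every ε > 0 and every continuous map F from the Hilbert cube Q = ℕ → [0,1] to P(C) there is a continuous map G : Q → P(C) with G(Q) ∩ Δ = ∅ and K_d(F(q), G(q)) < ε for all q ∈ Q. -/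
open MeasureTheory Topology Set

/-- The Kantorovich metric on Borel probability measures induced by the metric of `C`:
`K_d(μ,ν) = sup { |∫ f dμ − ∫ f dν| : f 1-Lipschitz }`. -/
noncomputable def kantorovichDist {C : Type*} [MetricSpace C] [MeasurableSpace C]
    (μ ν : ProbabilityMeasure C) : ℝ :=
  sSup {r : ℝ | ∃ f : C → ℝ, LipschitzWith 1 f ∧
    r = |(∫ x, f x ∂(μ : Measure C)) - (∫ x, f x ∂(ν : Measure C))|}

/-- The Dirac probability measure at a point. -/
noncomputable def diracPM {C : Type*} [MeasurableSpace C] (a : C) : ProbabilityMeasure C :=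
  ⟨MeasureTheory.Measure.dirac a, inferInstance⟩

/-- The convex combination `s • μ + t • ν` of two probability measures. -/
noncomputable def mixPM {C : Type*} [MeasurableSpace C] (s t : NNReal) (hst : s + t = 1)
    (μ ν : ProbabilityMeasure C) : ProbabilityMeasure C :=
  ⟨s • (μ : Measure C) + t • (ν : Measure C), ⟨by
    simp only [Measure.coe_add, Measure.coe_nnreal_smul_apply, Pi.add_apply, measure_univ, mul_one]
    exact_mod_cast hst⟩⟩

theorem integral_mixPM {C : Type*} [MeasurableSpace C] {s t : NNReal} (hst : s + t = 1)
    (μ ν : ProbabilityMeasure C) {f : C → ℝ} (hμ : Integrable f (μ : Measure C))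
    (hν : Integrable f (ν : Measure C)) :
    ∫ x, f x ∂(mixPM s t hst μ ν : Measure C) =
      s * ∫ x, f x ∂(μ : Measure C) + t * ∫ x, f x ∂(ν : Measure C) := by
  change ∫ x, f x ∂(s • (μ : Measure C) + t • (ν : Measure C)) = _
  rw [integral_add_measure (hμ.smul_measure_nnreal) (hν.smul_measure_nnreal),
    integral_smul_nnreal_measure, integral_smul_nnreal_measure]
  rfl

theorem continuous_mixPM_left {C : Type*} [TopologicalSpace C] [MeasurableSpace C]
    [OpensMeasurableSpace C] {s t : NNReal} (hst : s + t = 1) (ν : ProbabilityMeasure C) :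
    Continuous fun μ : ProbabilityMeasure C ↦ mixPM s t hst μ ν := by
  refine continuous_iff_continuousAt.2 fun μ ↦ ?_
  refine ProbabilityMeasure.tendsto_iff_forall_integral_tendsto.2 fun f ↦ ?_
  have h := ProbabilityMeasure.tendsto_iff_forall_integral_tendsto.1
    (Filter.tendsto_id (x := 𝓝 μ)) f
  simp only [integral_mixPM hst _ _ (f.integrable _) (f.integrable _)]
  exact (h.const_mul (s : ℝ)).add_const _

theorem isClosed_range_diracPM (C : Type*) [TopologicalSpace C] [CompactSpace C]
    [HasOuterApproxClosed C] [MeasurableSpace C] [BorelSpace C] :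
    IsClosed (range (diracPM (C := C))) :=
  (isCompact_range (continuous_diracProba (X := C))).isClosed

theorem abs_integral_sub_apply_le_diam {C : Type*} [MetricSpace C] [CompactSpace C]
    [MeasurableSpace C] [BorelSpace C] (μ : ProbabilityMeasure C) {f : C → ℝ}
    (hf : LipschitzWith 1 f) (a : C) :
    |∫ x, f x ∂(μ : Measure C) - f a| ≤ Metric.diam (univ : Set C) := by
  have hi : Integrable f (μ : Measure C) :=
    (BoundedContinuousFunction.mkOfCompact ⟨f, hf.continuous⟩).integrable _
  have h : ∫ x, f x ∂(μ : Measure C) - f a = ∫ x, (f x - f a) ∂(μ : Measure C) := by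
    rw [integral_sub hi (integrable_const _)]
    simp
  rw [h, ← Real.norm_eq_abs]
  refine (norm_integral_le_of_norm_le_const (C := Metric.diam (univ : Set C))
    (.of_forall fun x ↦ ?_)).trans (by simp)
  rw [← dist_eq_norm]
  refine (hf.dist_le_mul x a).trans ?_
  simpa using Metric.dist_le_diam_of_mem isCompact_univ.isBounded (mem_univ x) (mem_univ a)

theorem kantorovichDist_mixPM_le {C : Type*} [MetricSpace C] [CompactSpace C]
    [MeasurableSpace C] [BorelSpace C] {s t : NNReal} (hst : s + t = 1)
    (μ ν : ProbabilityMeasure C) :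
    kantorovichDist μ (mixPM s t hst μ ν) ≤ t * (2 * Metric.diam (univ : Set C)) := by
  refine Real.sSup_le ?_ (by positivity)
  rintro _ ⟨f, hf, rfl⟩
  have hi (ρ : ProbabilityMeasure C) : Integrable f (ρ : Measure C) :=
    (BoundedContinuousFunction.mkOfCompact ⟨f, hf.continuous⟩).integrable _
  obtain ⟨a⟩ : Nonempty C := μ.nonempty
  have hs : (s : ℝ) = 1 - t := eq_sub_of_add_eq (by exact_mod_cast hst)
  have hμ := abs_integral_sub_apply_le_diam μ hf a
  have hν := abs_integral_sub_apply_le_diam ν hf a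
  rw [integral_mixPM hst _ _ (hi μ) (hi ν), hs]
  set I := ∫ x, f x ∂(μ : Measure C)
  set J := ∫ x, f x ∂(ν : Measure C)
  rw [show I - ((1 - t) * I + t * J) = t * ((I - f a) - (J - f a)) by ring, abs_mul,
    abs_of_nonneg t.coe_nonneg]
  gcongr
  exact (abs_sub _ _).trans (by linarith)

theorem measure_compl_singleton_eq_zero_of_mixPM_eq_diracPM {C : Type*} [MeasurableSpace C]
    [MeasurableSingletonClass C] {s t : NNReal} (hst : s + t = 1) (ht : t ≠ 0)
    {μ ν : ProbabilityMeasure C} {c : C} (h : mixPM s t hst μ ν = diracPM c) :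
    (ν : Measure C) {c}ᶜ = 0 := by
  have h' : (s • (μ : Measure C) + t • (ν : Measure C)) {c}ᶜ = Measure.dirac c {c}ᶜ :=
    congrArg (fun ρ : ProbabilityMeasure C ↦ (ρ : Measure C) {c}ᶜ) h
  simp only [Measure.coe_add, Measure.coe_nnreal_smul_apply, Pi.add_apply, Measure.dirac_apply,
    mem_compl_iff, mem_singleton_iff, not_true_eq_false, not_false_eq_true, indicator_of_notMem,
    add_eq_zero, mul_eq_zero, ENNReal.coe_eq_zero, ht, false_or] at h'
  exact h'.2

/-- **The set of Dirac measures is a `Z`-set in `P(C)`.**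
For an infinite compact metric space `C`, the set `Δ = {δ_a : a ∈ C}` of Dirac measures is
closed in `P(C)` (with the topology of weak convergence), and every continuous map of the
Hilbert cube into `P(C)` can be approximated, uniformly in the Kantorovich metric `K_d`,
by continuous maps avoiding `Δ`. -/
theorem dirac_measures_isZSet
    (C : Type*) [MetricSpace C] [CompactSpace C] [Infinite C]
    [MeasurableSpace C] [BorelSpace C] :
    IsClosed (Set.range (diracPM (C := C))) ∧
    ∀ ε > (0 : ℝ), ∀ F : HCube → ProbabilityMeasure C, Continuous F →
      ∃ G : HCube → ProbabilityMeasure C, Continuous G ∧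
        Set.range G ∩ Set.range (diracPM (C := C)) = ∅ ∧
        ∀ q : HCube, kantorovichDist (F q) (G q) < ε := by
  refine ⟨isClosed_range_diracPM C, fun ε hε F hF ↦ ?_⟩
  obtain ⟨a, b, hab⟩ := exists_pair_ne C
  set D := Metric.diam (univ : Set C)
  have hD : 0 ≤ D := Metric.diam_nonneg
  have ht1 : ε / (2 * D + 1 + ε) ≤ 1 := (div_le_one (by positivity)).2 (by linarith)
  let t : NNReal := ⟨ε / (2 * D + 1 + ε), by positivity⟩
  have hst : (1 - t) + t = 1 := tsub_add_cancel_of_le ht1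
  have ht : t ≠ 0 := fun h ↦ (show ε / (2 * D + 1 + ε) ≠ 0 by positivity) (congrArg NNReal.toReal h)
  let ν := mixPM (1 / 2) (1 / 2) (add_halves 1) (diracPM a) (diracPM b)
  refine ⟨fun q ↦ mixPM (1 - t) t hst (F q) ν, (continuous_mixPM_left hst ν).comp hF, ?_,
    fun q ↦ ?_⟩
  · refine disjoint_iff_inter_eq_empty.1 (disjoint_left.2 ?_)
    rintro _ ⟨q, rfl⟩ ⟨c, hc⟩
    have h : (((1 / 2 : NNReal) • Measure.dirac a + (1 / 2 : NNReal) • Measure.dirac b :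
        Measure C)) {c}ᶜ = 0 :=
      measure_compl_singleton_eq_zero_of_mixPM_eq_diracPM hst ht hc.symm
    have hac : a = c ∧ b = c := by simpa [indicator_apply] using h
    exact hab (hac.1.trans hac.2.symm)
  · refine (kantorovichDist_mixPM_le hst (F q) ν).trans_lt ?_
    change ε / (2 * D + 1 + ε) * (2 * D) < ε
    rw [div_mul_eq_mul_div, div_lt_iff₀ (by positivity)]
    nlinarith
end

section
/- Let C and D be nonempty compact metrizable spaces and φ : C → D a continuous map. Then the range of the pushforward map P(C) → P(D), μ ↦ φ_*μ, equals { μ ∈ P(D) : μ(φ(C)) = 1 }, where φ(C) is the (compact, hence Borel) image of φ. -/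
open MeasureTheory Topology Set

/-- The pushforward of a Borel probability measure by a measurable map. -/
noncomputable def pushPM {C D : Type*} [MeasurableSpace C] [MeasurableSpace D]
    {φ : C → D} (hφ : Measurable φ) (μ : ProbabilityMeasure C) : ProbabilityMeasure D :=
  μ.map hφ.aemeasurable

/-- Over a compact space, the pushforward map along a continuous function has closed range. -/
theorem isClosed_range_pushPM {C D : Type*} [TopologicalSpace C] [CompactSpace C] [T2Space C]
    [MeasurableSpace C] [BorelSpace C] [TopologicalSpace D] [MeasurableSpace D] [BorelSpace D]
    [HasOuterApproxClosed D] {φ : C → D} (hφ : Continuous φ) :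
    IsClosed (Set.range (pushPM hφ.measurable)) :=
  (isCompact_range (ProbabilityMeasure.continuous_map hφ)).isClosed

/-- Pointwise almost everywhere convergence of `g n` to the identity implies weak convergence
of the pushforwards of `μ` by `g n` to `μ`. -/
theorem tendsto_map_of_ae_tendsto_id {D : Type*} [TopologicalSpace D] [MeasurableSpace D]
    [BorelSpace D] (μ : ProbabilityMeasure D) {g : ℕ → D → D}
    (hg : ∀ n, Measurable (g n))
    (h : ∀ᵐ y ∂(μ : Measure D), Filter.Tendsto (fun n ↦ g n y) Filter.atTop (𝓝 y)) :
    Filter.Tendsto (fun n ↦ μ.map (hg n).aemeasurable) Filter.atTop (𝓝 μ) := by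
  rw [ProbabilityMeasure.tendsto_iff_forall_integral_tendsto]
  intro f
  have key (n : ℕ) : ∫ y, f y ∂(μ.map (hg n).aemeasurable : Measure D)
      = ∫ y, f (g n y) ∂(μ : Measure D) := by
    rw [ProbabilityMeasure.toMeasure_map]
    exact integral_map_of_stronglyMeasurable (hg n) f.continuous.measurable.stronglyMeasurable
  simp only [key]
  refine tendsto_integral_of_dominated_convergence (fun _ ↦ ‖f‖)
    (fun n ↦ (f.continuous.measurable.comp (hg n)).aestronglyMeasurable)
    (integrable_const _) (fun n ↦ .of_forall fun y ↦ f.norm_coe_le_norm _) ?_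
  filter_upwards [h] with y hy
  exact (f.continuous.tendsto y).comp hy

/-- **Range of the pushforward map.**
For nonempty compact metrizable `C`, `D` and continuous `φ : C → D`, the range of
`μ ↦ φ_*μ : P(C) → P(D)` is exactly the set of Borel probability measures giving full
mass to the image `φ(C)`. -/
theorem range_pushforward_eq
    {C D : Type*} [TopologicalSpace C] [CompactSpace C]
    [TopologicalSpace.MetrizableSpace C] [Nonempty C] [MeasurableSpace C] [BorelSpace C]
    [TopologicalSpace D] [CompactSpace D]
    [TopologicalSpace.MetrizableSpace D] [Nonempty D] [MeasurableSpace D] [BorelSpace D]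
    (φ : C → D) (hφ : Continuous φ) :
    Set.range (pushPM hφ.measurable)
      = {μ : ProbabilityMeasure D | (μ : Measure D) (Set.range φ) = 1} := by
  ext μ
  have hK : MeasurableSet (range φ) := (isCompact_range hφ).measurableSet
  constructor
  · rintro ⟨ν, rfl⟩
    have hpre : φ ⁻¹' range φ = univ := preimage_range φ
    simp only [mem_ofPred_eq, pushPM, ProbabilityMeasure.toMeasure_map,
      Measure.map_apply hφ.measurable hK, hpre, measure_univ]
  · intro hμ
    let _ : MetricSpace D := TopologicalSpace.metrizableSpaceMetric D
    obtain ⟨c⟩ := ‹Nonempty C›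
    let a : ℕ → SimpleFunc D D :=
      SimpleFunc.approxOn id measurable_id (range φ) (φ c) (mem_range_self c)
    let s : ℕ → SimpleFunc D C := fun n ↦ (a n).map (Function.invFun φ)
    have hs (n : ℕ) : φ ∘ s n = a n := by
      funext y
      exact Function.invFun_eq (SimpleFunc.approxOn_mem measurable_id (mem_range_self c) n y)
    have hlim := tendsto_map_of_ae_tendsto_id μ (fun n ↦ (a n).measurable) (by
      have hae : ∀ᵐ y ∂(μ : Measure D), y ∈ range φ :=
        (mem_ae_iff_prob_eq_one hK).2 hμ
      filter_upwards [hae] with y hy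
      exact SimpleFunc.tendsto_approxOn measurable_id (mem_range_self c) (subset_closure hy))
    refine (isClosed_range_pushPM hφ).mem_of_tendsto hlim (.of_forall fun n ↦ ?_)
    refine ⟨μ.map (s n).measurable.aemeasurable, Subtype.ext ?_⟩
    change ((μ : Measure D).map (s n)).map φ = (μ : Measure D).map (a n)
    rw [Measure.map_map hφ.measurable (s n).measurable, hs]
end

section
/- Let X be a nonempty separable metrizable space and d a bounded compatible metric on X. Let M(X) denote the set of equivalence classes, modulo equality Lebesgue-almost everywhere, of Lebesgue measurable functions from [0,1] to X, and define D(f,g) = ∫₀¹ d(f(t), g(t)) dt. Then: (1) D is a well-defined metric on M(X); (2) diam(M(X), D) = diam(X, d); (3) D is a complete metric if and only if d is a complete metric. -/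
open MeasureTheory Topology Set

/-- `M(X)`: equivalence classes, modulo equality Lebesgue-a.e., of Lebesgue measurable
functions from `[0,1]` to `X`. -/
abbrev MSpace (X : Type*) [TopologicalSpace X] :=
  MeasureTheory.AEEqFun I01 X (volume : Measure I01)

/-- The metric `D(f,g) = ∫₀¹ d(f(t),g(t)) dt` on `M(X)`. -/
noncomputable def mDist {X : Type*} [MetricSpace X] (f g : MSpace X) : ℝ :=
  ∫ t : I01, dist (f t) (g t) ∂(volume : Measure I01)

namespace MSpace

variable {X : Type*} [MetricSpace X]

instance isProbabilityMeasure_volume : IsProbabilityMeasure (volume : Measure I01) :=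
  inferInstanceAs (IsProbabilityMeasure (volume : Measure unitInterval))

theorem aestronglyMeasurable_dist (f g : MSpace X) :
    AEStronglyMeasurable (fun t : I01 => dist (f t) (g t)) volume :=
  (f.stronglyMeasurable.dist g.stronglyMeasurable).aestronglyMeasurable

theorem integrable_dist {C : ℝ} (hC : ∀ x y : X, dist x y ≤ C) (f g : MSpace X) :
    Integrable (fun t : I01 => dist (f t) (g t)) volume :=
  Integrable.of_bound (aestronglyMeasurable_dist f g) C
    (ae_of_all _ fun t => by simpa using hC (f t) (g t))

theorem mDist_nonneg (f g : MSpace X) : 0 ≤ mDist f g :=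
  integral_nonneg fun _ => dist_nonneg

theorem mDist_comm (f g : MSpace X) : mDist f g = mDist g f := by
  simp only [mDist, dist_comm]

theorem mDist_eq_zero_iff {C : ℝ} (hC : ∀ x y : X, dist x y ≤ C) (f g : MSpace X) :
    mDist f g = 0 ↔ f = g := by
  rw [mDist, integral_eq_zero_iff_of_nonneg (fun _ => dist_nonneg) (integrable_dist hC f g),
    AEEqFun.ext_iff]
  simp only [Filter.EventuallyEq, Pi.zero_apply, dist_eq_zero]

theorem mDist_triangle {C : ℝ} (hC : ∀ x y : X, dist x y ≤ C) (f g h : MSpace X) :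
    mDist f h ≤ mDist f g + mDist g h := by
  unfold mDist
  rw [← integral_add (integrable_dist hC f g) (integrable_dist hC g h)]
  exact integral_mono (integrable_dist hC f h)
    ((integrable_dist hC f g).add (integrable_dist hC g h)) fun _ => dist_triangle _ _ _

theorem mDist_le {C : ℝ} (hC : ∀ x y : X, dist x y ≤ C) (f g : MSpace X) : mDist f g ≤ C := by
  simpa [mDist] using
    integral_mono (integrable_dist hC f g) (integrable_const C) fun t => hC (f t) (g t)

theorem mDist_const_right (f : MSpace X) (x : X) :
    mDist f (AEEqFun.const I01 x) = ∫ t : I01, dist (f t) x :=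
  integral_congr_ae ((AEEqFun.coeFn_const I01 x).mono fun t ht => by simp [ht])

theorem mDist_const_const (x y : X) :
    mDist (AEEqFun.const I01 x) (AEEqFun.const I01 y : MSpace X) = dist x y := by
  rw [mDist_const_right,
    integral_congr_ae ((AEEqFun.coeFn_const (μ := volume) I01 x).mono fun t ht =>
      show _ = dist x y by simp [ht])]
  simp

theorem lintegral_edist {C : ℝ} (hC : ∀ x y : X, dist x y ≤ C) (f g : MSpace X) :
    ∫⁻ t : I01, edist (f t) (g t) = ENNReal.ofReal (mDist f g) := by
  rw [mDist, ofReal_integral_eq_lintegral_ofReal (integrable_dist hC f g)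
    (ae_of_all _ fun _ => dist_nonneg)]
  simp only [edist_dist]

theorem sSup_mDist_eq_diam [Nonempty X] {C : ℝ} (hC : ∀ x y : X, dist x y ≤ C) :
    sSup {r : ℝ | ∃ f g : MSpace X, r = mDist f g} = Metric.diam (univ : Set X) := by
  have hb : Bornology.IsBounded (univ : Set X) :=
    Metric.isBounded_iff.2 ⟨C, fun x _ y _ => hC x y⟩
  have hle : ∀ r ∈ {r : ℝ | ∃ f g : MSpace X, r = mDist f g}, r ≤ Metric.diam (univ : Set X) := by
    rintro _ ⟨f, g, rfl⟩
    exact mDist_le (fun x y => Metric.dist_le_diam_of_mem hb (mem_univ x) (mem_univ y)) f g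
  obtain ⟨x₀⟩ := ‹Nonempty X›
  apply le_antisymm
  · exact csSup_le ⟨_, AEEqFun.const I01 x₀, AEEqFun.const I01 x₀, rfl⟩ hle
  · refine Metric.diam_le_of_forall_dist_le ?_ fun x _ y _ => ?_
    · refine Real.sSup_nonneg ?_
      rintro _ ⟨f, g, rfl⟩
      exact mDist_nonneg f g
    · exact le_csSup ⟨_, hle⟩
        ⟨AEEqFun.const I01 x, AEEqFun.const I01 y, (mDist_const_const x y).symm⟩

/-- A sequence whose successive distances are summable converges in a complete target. -/
theorem exists_tendsto_of_mDist_succ_le [CompleteSpace X] {C : ℝ}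
    (hC : ∀ x y : X, dist x y ≤ C) {b : ℕ → ℝ} (hb : Summable b) (v : ℕ → MSpace X)
    (hv : ∀ k, mDist (v k) (v (k + 1)) ≤ b k) :
    ∃ f : MSpace X, Filter.Tendsto (fun k => mDist (v k) f) Filter.atTop (𝓝 0) := by
  have hmeas (k : ℕ) : AEMeasurable (fun t : I01 => edist (v k t) (v (k + 1) t)) volume := by
    simpa only [edist_dist] using
      (aestronglyMeasurable_dist (v k) (v (k + 1))).aemeasurable.ennreal_ofReal
  have hfin : ∫⁻ t : I01, ∑' k, edist (v k t) (v (k + 1) t) ≠ ⊤ := by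
    rw [lintegral_tsum hmeas]
    simp only [lintegral_edist hC]
    exact (hb.of_nonneg_of_le (fun _ => mDist_nonneg _ _) hv).tsum_ofReal_ne_top
  have hconv : ∀ᵐ t : I01, ∃ x, Filter.Tendsto (fun k => v k t) Filter.atTop (𝓝 x) := by
    filter_upwards [ae_lt_top' (AEMeasurable.tsum hmeas) hfin] with t ht
    exact cauchySeq_tendsto_of_complete
      (cauchySeq_of_edist_le_of_tsum_ne_top _ (fun _ => le_rfl) ht.ne)
  obtain ⟨F, hF, hlim⟩ := exists_stronglyMeasurable_limit_of_tendsto_ae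
    (fun k => (v k).aestronglyMeasurable) hconv
  refine ⟨AEEqFun.mk F hF.aestronglyMeasurable, ?_⟩
  rw [← integral_zero I01 ℝ (μ := volume)]
  refine tendsto_integral_of_dominated_convergence (fun _ => C)
    (fun k => aestronglyMeasurable_dist _ _) (integrable_const C)
    (fun k => ae_of_all _ fun t => by simpa using hC _ _) ?_
  filter_upwards [hlim, AEEqFun.coeFn_mk F hF.aestronglyMeasurable] with t ht hFt
  rw [hFt]
  exact tendsto_iff_dist_tendsto_zero.1 ht

theorem exists_limit_of_cauchy [CompleteSpace X] {C : ℝ} (hC : ∀ x y : X, dist x y ≤ C)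
    (u : ℕ → MSpace X)
    (hu : ∀ ε > (0 : ℝ), ∃ N, ∀ m ≥ N, ∀ n ≥ N, mDist (u m) (u n) < ε) :
    ∃ f : MSpace X, ∀ ε > (0 : ℝ), ∃ N, ∀ n ≥ N, mDist (u n) f < ε := by
  have hsub : ∀ k : ℕ, ∃ N, ∀ m ≥ N, ∀ n ≥ N, mDist (u m) (u n) < (1 / 2 : ℝ) ^ k :=
    fun k => hu _ (by positivity)
  obtain ⟨φ, hφ, hφu⟩ := Filter.extraction_forall_of_eventually'
    (P := fun k N => ∀ m ≥ N, ∀ n ≥ N, mDist (u m) (u n) < (1 / 2 : ℝ) ^ k) fun k =>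
      (hsub k).imp fun N hN M hM m hm n hn => hN m (hM.trans hm) n (hM.trans hn)
  obtain ⟨f, hf⟩ := exists_tendsto_of_mDist_succ_le hC summable_geometric_two (fun k => u (φ k))
    fun k => (hφu k _ le_rfl _ (hφ.monotone k.le_succ)).le
  refine ⟨f, fun ε hε => ?_⟩
  obtain ⟨N, hN⟩ := hu (ε / 2) (half_pos hε)
  obtain ⟨k, hk, hNk⟩ := ((hf.eventually (gt_mem_nhds (half_pos hε))).and
    (Filter.eventually_ge_atTop N)).exists
  refine ⟨N, fun n hn => ?_⟩
  linarith [mDist_triangle hC (u n) (u (φ k)) f, hN n hn (φ k) (hNk.trans (hφ.id_le k))]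

/-- If the constant functions of a Cauchy sequence converge in `M(X)`, the sequence converges. -/
theorem exists_tendsto_of_mDist_const {C : ℝ} (hC : ∀ x y : X, dist x y ≤ C) {x : ℕ → X}
    (hx : CauchySeq x) {f : MSpace X}
    (hf : Filter.Tendsto (fun n => mDist f (AEEqFun.const I01 (x n))) Filter.atTop (𝓝 0)) :
    ∃ y, Filter.Tendsto x Filter.atTop (𝓝 y) := by
  have hlim (y : X) : ∃ r, Filter.Tendsto (fun n => dist y (x n)) Filter.atTop (𝓝 r) :=
    cauchySeq_tendsto_of_complete
      ((LipschitzWith.dist_right y).uniformContinuous.comp_cauchySeq hx)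
  choose r hr using hlim
  have hmeas (n : ℕ) : AEStronglyMeasurable (fun t : I01 => dist (f t) (x n)) volume :=
    (f.stronglyMeasurable.dist stronglyMeasurable_const).aestronglyMeasurable
  have hint : Integrable (fun t : I01 => r (f t)) volume :=
    Integrable.of_bound
      (aestronglyMeasurable_of_tendsto_ae _ hmeas (ae_of_all _ fun t => hr (f t))) C
      (ae_of_all _ fun t => le_of_tendsto' (hr (f t)).norm fun n => by simpa using hC _ _)
  have hzero : ∫ t : I01, r (f t) = 0 := by
    simp only [mDist_const_right] at hf
    exact tendsto_nhds_unique (tendsto_integral_of_dominated_convergence (fun _ => C) hmeas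
      (integrable_const C) (fun n => ae_of_all _ fun t => by simpa using hC _ _)
      (ae_of_all _ fun t => hr (f t))) hf
  rw [integral_eq_zero_iff_of_nonneg
    (fun t => ge_of_tendsto' (hr (f t)) fun _ => dist_nonneg) hint] at hzero
  obtain ⟨t, ht⟩ := hzero.exists
  refine ⟨f t, tendsto_iff_dist_tendsto_zero.2 ?_⟩
  simpa only [dist_comm, show r (f t) = 0 from ht] using hr (f t)

theorem completeSpace_of_cauchy_limits {C : ℝ} (hC : ∀ x y : X, dist x y ≤ C)
    (h : ∀ u : ℕ → MSpace X,
      (∀ ε > (0 : ℝ), ∃ N, ∀ m ≥ N, ∀ n ≥ N, mDist (u m) (u n) < ε) →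
      ∃ f : MSpace X, ∀ ε > (0 : ℝ), ∃ N, ∀ n ≥ N, mDist (u n) f < ε) :
    CompleteSpace X := by
  refine Metric.complete_of_cauchySeq_tendsto fun x hx => ?_
  obtain ⟨f, hf⟩ := h (fun n => AEEqFun.const I01 (x n)) (by
    simpa only [mDist_const_const] using Metric.cauchySeq_iff.1 hx)
  refine exists_tendsto_of_mDist_const hC hx (f := f) (Metric.tendsto_atTop.2 fun ε hε => ?_)
  refine (hf ε hε).imp fun N hN n hn => ?_
  rw [Real.dist_0_eq_abs, abs_of_nonneg (mDist_nonneg _ _), mDist_comm]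
  exact hN n hn

end MSpace

/-- **The metric on the space of measurable functions.**
For a nonempty separable metric space `X` with bounded metric `d`, the function
`D(f,g) = ∫₀¹ d(f(t),g(t)) dt` is a (well-defined) metric on `M(X)`,
`diam (M(X), D) = diam (X, d)`, and `D` is complete iff `d` is complete. -/
theorem mSpace_metric_properties
    (X : Type*) [MetricSpace X] [TopologicalSpace.SeparableSpace X] [Nonempty X]
    (hbdd : ∃ C : ℝ, ∀ x y : X, dist x y ≤ C) :
    (∀ f g : MSpace X, 0 ≤ mDist f g) ∧
    (∀ f g : MSpace X, mDist f g = mDist g f) ∧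
    (∀ f g : MSpace X, mDist f g = 0 ↔ f = g) ∧
    (∀ f g h : MSpace X, mDist f h ≤ mDist f g + mDist g h) ∧
    sSup {r : ℝ | ∃ f g : MSpace X, r = mDist f g} = Metric.diam (Set.univ : Set X) ∧
    ((∀ u : ℕ → MSpace X,
        (∀ ε > (0 : ℝ), ∃ N, ∀ m ≥ N, ∀ n ≥ N, mDist (u m) (u n) < ε) →
        ∃ f : MSpace X, ∀ ε > (0 : ℝ), ∃ N, ∀ n ≥ N, mDist (u n) f < ε)
      ↔ CompleteSpace X) := by
  obtain ⟨C, hC⟩ := hbdd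
  exact ⟨MSpace.mDist_nonneg, MSpace.mDist_comm, MSpace.mDist_eq_zero_iff hC,
    MSpace.mDist_triangle hC, MSpace.sSup_mDist_eq_diam hC,
    MSpace.completeSpace_of_cauchy_limits hC, fun _ => MSpace.exists_limit_of_cauchy hC⟩
end

section
/- Let X be a nonempty separable metrizable space with a bounded compatible metric d, and let (M(X), D) be the metric space of equivalence classes (modulo Lebesgue-a.e. equality) of Lebesgue measurable functions [0,1] → X with D(f,g) = ∫₀¹ d(f(t), g(t)) dt. For A ⊆ X, let M(A) = { [u] ∈ M(X) : u(t) ∈ A for almost every t ∈ [0,1] }. Then the closure of M(A) in (M(X), D) equals M(Ā), where Ā is the closure of A in X. -/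
open MeasureTheory Topology Set TopologicalSpace

/-- The topology induced by a distance function `ρ` on `S`: the topology generated
by the `ρ`-balls. -/
def metricTop {S : Type*} (ρ : S → S → ℝ) : TopologicalSpace S :=
  TopologicalSpace.generateFrom
    {U : Set S | ∃ (c : S) (ε : ℝ), 0 < ε ∧ U = {y : S | ρ c y < ε}}

/-- `M(A) ⊆ M(X)`: classes of functions taking values in `A` almost everywhere. -/
def mSet {X : Type*} [TopologicalSpace X] (A : Set X) : Set (MSpace X) :=
  {f : MSpace X | ∀ᵐ t ∂(volume : Measure I01), f t ∈ A}

lemma integrable_dist_coeFn {X : Type*} [MetricSpace X]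
    (hbdd : ∃ C : ℝ, ∀ x y : X, dist x y ≤ C) (f g : MSpace X) :
    Integrable (fun t : I01 ↦ dist (f t) (g t)) := by
  obtain ⟨C, hC⟩ := hbdd
  refine Integrable.of_bound
    (f.stronglyMeasurable.dist g.stronglyMeasurable).aestronglyMeasurable C (.of_forall fun t ↦ ?_)
  rw [Real.norm_of_nonneg dist_nonneg]
  exact hC _ _

lemma mDist_self {X : Type*} [MetricSpace X] (f : MSpace X) : mDist f f = 0 := by
  simp [mDist]

lemma mDist_triangle {X : Type*} [MetricSpace X]
    (hbdd : ∃ C : ℝ, ∀ x y : X, dist x y ≤ C) (f g h : MSpace X) :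
    mDist f h ≤ mDist f g + mDist g h := by
  have hfg := integrable_dist_coeFn hbdd f g
  have hgh := integrable_dist_coeFn hbdd g h
  unfold mDist
  rw [← integral_add hfg hgh]
  exact integral_mono (integrable_dist_coeFn hbdd f h) (hfg.add hgh)
    fun t ↦ dist_triangle _ _ _

/-- A sequence whose distance to `f` tends to zero converges to `f` in the topology generated by
the balls, provided the distance function satisfies the triangle inequality. -/
lemma tendsto_metricTop_of_tendsto_zero {S : Type*} {ρ : S → S → ℝ}
    (htri : ∀ a b c, ρ a c ≤ ρ a b + ρ b c) {f : S} {u : ℕ → S}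
    (hu : Filter.Tendsto (fun n ↦ ρ f (u n)) Filter.atTop (𝓝 0)) :
    Filter.Tendsto u Filter.atTop (@nhds S (metricTop ρ) f) := by
  rw [metricTop, tendsto_nhds_generateFrom_iff]
  rintro _ ⟨c, ε, -, rfl⟩ hf
  have hf : ρ c f < ε := hf
  filter_upwards [hu.eventually_lt_const (sub_pos.2 hf)] with n hn
  have := htri c f (u n)
  change ρ c (u n) < ε
  linarith

lemma exists_mem_lt_of_mem_closure_metricTop {S : Type*} {ρ : S → S → ℝ} {f : S} {s : Set S}
    (hself : ρ f f = 0) (hf : f ∈ @closure S (metricTop ρ) s) {ε : ℝ} (hε : 0 < ε) :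
    ∃ g ∈ s, ρ f g < ε := by
  let := metricTop ρ
  obtain ⟨g, hg, hgs⟩ := mem_closure_iff.1 hf {y | ρ f y < ε}
    (isOpen_generateFrom_of_mem ⟨f, ε, hε, rfl⟩) (by simpa [hself] using hε)
  exact ⟨g, hgs, hg⟩

lemma mem_mSet_closure_of_forall_exists_mDist_lt {X : Type*} [MetricSpace X]
    (hbdd : ∃ C : ℝ, ∀ x y : X, dist x y ≤ C) {A : Set X} {f : MSpace X}
    (hf : ∀ ε > 0, ∃ g ∈ mSet A, mDist f g < ε) : f ∈ mSet (closure A) := by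
  have hA : A.Nonempty := by
    obtain ⟨g, hg, -⟩ := hf 1 one_pos
    have hg : ∀ᵐ t, g t ∈ A := hg
    obtain ⟨t, ht⟩ := hg.exists
    exact ⟨_, ht⟩
  have hle : ∀ g ∈ mSet A, ∀ᵐ t, Metric.infDist (f t) A ≤ dist (f t) (g t) := fun g hg ↦ by
    have hg : ∀ᵐ t, g t ∈ A := hg
    filter_upwards [hg] with t ht using Metric.infDist_le_dist_of_mem ht
  have hint : Integrable (fun t : I01 ↦ Metric.infDist (f t) A) := by
    obtain ⟨g, hg, -⟩ := hf 1 one_pos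
    refine (integrable_dist_coeFn hbdd f g).mono'
      ((Metric.continuous_infDist_pt A).comp_stronglyMeasurable
        f.stronglyMeasurable).aestronglyMeasurable ?_
    filter_upwards [hle g hg] with t ht
    rwa [Real.norm_of_nonneg Metric.infDist_nonneg]
  have hzero : ∫ t : I01, Metric.infDist (f t) A = 0 := by
    refine le_antisymm (le_of_forall_pos_le_add fun ε hε ↦ ?_)
      (integral_nonneg fun t ↦ Metric.infDist_nonneg)
    obtain ⟨g, hg, hlt⟩ := hf ε hε
    rw [zero_add]
    exact (integral_mono_ae hint (integrable_dist_coeFn hbdd f g) (hle g hg)).trans hlt.le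
  have hae := (integral_eq_zero_iff_of_nonneg (fun t ↦ Metric.infDist_nonneg) hint).1 hzero
  change ∀ᵐ t, f t ∈ closure A
  filter_upwards [hae] with t ht
  exact (Metric.mem_closure_iff_infDist_zero hA).2 ht

lemma exists_seq_mem_mSet_tendsto_mDist {X : Type*} [MetricSpace X] [SeparableSpace X]
    (hbdd : ∃ C : ℝ, ∀ x y : X, dist x y ≤ C) {A : Set X} {f : MSpace X}
    (hf : f ∈ mSet (closure A)) :
    ∃ u : ℕ → MSpace X, (∀ n, u n ∈ mSet A) ∧
      Filter.Tendsto (fun n ↦ mDist f (u n)) Filter.atTop (𝓝 0) := by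
  have hf : ∀ᵐ t, f t ∈ closure A := hf
  obtain ⟨a, ha⟩ : A.Nonempty := by
    obtain ⟨t, ht⟩ := hf.exists
    exact closure_nonempty_iff.1 ⟨_, ht⟩
  let : MeasurableSpace X := borel X
  have : BorelSpace X := ⟨rfl⟩
  have : SecondCountableTopology X := UniformSpace.secondCountable_of_separable X
  let s := SimpleFunc.approxOn f f.stronglyMeasurable.measurable A a ha
  let u : ℕ → MSpace X := fun n ↦ AEEqFun.mk (s n) (s n).stronglyMeasurable.aestronglyMeasurable
  have hu : ∀ n, u n =ᵐ[volume] s n := fun n ↦ AEEqFun.coeFn_mk _ _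
  refine ⟨u, fun n ↦ ?_, ?_⟩
  · change ∀ᵐ t, u n t ∈ A
    filter_upwards [hu n] with t ht
    rw [ht]
    exact SimpleFunc.approxOn_mem _ ha n t
  obtain ⟨C, hC⟩ := hbdd
  have hlim : Filter.Tendsto (fun n ↦ ∫ t : I01, dist (f t) (u n t)) Filter.atTop
      (𝓝 (∫ _ : I01, (0 : ℝ))) := by
    refine tendsto_integral_of_dominated_convergence (fun _ ↦ C)
      (fun n ↦ (integrable_dist_coeFn ⟨C, hC⟩ f (u n)).aestronglyMeasurable)
      (integrable_const C) (fun n ↦ .of_forall fun t ↦ ?_) ?_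
    · rw [Real.norm_of_nonneg dist_nonneg]
      exact hC _ _
    · filter_upwards [hf, ae_all_iff.2 hu] with t ht hut
      simp_rw [hut]
      simpa using (tendsto_const_nhds (x := f t)).dist
        (SimpleFunc.tendsto_approxOn f.stronglyMeasurable.measurable ha ht)
  simpa [mDist] using hlim

/-- **Closure of `M(A)` in `(M(X), D)`.**
For a nonempty separable metric space `X` with bounded metric and `A ⊆ X`, the closure of
`M(A)` in `(M(X), D)` equals `M(Ā)`. -/
theorem closure_mSet_eq
    (X : Type*) [MetricSpace X] [TopologicalSpace.SeparableSpace X] [Nonempty X]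
    (hbdd : ∃ C : ℝ, ∀ x y : X, dist x y ≤ C) (A : Set X) :
    @closure (MSpace X) (metricTop (mDist (X := X))) (mSet A) = mSet (closure A) := by
  refine Subset.antisymm (fun f hf ↦ ?_) fun f hf ↦ ?_
  · exact mem_mSet_closure_of_forall_exists_mDist_lt hbdd fun ε hε ↦
      exists_mem_lt_of_mem_closure_metricTop (mDist_self f) hf hε
  · obtain ⟨u, hu, hlim⟩ := exists_seq_mem_mSet_tendsto_mDist hbdd hf
    exact @mem_closure_of_tendsto (MSpace X) (metricTop mDist) _ _ _ _ _ _
      (tendsto_metricTop_of_tendsto_zero (mDist_triangle hbdd) hlim) (.of_forall hu)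
end
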